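/- X_apr (resp. X_pr) is Zariski dense in X if and only if Y_apr (resp. Y_pr) is Zariski dense in Y = X_ℂ. -/

import Mathlib

/-!
Common framework: a "compact Lie group / complex reductive group acting on a
finite-dimensional module" is modelled as a subgroup of invertible `n × n`
matrices over `𝕜 = ℝ` or `ℂ` acting on `Fin n → 𝕜` by `Matrix.mulVec`.
Polynomial functions on the module are `MvPolynomial (Fin n) 𝕜`.
-/

set_option synthInstance.maxHeartbeats 1000000
set_option maxHeartbeats 1000000

noncomputable section

open MvPolynomial

namespace ZPaper

variable (𝕜 : Type) [RCLike 𝕜] (n : ℕ)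

/-- The zero set of a family of polynomials. -/
def zeroSet (S : Set (MvPolynomial (Fin n) 𝕜)) : Set (Fin n → 𝕜) :=
  {v | ∀ p ∈ S, eval v p = 0}

/-- A subset of `𝕜ⁿ` is algebraic if it is the zero set of a family of polynomials. -/
def IsAlgebraicSet (X : Set (Fin n → 𝕜)) : Prop :=
  ∃ S : Set (MvPolynomial (Fin n) 𝕜), X = zeroSet 𝕜 n S

/-- The vanishing ideal `I(X)` of a subset `X ⊆ 𝕜ⁿ`. -/
def vanishingIdeal (X : Set (Fin n → 𝕜)) : Ideal (MvPolynomial (Fin n) 𝕜) where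
  carrier := {p | ∀ x ∈ X, eval x p = 0}
  zero_mem' := by intro x _; simp
  add_mem' := by intro a b ha hb x hx; simp [ha x hx, hb x hx]
  smul_mem' := by intro c p hp x hx; simp [smul_eq_mul, hp x hx]

/-- The Zariski closure of a subset of `𝕜ⁿ`. -/
def zclosure (A : Set (Fin n → 𝕜)) : Set (Fin n → 𝕜) :=
  zeroSet 𝕜 n (vanishingIdeal 𝕜 n A : Set (MvPolynomial (Fin n) 𝕜))

/-- `A` is Zariski dense in `X`: every polynomial vanishing on `A` vanishes on `X`. -/
def ZDenseIn (A X : Set (Fin n → 𝕜)) : Prop :=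
  ∀ p : MvPolynomial (Fin n) 𝕜, (∀ a ∈ A, eval a p = 0) → ∀ x ∈ X, eval x p = 0

/-- A set of matrices is a subgroup of `GL_n(𝕜)`. -/
def IsMatSubgroup (G : Set (Matrix (Fin n) (Fin n) 𝕜)) : Prop :=
  (1 : Matrix (Fin n) (Fin n) 𝕜) ∈ G ∧ (∀ a ∈ G, ∀ b ∈ G, a * b ∈ G) ∧
    ∀ a ∈ G, IsUnit a ∧ a⁻¹ ∈ G

/-- `X` is a `G`-stable subset of `𝕜ⁿ`. -/
def Stabilizes (G : Set (Matrix (Fin n) (Fin n) 𝕜)) (X : Set (Fin n → 𝕜)) : Prop :=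
  ∀ g ∈ G, ∀ x ∈ X, Matrix.mulVec g x ∈ X

/-- A polynomial is `G`-invariant. -/
def Invariant (G : Set (Matrix (Fin n) (Fin n) 𝕜)) (p : MvPolynomial (Fin n) 𝕜) : Prop :=
  ∀ g ∈ G, ∀ v : Fin n → 𝕜, eval (Matrix.mulVec g v) p = eval v p

/-- `I_G(X)`: the ideal generated by the `G`-invariant polynomials vanishing on `X`,
i.e. by `I(X)^G = I(X) ∩ 𝕜[V]^G`. -/
def invariantIdeal (G : Set (Matrix (Fin n) (Fin n) 𝕜)) (X : Set (Fin n → 𝕜)) :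
    Ideal (MvPolynomial (Fin n) 𝕜) :=
  Ideal.span {p | Invariant 𝕜 n G p ∧ ∀ x ∈ X, eval x p = 0}

/-- `X` is `G`-reduced: `I_G(X) = I(X)`. -/
def IsGReduced (G : Set (Matrix (Fin n) (Fin n) 𝕜)) (X : Set (Fin n → 𝕜)) : Prop :=
  invariantIdeal 𝕜 n G X = vanishingIdeal 𝕜 n X

/-- `X` is almost `G`-reduced: `√I_G(X) = I(X)`. -/
def IsAlmostGReduced (G : Set (Matrix (Fin n) (Fin n) 𝕜)) (X : Set (Fin n → 𝕜)) : Prop :=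
  (invariantIdeal 𝕜 n G X).radical = vanishingIdeal 𝕜 n X

/-- The orbit `G·v`. -/
def orbit (G : Set (Matrix (Fin n) (Fin n) 𝕜)) (v : Fin n → 𝕜) : Set (Fin n → 𝕜) :=
  (fun g => Matrix.mulVec g v) '' G

/-- The isotropy group `G_v`. -/
def isotropy (G : Set (Matrix (Fin n) (Fin n) 𝕜)) (v : Fin n → 𝕜) :
    Set (Matrix (Fin n) (Fin n) 𝕜) :=
  {g ∈ G | Matrix.mulVec g v = v}

/-- Matrix exponential. -/
def mexp (A : Matrix (Fin n) (Fin n) 𝕜) : Matrix (Fin n) (Fin n) 𝕜 :=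
  ∑' k : ℕ, ((k.factorial : 𝕜)⁻¹) • A ^ k

/-- The Lie algebra of a matrix group: matrices whose one-parameter subgroup lies in `G`. -/
def lieAlgebra (G : Set (Matrix (Fin n) (Fin n) 𝕜)) : Set (Matrix (Fin n) (Fin n) 𝕜) :=
  {A | ∀ t : 𝕜, mexp 𝕜 n (t • A) ∈ G}

/-- The tangent space `T_v(G·v)` to the orbit, i.e. `𝔤·v`. -/
def orbitTangent (G : Set (Matrix (Fin n) (Fin n) 𝕜)) (v : Fin n → 𝕜) :
    Submodule 𝕜 (Fin n → 𝕜) :=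
  Submodule.span 𝕜 ((fun A => Matrix.mulVec A v) '' lieAlgebra 𝕜 n G)

/-- `N` is a `G_v`-stable complement to `T_v(G·v)` in `𝕜ⁿ` (a slice at `v`). -/
def IsSliceComplement (G : Set (Matrix (Fin n) (Fin n) 𝕜)) (v : Fin n → 𝕜)
    (N : Submodule 𝕜 (Fin n → 𝕜)) : Prop :=
  IsCompl (orbitTangent 𝕜 n G v) N ∧
    ∀ g ∈ isotropy 𝕜 n G v, ∀ x ∈ N, Matrix.mulVec g x ∈ N

/-- The image of `H` in `GL(N)` is trivial. -/
def ActsTriviallyOn (H : Set (Matrix (Fin n) (Fin n) 𝕜))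
    (N : Submodule 𝕜 (Fin n → 𝕜)) : Prop :=
  ∀ g ∈ H, ∀ x ∈ N, Matrix.mulVec g x = x

/-- The image of `H` in `GL(N)` is finite. -/
def HasFiniteImageOn (H : Set (Matrix (Fin n) (Fin n) 𝕜))
    (N : Submodule 𝕜 (Fin n → 𝕜)) : Prop :=
  Set.Finite ((fun g => fun x : N => Matrix.mulVec g (x : Fin n → 𝕜)) '' H)

/-- The orbit `G·v` is (Zariski) closed. -/
def HasClosedOrbit (G : Set (Matrix (Fin n) (Fin n) 𝕜)) (v : Fin n → 𝕜) : Prop :=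
  zclosure 𝕜 n (orbit 𝕜 n G v) ⊆ orbit 𝕜 n G v

/-- `v` lies on a principal orbit: `G·v` is closed and the isotropy group acts trivially on
some (hence any) slice at `v`. -/
def IsPrincipalPt (G : Set (Matrix (Fin n) (Fin n) 𝕜)) (v : Fin n → 𝕜) : Prop :=
  HasClosedOrbit 𝕜 n G v ∧
    ∃ N, IsSliceComplement 𝕜 n G v N ∧ ActsTriviallyOn 𝕜 n (isotropy 𝕜 n G v) N

/-- `v` lies on an almost principal orbit. -/
def IsAlmostPrincipalPt (G : Set (Matrix (Fin n) (Fin n) 𝕜)) (v : Fin n → 𝕜) : Prop :=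
  HasClosedOrbit 𝕜 n G v ∧
    ∃ N, IsSliceComplement 𝕜 n G v N ∧ HasFiniteImageOn 𝕜 n (isotropy 𝕜 n G v) N

/-- The set of principal points `V_pr`. -/
def prPoints (G : Set (Matrix (Fin n) (Fin n) 𝕜)) : Set (Fin n → 𝕜) :=
  {v | IsPrincipalPt 𝕜 n G v}

/-- The set of almost principal points `V_apr`. -/
def aprPoints (G : Set (Matrix (Fin n) (Fin n) 𝕜)) : Set (Fin n → 𝕜) :=
  {v | IsAlmostPrincipalPt 𝕜 n G v}

/-- `π⁻¹(π(Y))`: all points that the invariants cannot separate from `Y`. -/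
def saturation (G : Set (Matrix (Fin n) (Fin n) 𝕜)) (Y : Set (Fin n → 𝕜)) :
    Set (Fin n → 𝕜) :=
  {v | ∃ y ∈ Y, ∀ p, Invariant 𝕜 n G p → eval v p = eval y p}

/-- `Y` is `G`-saturated: `Y = π⁻¹(π(Y))`. -/
def IsSaturated (G : Set (Matrix (Fin n) (Fin n) 𝕜)) (Y : Set (Fin n → 𝕜)) : Prop :=
  Y = saturation 𝕜 n G Y

/-- The fiber `π⁻¹(π(v))` of the quotient morphism. -/
def piFiber (G : Set (Matrix (Fin n) (Fin n) 𝕜)) (v : Fin n → 𝕜) : Set (Fin n → 𝕜) :=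
  {u | ∀ p, Invariant 𝕜 n G p → eval u p = eval v p}

/-- The invariant ring `𝕜[V]^G` as a subalgebra of `𝕜[V]`. -/
def invariantSubalgebra (G : Set (Matrix (Fin n) (Fin n) 𝕜)) :
    Subalgebra 𝕜 (MvPolynomial (Fin n) 𝕜) where
  carrier := {p | Invariant 𝕜 n G p}
  mul_mem' := by intro a b ha hb g hg v; simp [ha g hg v, hb g hg v]
  one_mem' := by intro g hg v; simp
  add_mem' := by intro a b ha hb g hg v; simp [ha g hg v, hb g hg v]
  zero_mem' := by intro g hg v; simp
  algebraMap_mem' := by intro r g hg v; simp [MvPolynomial.algebraMap_eq]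

/-- The representation is cofree: `𝕜[V]` is a free module over `𝕜[V]^G`. -/
def IsCofree (G : Set (Matrix (Fin n) (Fin n) 𝕜)) : Prop :=
  Module.Free ↥(invariantSubalgebra 𝕜 n G) (MvPolynomial (Fin n) 𝕜)

/-- The vanishing ideal of `π(Y)` in `𝕜[V//G] = 𝕜[V]^G`. -/
def quotVanishingIdeal (G : Set (Matrix (Fin n) (Fin n) 𝕜)) (Y : Set (Fin n → 𝕜)) :
    Ideal ↥(invariantSubalgebra 𝕜 n G) where
  carrier := {p | ∀ y ∈ Y, eval y (p : MvPolynomial (Fin n) 𝕜) = 0}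
  zero_mem' := by intro y hy; simp
  add_mem' := by intro a b ha hb y hy; simp [ha y hy, hb y hy]
  smul_mem' := by intro c p hp y hy; simp [smul_eq_mul, hp y hy]

/-- The module is stable: there is a nonempty Zariski-open set of points with closed orbit. -/
def IsStableModule (G : Set (Matrix (Fin n) (Fin n) 𝕜)) : Prop :=
  ∃ U : Set (Fin n → 𝕜), U.Nonempty ∧ IsAlgebraicSet 𝕜 n Uᶜ ∧
    ∀ v ∈ U, HasClosedOrbit 𝕜 n G v

/-- `G` is Zariski closed in `GL_n(𝕜)`. -/
def IsZClosedInGL (G : Set (Matrix (Fin n) (Fin n) 𝕜)) : Prop :=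
  ∃ P : Set (MvPolynomial (Fin n × Fin n) 𝕜),
    G = {g | IsUnit g ∧ ∀ p ∈ P, eval (fun ij => g ij.1 ij.2) p = 0}

/-- `G` is a (linearly) reductive algebraic group: a Zariski closed subgroup of `GL_n`
containing a Zariski-dense compact subgroup (the unitarian trick characterization). -/
def IsReductiveGroup (G : Set (Matrix (Fin n) (Fin n) 𝕜)) : Prop :=
  IsMatSubgroup 𝕜 n G ∧ IsZClosedInGL 𝕜 n G ∧
    ∃ K : Set (Matrix (Fin n) (Fin n) 𝕜), K ⊆ G ∧ IsCompact K ∧ IsMatSubgroup 𝕜 n K ∧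
      ∀ p : MvPolynomial (Fin n × Fin n) 𝕜,
        (∀ k ∈ K, eval (fun ij => k ij.1 ij.2) p = 0) →
          ∀ g ∈ G, eval (fun ij => g ij.1 ij.2) p = 0

/-- The isotropy groups of `v` and `w` are conjugate in `G`. -/
def ConjIsotropy (G : Set (Matrix (Fin n) (Fin n) 𝕜)) (v w : Fin n → 𝕜) : Prop :=
  ∃ g ∈ G, isotropy 𝕜 n G w = (fun h => g * h * g⁻¹) '' isotropy 𝕜 n G v

/-- The (Luna) stratum of `V` determined by a point `v` with closed orbit: the inverse image
under `π` of the set of closed orbits with isotropy group conjugate to `G_v`. -/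
def stratumOf (G : Set (Matrix (Fin n) (Fin n) 𝕜)) (v : Fin n → 𝕜) : Set (Fin n → 𝕜) :=
  {u | ∃ w, HasClosedOrbit 𝕜 n G w ∧ w ∈ zclosure 𝕜 n (orbit 𝕜 n G u) ∧
    ConjIsotropy 𝕜 n G v w}

/-- Dimension of (the Zariski closure of) a subset of `𝕜ⁿ`, as the Krull dimension of its
coordinate ring. -/
def adim (X : Set (Fin n → 𝕜)) : WithBot ℕ∞ :=
  ringKrullDim (MvPolynomial (Fin n) 𝕜 ⧸ vanishingIdeal 𝕜 n X)

/-- A nonempty algebraic set with prime vanishing ideal, i.e. an irreducible algebraic set. -/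
def IsIrredAlg (Z : Set (Fin n → 𝕜)) : Prop :=
  IsAlgebraicSet 𝕜 n Z ∧ Z.Nonempty ∧ (vanishingIdeal 𝕜 n Z).IsPrime

/-- `Z` is an irreducible component of `Y`. -/
def IsIrredComponentOf (Y Z : Set (Fin n → 𝕜)) : Prop :=
  IsIrredAlg 𝕜 n Z ∧ Z ⊆ Y ∧
    ∀ Z', IsIrredAlg 𝕜 n Z' → Z ⊆ Z' → Z' ⊆ Y → Z' = Z

/-- The rank at `v` of the differential of `f = (f_1, …, f_d) : V → 𝕜^d`. -/
def jacRank {d : ℕ} (f : Fin d → MvPolynomial (Fin n) 𝕜) (v : Fin n → 𝕜) : ℕ :=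
  (Matrix.of fun (i : Fin d) (j : Fin n) => eval v (pderiv j (f i))).rank

/-- A polynomial is `H`-invariant as a function on the submodule `N`. -/
def InvariantOn (H : Set (Matrix (Fin n) (Fin n) 𝕜)) (N : Submodule 𝕜 (Fin n → 𝕜))
    (p : MvPolynomial (Fin n) 𝕜) : Prop :=
  ∀ g ∈ H, ∀ x ∈ N, eval (Matrix.mulVec g x) p = eval x p

/-- The null cone of the `H`-module `N`: points of `N` which the `H`-invariant functions on `N`
cannot separate from `0`. -/
def sliceNullCone (H : Set (Matrix (Fin n) (Fin n) 𝕜)) (N : Submodule 𝕜 (Fin n → 𝕜)) :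
    Set (Fin n → 𝕜) :=
  {x | x ∈ N ∧ ∀ p, InvariantOn 𝕜 n H N p → eval x p = eval (0 : Fin n → 𝕜) p}

/-- The `H`-module `N` is coreduced: the vanishing ideal of its null cone in `𝕜[N]` is
generated by `H`-invariant functions.  (Stated in `𝕜[V]`: the vanishing ideal of the null
cone equals the ideal generated by the invariant functions vanishing on it together with the
vanishing ideal of `N`.) -/
def CoreducedOn (H : Set (Matrix (Fin n) (Fin n) 𝕜)) (N : Submodule 𝕜 (Fin n → 𝕜)) : Prop :=
  vanishingIdeal 𝕜 n (sliceNullCone 𝕜 n H N) =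
    Ideal.span ({p | InvariantOn 𝕜 n H N p ∧ ∀ x ∈ sliceNullCone 𝕜 n H N, eval x p = 0} ∪
      {p | ∀ x ∈ (N : Set (Fin n → 𝕜)), eval x p = 0})

/-- Complexification of a real vector. -/
def cVec (w : Fin n → ℝ) : Fin n → ℂ := fun i => (w i : ℂ)

/-- The complexification `G = K_ℂ` of a compact matrix group `K ⊆ GL_n(ℝ)`: the Zariski
closure of `K` in the complex matrices. -/
def complexifiedGroup (K : Set (Matrix (Fin n) (Fin n) ℝ)) :
    Set (Matrix (Fin n) (Fin n) ℂ) :=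
  {g | ∀ p : MvPolynomial (Fin n × Fin n) ℂ,
    (∀ k ∈ K, eval (fun ij => (k ij.1 ij.2 : ℂ)) p = 0) →
      eval (fun ij => g ij.1 ij.2) p = 0}

/-- The complexification `Y = X_ℂ ⊆ ℂⁿ` of `X ⊆ ℝⁿ`: the Zariski closure of `X` in `ℂⁿ`. -/
def complexification (X : Set (Fin n → ℝ)) : Set (Fin n → ℂ) :=
  zclosure ℂ n (cVec n '' X)

end ZPaper

set_option linter.unusedSectionVars false

namespace ZPaper

section Polynomials

variable {𝕜 : Type} [RCLike 𝕜] {σ τ : Type} [Fintype σ] [Fintype τ]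

/-- The differential of a polynomial at a point, as a continuous linear form. -/
def polyDiff (p : MvPolynomial σ 𝕜) (x : σ → 𝕜) : (σ → 𝕜) →L[𝕜] 𝕜 :=
  ∑ i, eval x (pderiv i p) • ContinuousLinearMap.proj i

theorem polyDiff_apply (p : MvPolynomial σ 𝕜) (x v : σ → 𝕜) :
    polyDiff p x v = ∑ i, eval x (pderiv i p) * v i := by
  simp [polyDiff]

theorem hasStrictFDerivAt_eval (p : MvPolynomial σ 𝕜) (x : σ → 𝕜) :
    HasStrictFDerivAt (fun y => eval y p) (polyDiff p x) x := by
  classical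
  induction p using MvPolynomial.induction_on with
  | C a =>
    have : polyDiff (C a : MvPolynomial σ 𝕜) x = 0 := by ext; simp [polyDiff]
    simpa [this] using hasStrictFDerivAt_const a x
  | add p q hp hq =>
    have : polyDiff (p + q) x = polyDiff p x + polyDiff q x := by
      ext; simp [polyDiff, add_mul, Finset.sum_add_distrib]
    simpa [this] using hp.fun_add hq
  | mul_X p i hp =>
    have h := hp.fun_mul (ContinuousLinearMap.proj (R := 𝕜) (φ := fun _ : σ => 𝕜) i).hasStrictFDerivAt
      (x := x)
    have : polyDiff (p * X i) x = eval x p • ContinuousLinearMap.proj i + x i • polyDiff p x := by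
      ext v
      have h1 : ∀ j, eval x (pderiv j (p * X i)) * v j =
          (if i = j then eval x p * v j else 0) + x i * (eval x (pderiv j p) * v j) := by
        intro j
        rw [pderiv_mul, pderiv_X]
        by_cases hj : i = j
        · subst hj; simp; ring
        · simp [hj]; ring
      simp only [polyDiff_apply, h1, Finset.sum_add_distrib, ← Finset.mul_sum]
      simp [polyDiff_apply]
    rw [this]
    simpa using h

theorem hasFDerivAt_eval (p : MvPolynomial σ 𝕜) (x : σ → 𝕜) :
    HasFDerivAt (fun y => eval y p) (polyDiff p x) x :=
  (hasStrictFDerivAt_eval p x).hasFDerivAt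

/-- Pullback of a polynomial along a linear map. -/
def linSub (L : (σ → 𝕜) →ₗ[𝕜] (τ → 𝕜)) (p : MvPolynomial τ 𝕜) : MvPolynomial σ 𝕜 := by
  classical exact bind₁ (fun i => ∑ j, C (L (Pi.single j 1) i) * X j) p

theorem eval_linSub (L : (σ → 𝕜) →ₗ[𝕜] (τ → 𝕜)) (p : MvPolynomial τ 𝕜) (x : σ → 𝕜) :
    eval x (linSub L p) = eval (L x) p := by
  classical
  unfold linSub
  have : ((aeval x).comp (bind₁ fun i => ∑ j, C (L (Pi.single j 1) i) * X j) :
      MvPolynomial τ 𝕜 →ₐ[𝕜] 𝕜) = aeval (L x) := by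
    ext i
    have hx : x = ∑ j, x j • (Pi.single j 1 : σ → 𝕜) := by
      ext i; simp [Finset.sum_apply, Pi.single_apply]
    conv_rhs => rw [hx]
    simp [mul_comm]
  simpa [coe_aeval_eq_eval] using DFunLike.congr_fun this p

theorem polyDiff_linSub (L : (σ → 𝕜) →ₗ[𝕜] (τ → 𝕜)) (p : MvPolynomial τ 𝕜) (x v : σ → 𝕜) :
    polyDiff (linSub L p) x v = polyDiff p (L x) (L v) := by
  have h1 := hasFDerivAt_eval (linSub L p) x
  have h2 := (hasFDerivAt_eval p (LinearMap.toContinuousLinearMap L x)).comp x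
    (LinearMap.toContinuousLinearMap L).hasFDerivAt
  have h3 : (fun y => eval y (linSub L p))
      = (fun y => eval y p) ∘ (LinearMap.toContinuousLinearMap L) := by
    ext y; simp [eval_linSub]
  rw [h3] at h1
  simpa using DFunLike.congr_fun (h1.unique h2) v

theorem polyDiff_mul (p q : MvPolynomial σ 𝕜) (x v : σ → 𝕜) :
    polyDiff (p * q) x v = eval x p * polyDiff q x v + eval x q * polyDiff p x v := by
  simp only [polyDiff_apply, pderiv_mul, map_add, map_mul, Finset.mul_sum,
    ← Finset.sum_add_distrib]
  exact Finset.sum_congr rfl fun i _ => by ring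

theorem polyDiff_add (p q : MvPolynomial σ 𝕜) (x v : σ → 𝕜) :
    polyDiff (p + q) x v = polyDiff p x v + polyDiff q x v := by
  simp only [polyDiff_apply, map_add, add_mul, Finset.sum_add_distrib]

theorem polyDiff_C (a : 𝕜) (x v : σ → 𝕜) : polyDiff (C a) x v = 0 := by
  simp [polyDiff_apply]

/-- The restriction of a polynomial to an affine line, as a one-variable polynomial. -/
theorem exists_polynomial_line (p : MvPolynomial σ 𝕜) (x v : σ → 𝕜) :
    ∃ q : Polynomial 𝕜, ∀ t : 𝕜, q.eval t = eval (x + t • v) p := by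
  refine ⟨aeval (fun i => Polynomial.C (x i) + Polynomial.X * Polynomial.C (v i)) p, fun t => ?_⟩
  have : ((Polynomial.aeval t).comp
      (aeval (fun i => Polynomial.C (x i) + Polynomial.X * Polynomial.C (v i))) :
      MvPolynomial σ 𝕜 →ₐ[𝕜] 𝕜) = aeval (x + t • v) := by
    ext i; simp; ring
  simpa [Polynomial.coe_aeval_eq_eval] using DFunLike.congr_fun this p

/-- A polynomial that vanishes on an open neighbourhood of a point is zero everywhere. -/
theorem eval_eq_zero_of_eventually (p : MvPolynomial σ 𝕜) (x : σ → 𝕜)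
    (h : ∀ᶠ y in nhds x, eval y p = 0) (z : σ → 𝕜) : eval z p = 0 := by
  obtain ⟨q, hq⟩ := exists_polynomial_line p x (z - x)
  have hc : Filter.Tendsto (fun t : 𝕜 => x + t • (z - x)) (nhds 0) (nhds x) := by
    have : Continuous (fun t : 𝕜 => x + t • (z - x)) := by fun_prop
    simpa using this.tendsto 0
  have h0 : q = 0 := by
    apply Polynomial.eq_zero_of_infinite_isRoot
    have : {t : 𝕜 | q.IsRoot t} ∈ nhds 0 := by
      filter_upwards [hc.eventually h] with t ht
      simp [Polynomial.IsRoot, hq, ht]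
    exact infinite_of_mem_nhds 0 this
  have := hq 1
  rw [h0, one_smul, add_sub_cancel] at this
  simpa using this.symm

/-- If a polynomial is nonzero at `x`, it is nonzero at all but finitely many points of any line
through `x`. -/
theorem exists_ne_zero_near (p : MvPolynomial σ 𝕜) (x v : σ → 𝕜) (h : eval x p ≠ 0) (q : Polynomial 𝕜)
    (hq : q ≠ 0) : ∃ t : 𝕜, q.eval t ≠ 0 ∧ eval (x + t • v) p ≠ 0 := by
  obtain ⟨r, hr⟩ := exists_polynomial_line p x v
  have hr0 : r ≠ 0 := by
    rintro rfl
    have := hr 0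
    simp at this
    exact h this.symm
  have : q * r ≠ 0 := mul_ne_zero hq hr0
  by_contra! hcon
  apply this
  apply Polynomial.funext
  intro t
  by_cases hqt : q.eval t = 0
  · simp [hqt]
  · simp [hr, hcon t hqt]

/-- Linear independence of values of polynomial vector functions is detected by a polynomial. -/
theorem exists_poly_linearIndependent {r : ℕ} (s : Fin r → τ → MvPolynomial σ 𝕜) (y : σ → 𝕜)
    (hy : LinearIndependent 𝕜 (fun j => fun i => eval y (s j i))) :
    ∃ f : MvPolynomial σ 𝕜, eval y f ≠ 0 ∧ ∀ v, eval v f ≠ 0 →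
      LinearIndependent 𝕜 (fun j => fun i => eval v (s j i)) := by
  classical
  obtain ⟨g, hg⟩ := (Fintype.linearCombination 𝕜
    (fun j => fun i => eval y (s j i))).exists_leftInverse_of_injective
      (LinearMap.ker_eq_bot.mpr (linearIndependent_iff_injective_fintypeLinearCombination.mp hy))
  let Mt : Matrix (Fin r) (Fin r) (MvPolynomial σ 𝕜) :=
    Matrix.of fun a b => ∑ i, C (g (Pi.single i 1) a) * s b i
  have hM : ∀ v, Mt.map (eval v) = Matrix.of fun a b => g (fun i => eval v (s b i)) a := by
    intro v
    ext a b
    have : (fun i => eval v (s b i)) = ∑ i, (eval v (s b i)) • (Pi.single i 1 : τ → 𝕜) := by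
      ext i; simp [Finset.sum_apply, Pi.single_apply]
    simp only [Matrix.map_apply, Matrix.of_apply, Mt]
    rw [this]
    simp [mul_comm]
  have hdet : ∀ v, eval v Mt.det = (Matrix.of fun a b => g (fun i => eval v (s b i)) a).det := by
    intro v
    rw [← hM, RingHom.map_det]; rfl
  refine ⟨Mt.det, ?_, fun v hv => ?_⟩
  · rw [hdet]
    have : (Matrix.of fun a b => g (fun i => eval y (s b i)) a) = 1 := by
      ext a b
      have := congrFun (DFunLike.congr_fun hg (Pi.single b 1)) a
      simp [Fintype.linearCombination_apply, Pi.single_apply, ite_smul] at this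
      simp [this, Matrix.one_apply]
    rw [this]; simp
  · rw [hdet] at hv
    have h1 : LinearIndependent 𝕜 (Matrix.of fun a b => g (fun i => eval v (s b i)) a).col :=
      Matrix.linearIndependent_cols_of_det_ne_zero hv
    exact LinearIndependent.of_comp g h1

end Polynomials

section MatrixNorm

theorem uniformity_linftyOp (n : ℕ) (𝕜 : Type) [RCLike 𝕜] :
    @uniformity (Matrix (Fin n) (Fin n) 𝕜) inferInstance =
      @uniformity _ (Matrix.linftyOpNormedRing (n := Fin n) (α := 𝕜)).toMetricSpace.toUniformSpace :=
  rfl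

/-- The operator norm on matrices, with the product topology as underlying topology. -/
abbrev matNormedRing (n : ℕ) (𝕜 : Type) [RCLike 𝕜] : NormedRing (Matrix (Fin n) (Fin n) 𝕜) :=
  { (Matrix.linftyOpNormedRing : NormedRing (Matrix (Fin n) (Fin n) 𝕜)) with
    toMetricSpace := (Matrix.linftyOpNormedRing (n := Fin n)
      (α := 𝕜)).toMetricSpace.replaceUniformity (uniformity_linftyOp n 𝕜) }

attribute [local instance] matNormedRing

/-- The normed algebra structure belonging to `matNormedRing`. -/
abbrev matNormedAlgebra (n : ℕ) (𝕜 : Type) [RCLike 𝕜] :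
    NormedAlgebra 𝕜 (Matrix (Fin n) (Fin n) 𝕜) :=
  { (inferInstance : Algebra 𝕜 (Matrix (Fin n) (Fin n) 𝕜)) with
    norm_smul_le := (Matrix.linftyOpNormedAlgebra (n := Fin n) (R := 𝕜) (α := 𝕜)).norm_smul_le }

theorem mexp_eq_exp (n : ℕ) (𝕜 : Type) [RCLike 𝕜] (A : Matrix (Fin n) (Fin n) 𝕜) :
    mexp 𝕜 n A = NormedSpace.exp A := by
  rw [NormedSpace.exp_eq_tsum 𝕜]; rfl

end MatrixNorm
end ZPaper

namespace ZPaper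

attribute [local instance] matNormedRing matNormedAlgebra

section LieAlgebra

variable {𝕜 : Type} [RCLike 𝕜] {n : ℕ}

/-- The entries of a matrix, as a linear equivalence. -/
def flat : Matrix (Fin n) (Fin n) 𝕜 ≃ₗ[𝕜] (Fin n × Fin n → 𝕜) where
  toFun g := fun ij => g ij.1 ij.2
  invFun x := Matrix.of fun i j => x (i, j)
  map_add' _ _ := rfl
  map_smul' _ _ := rfl
  left_inv _ := rfl
  right_inv _ := rfl

theorem flat_apply (g : Matrix (Fin n) (Fin n) 𝕜) (ij : Fin n × Fin n) :
    flat g ij = g ij.1 ij.2 := rfl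

/-- A polynomial in the matrix entries vanishes on a set of matrices. -/
def VanishesOn (G : Set (Matrix (Fin n) (Fin n) 𝕜)) (p : MvPolynomial (Fin n × Fin n) 𝕜) : Prop :=
  ∀ k ∈ G, eval (flat k) p = 0

/-- A set of matrices that is the common zero set of the polynomials vanishing on it. -/
def IsZClosedSet (G : Set (Matrix (Fin n) (Fin n) 𝕜)) : Prop :=
  ∀ g, (∀ p, VanishesOn G p → eval (flat g) p = 0) → g ∈ G

/-- The Zariski tangent space at the identity. -/
def tangentOne (G : Set (Matrix (Fin n) (Fin n) 𝕜)) :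
    Submodule 𝕜 (Matrix (Fin n) (Fin n) 𝕜) where
  carrier := {A | ∀ p, VanishesOn G p → polyDiff p (flat 1) (flat A) = 0}
  zero_mem' := by intro p _; simp
  add_mem' := by intro A B hA hB p hp; simp [hA p hp, hB p hp]
  smul_mem' := by intro c A hA p hp; simp [hA p hp]

/-- Left multiplication by a matrix, in coordinates. -/
def flatMulLeft (g : Matrix (Fin n) (Fin n) 𝕜) :
    (Fin n × Fin n → 𝕜) →ₗ[𝕜] (Fin n × Fin n → 𝕜) :=
  flat.toLinearMap ∘ₗ LinearMap.mulLeft 𝕜 g ∘ₗ flat.symm.toLinearMap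

theorem flatMulLeft_flat (g A : Matrix (Fin n) (Fin n) 𝕜) :
    flatMulLeft g (flat A) = flat (g * A) := by
  simp [flatMulLeft]

theorem polyDiff_flat_mul {G : Set (Matrix (Fin n) (Fin n) 𝕜)}
    (hmul : ∀ a ∈ G, ∀ b ∈ G, a * b ∈ G) {A : Matrix (Fin n) (Fin n) 𝕜} (hA : A ∈ tangentOne G)
    {p : MvPolynomial (Fin n × Fin n) 𝕜} (hp : VanishesOn G p) {g : Matrix (Fin n) (Fin n) 𝕜}
    (hg : g ∈ G) : polyDiff p (flat g) (flat (g * A)) = 0 := by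
  have h := hA (linSub (flatMulLeft g) p) fun k hk => by
    rw [eval_linSub, flatMulLeft_flat]; exact hp _ (hmul g hg k hk)
  rwa [polyDiff_linSub, flatMulLeft_flat, flatMulLeft_flat, mul_one] at h

/-- The left invariant derivation on polynomials in the matrix entries. -/
def leftDer (A : Matrix (Fin n) (Fin n) 𝕜) (p : MvPolynomial (Fin n × Fin n) 𝕜) :
    MvPolynomial (Fin n × Fin n) 𝕜 :=
  ∑ i, pderiv i p * ∑ k, X (i.1, k) * C (A k i.2)

theorem eval_leftDer (A g : Matrix (Fin n) (Fin n) 𝕜) (p : MvPolynomial (Fin n × Fin n) 𝕜) :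
    eval (flat g) (leftDer A p) = polyDiff p (flat g) (flat (g * A)) := by
  simp [leftDer, polyDiff_apply, flat_apply, Matrix.mul_apply]

theorem hasDerivAt_eval_flat {γ : 𝕜 → Matrix (Fin n) (Fin n) 𝕜} {γ' : Matrix (Fin n) (Fin n) 𝕜}
    {t : 𝕜} (h : HasDerivAt γ γ' t) (p : MvPolynomial (Fin n × Fin n) 𝕜) :
    HasDerivAt (fun s => eval (flat (γ s)) p) (polyDiff p (flat (γ t)) (flat γ')) t := by
  have h1 : HasDerivAt (fun s => flat (γ s)) (flat γ') t :=
    (LinearMap.toContinuousLinearMap (flat (𝕜 := 𝕜) (n := n)).toLinearMap).hasFDerivAt.comp_hasDerivAt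
      t h
  exact (hasFDerivAt_eval p (flat (γ t))).comp_hasDerivAt t h1

theorem analyticAt_eval_flat_exp (A : Matrix (Fin n) (Fin n) 𝕜)
    (p : MvPolynomial (Fin n × Fin n) 𝕜) (t : 𝕜) :
    AnalyticAt 𝕜 (fun s : 𝕜 => eval (flat (NormedSpace.exp (s • A))) p) t := by
  have h1 : AnalyticAt 𝕜 (fun s : 𝕜 => NormedSpace.exp (s • A)) t :=
    (NormedSpace.exp_analytic (𝕂 := 𝕜) (t • A)).comp_of_eq
      ((analyticAt_id).smul analyticAt_const) rfl
  have h2 : AnalyticAt 𝕜 (fun s : 𝕜 => flat (NormedSpace.exp (s • A))) t :=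
    ((LinearMap.toContinuousLinearMap (flat (𝕜 := 𝕜) (n := n)).toLinearMap).analyticAt _).comp h1
  have := AnalyticAt.aeval_mvPolynomial (𝕜 := 𝕜) (A := 𝕜) (B := 𝕜) (z := t)
    (f := fun s : 𝕜 => flat (NormedSpace.exp (s • A)))
    (fun i => ((ContinuousLinearMap.proj (R := 𝕜) (φ := fun _ : Fin n × Fin n => 𝕜)
      i).analyticAt _).comp h2) p
  simpa [coe_aeval_eq_eval] using this

theorem iteratedDeriv_eval_flat_exp (A : Matrix (Fin n) (Fin n) 𝕜) (k : ℕ)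
    (p : MvPolynomial (Fin n × Fin n) 𝕜) :
    iteratedDeriv k (fun s : 𝕜 => eval (flat (NormedSpace.exp (s • A))) p) =
      fun s : 𝕜 => eval (flat (NormedSpace.exp (s • A))) ((leftDer A)^[k] p) := by
  induction k generalizing p with
  | zero => simp
  | succ k ih =>
    rw [iteratedDeriv_succ', Function.iterate_succ_apply, ← ih]
    congr 1
    ext t
    rw [(hasDerivAt_eval_flat (hasDerivAt_exp_smul_const A t) p).deriv, eval_leftDer]

theorem eq_zero_of_iteratedDeriv_eq_zero {f : 𝕜 → 𝕜} (hf : ∀ t, AnalyticAt 𝕜 f t)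
    (h : ∀ k, iteratedDeriv k f 0 = 0) (t : 𝕜) : f t = 0 := by
  have h1 : analyticOrderAt f 0 = ⊤ := by
    rw [ENat.eq_top_iff_forall_ge]
    intro m
    exact (natCast_le_analyticOrderAt_iff_iteratedDeriv_eq_zero (hf 0)).mpr fun i _ => h i
  rw [analyticOrderAt_eq_top] at h1
  exact AnalyticOnNhd.eqOn_zero_of_preconnected_of_eventuallyEq_zero (U := Set.univ)
    (fun t _ => hf t) (convex_univ (𝕜 := ℝ)).isPreconnected (Set.mem_univ 0) h1 (Set.mem_univ t)

theorem mem_lieAlgebra_iff {G : Set (Matrix (Fin n) (Fin n) 𝕜)} (h1 : 1 ∈ G)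
    (hmul : ∀ a ∈ G, ∀ b ∈ G, a * b ∈ G) (hZ : IsZClosedSet G) (A : Matrix (Fin n) (Fin n) 𝕜) :
    A ∈ lieAlgebra 𝕜 n G ↔ A ∈ tangentOne G := by
  constructor
  · intro hA p hp
    have h := hasDerivAt_eval_flat (hasDerivAt_exp_smul_const A (0 : 𝕜)) p
    have h0 : (fun s : 𝕜 => eval (flat (NormedSpace.exp (s • A))) p) = fun _ => 0 := by
      ext s
      apply hp
      rw [← mexp_eq_exp]
      exact hA s
    rw [h0] at h
    have := h.unique (hasDerivAt_const (0 : 𝕜) (0 : 𝕜))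
    simpa using this
  · intro hA t
    rw [mexp_eq_exp]
    apply hZ
    intro p hp
    refine eq_zero_of_iteratedDeriv_eq_zero (analyticAt_eval_flat_exp A p) (fun k => ?_) t
    rw [iteratedDeriv_eval_flat_exp]
    have : ∀ k, ∀ p, VanishesOn G p → VanishesOn G ((leftDer A)^[k] p) := by
      intro k
      induction k with
      | zero => intro p hp; exact hp
      | succ k ih =>
        intro p hp
        rw [Function.iterate_succ_apply]
        apply ih
        intro g hg
        rw [eval_leftDer]
        exact polyDiff_flat_mul hmul hA hp hg
    simpa using this k p hp 1 h1

theorem lieAlgebra_eq {G : Set (Matrix (Fin n) (Fin n) 𝕜)} (h1 : 1 ∈ G)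
    (hmul : ∀ a ∈ G, ∀ b ∈ G, a * b ∈ G) (hZ : IsZClosedSet G) :
    lieAlgebra 𝕜 n G = tangentOne G :=
  Set.ext (mem_lieAlgebra_iff h1 hmul hZ)

/-- Evaluation of matrices at a vector. -/
def evalAt (v : Fin n → 𝕜) : Matrix (Fin n) (Fin n) 𝕜 →ₗ[𝕜] (Fin n → 𝕜) where
  toFun A := A.mulVec v
  map_add' A B := Matrix.add_mulVec A B v
  map_smul' c A := Matrix.smul_mulVec c A v

theorem evalAt_apply (v : Fin n → 𝕜) (A : Matrix (Fin n) (Fin n) 𝕜) :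
    evalAt v A = A.mulVec v := rfl

theorem orbitTangent_eq {G : Set (Matrix (Fin n) (Fin n) 𝕜)} (h1 : 1 ∈ G)
    (hmul : ∀ a ∈ G, ∀ b ∈ G, a * b ∈ G) (hZ : IsZClosedSet G) (v : Fin n → 𝕜) :
    orbitTangent 𝕜 n G v = (tangentOne G).map (evalAt v) := by
  rw [orbitTangent, lieAlgebra_eq h1 hmul hZ]
  exact Submodule.span_eq ((tangentOne G).map (evalAt v))

theorem exp_smul_mem {G : Set (Matrix (Fin n) (Fin n) 𝕜)} (h1 : 1 ∈ G)
    (hmul : ∀ a ∈ G, ∀ b ∈ G, a * b ∈ G) (hZ : IsZClosedSet G) {A : Matrix (Fin n) (Fin n) 𝕜}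
    (hA : A ∈ tangentOne G) (t : 𝕜) : NormedSpace.exp (t • A) ∈ G := by
  rw [← mexp_eq_exp]
  exact (mem_lieAlgebra_iff h1 hmul hZ A).mpr hA t

theorem exp_mem {G : Set (Matrix (Fin n) (Fin n) 𝕜)} (h1 : 1 ∈ G)
    (hmul : ∀ a ∈ G, ∀ b ∈ G, a * b ∈ G) (hZ : IsZClosedSet G) {A : Matrix (Fin n) (Fin n) 𝕜}
    (hA : A ∈ tangentOne G) : NormedSpace.exp A ∈ G := by
  simpa using exp_smul_mem h1 hmul hZ hA 1

theorem conj_mem_tangentOne {G : Set (Matrix (Fin n) (Fin n) 𝕜)} (hG : IsMatSubgroup 𝕜 n G)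
    (hZ : IsZClosedSet G) {A g : Matrix (Fin n) (Fin n) 𝕜} (hA : A ∈ tangentOne G) (hg : g ∈ G) :
    g * A * g⁻¹ ∈ tangentOne G := by
  obtain ⟨h1, hmul, hinv⟩ := hG
  rw [← mem_lieAlgebra_iff h1 hmul hZ]
  intro t
  have : t • (g * A * g⁻¹) = g * (t • A) * g⁻¹ := by simp
  rw [mexp_eq_exp, this, Matrix.exp_conj _ _ (hinv g hg).1]
  exact hmul _ (hmul _ hg _ (exp_smul_mem h1 hmul hZ hA t)) _ (hinv g hg).2

theorem hasDerivAt_exp_mulVec (A : Matrix (Fin n) (Fin n) 𝕜) (x : Fin n → 𝕜) (t : 𝕜) :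
    HasDerivAt (fun s : 𝕜 => (NormedSpace.exp (s • A)).mulVec x)
      ((NormedSpace.exp (t • A)).mulVec (A.mulVec x)) t := by
  have := (LinearMap.toContinuousLinearMap (evalAt x)).hasFDerivAt.comp_hasDerivAt t
    (hasDerivAt_exp_smul_const A t)
  simpa [evalAt_apply, Function.comp_def] using this

theorem exp_smul_mulVec_eq {A : Matrix (Fin n) (Fin n) 𝕜} {x : Fin n → 𝕜} (h : A.mulVec x = 0)
    (t : 𝕜) : (NormedSpace.exp (t • A)).mulVec x = x := by
  have h1 : ∀ t, HasDerivAt (fun s : 𝕜 => (NormedSpace.exp (s • A)).mulVec x) 0 t := by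
    intro t
    simpa [h] using hasDerivAt_exp_mulVec A x t
  have := is_const_of_deriv_eq_zero (fun t => (h1 t).differentiableAt) (fun t => (h1 t).deriv) t 0
  simpa using this

theorem mulVec_eq_zero_of_finite_range {A : Matrix (Fin n) (Fin n) 𝕜} {x : Fin n → 𝕜}
    (h : (Set.range fun t : 𝕜 => (NormedSpace.exp (t • A)).mulVec x).Finite) :
    A.mulVec x = 0 := by
  have hc : Continuous fun t : 𝕜 => (NormedSpace.exp (t • A)).mulVec x :=
    continuous_iff_continuousAt.mpr fun t => (hasDerivAt_exp_mulVec A x t).continuousAt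
  have hpre : IsPreconnected (Set.range fun t : 𝕜 => (NormedSpace.exp (t • A)).mulVec x) := by
    rw [← Set.image_univ]
    exact (convex_univ (𝕜 := ℝ)).isPreconnected.image _ hc.continuousOn
  have hsub := h.countable.isTotallyDisconnected _ subset_rfl hpre
  have h0 : (fun t : 𝕜 => (NormedSpace.exp (t • A)).mulVec x) = fun _ => x := by
    ext1 t
    have := hsub ⟨t, rfl⟩ ⟨0, rfl⟩
    simpa using this
  have h1 := hasDerivAt_exp_mulVec A x (0 : 𝕜)
  rw [h0] at h1
  simpa using h1.unique (hasDerivAt_const (0 : 𝕜) x)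

theorem mulVec_eq_zero_of_finiteImage {G : Set (Matrix (Fin n) (Fin n) 𝕜)} (h1 : 1 ∈ G)
    (hmul : ∀ a ∈ G, ∀ b ∈ G, a * b ∈ G) (hZ : IsZClosedSet G) {v : Fin n → 𝕜}
    {N : Submodule 𝕜 (Fin n → 𝕜)} (hN : HasFiniteImageOn 𝕜 n (isotropy 𝕜 n G v) N)
    {A : Matrix (Fin n) (Fin n) 𝕜} (hA : A ∈ tangentOne G) (hAv : A.mulVec v = 0) {x : Fin n → 𝕜}
    (hx : x ∈ N) : A.mulVec x = 0 := by
  apply mulVec_eq_zero_of_finite_range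
  refine (hN.image fun f => f ⟨x, hx⟩).subset ?_
  rintro _ ⟨t, rfl⟩
  exact ⟨_, ⟨_, ⟨exp_smul_mem h1 hmul hZ hA t, exp_smul_mulVec_eq hAv t⟩, rfl⟩, rfl⟩

theorem hasFiniteImageOn_of_actsTriviallyOn {H : Set (Matrix (Fin n) (Fin n) 𝕜)}
    {N : Submodule 𝕜 (Fin n → 𝕜)} (h : ActsTriviallyOn 𝕜 n H N) : HasFiniteImageOn 𝕜 n H N := by
  refine (Set.finite_singleton (fun x : N => (x : Fin n → 𝕜))).subset ?_
  rintro _ ⟨g, hg, rfl⟩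
  ext1 x
  exact h g hg x x.2

end LieAlgebra
end ZPaper

namespace ZPaper

attribute [local instance] matNormedRing matNormedAlgebra

section LocalStructure

open Filter Topology

variable {n : ℕ}

theorem eventually_eq_zero_of_hasFDerivAt {E ι : Type*} [NormedAddCommGroup E] [NormedSpace ℝ E]
    [FiniteDimensional ℝ E] {φ : ι → E → ℝ} {ℓ : ι → E →L[ℝ] ℝ}
    (hφ : ∀ i, HasFDerivAt (φ i) (ℓ i) 0) (h0 : ∀ i, φ i 0 = 0)
    (hℓ : ∀ e, (∀ i, ℓ i e = 0) → e = 0) :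
    ∀ᶠ d in 𝓝 (0 : E), (∀ i, φ i d = 0) → d = 0 := by
  by_contra hcon
  rw [not_eventually] at hcon
  let F : Filter E := 𝓝 0 ⊓ 𝓟 {d | ¬((∀ i, φ i d = 0) → d = 0)}
  have hF : F.NeBot := by
    rw [frequently_iff_neBot] at hcon
    exact hcon
  have hev : ∀ᶠ d in F, (∀ i, φ i d = 0) ∧ d ≠ 0 := by
    have : ∀ᶠ d in F, ¬((∀ i, φ i d = 0) → d = 0) :=
      mem_inf_of_right (mem_principal_self _)
    filter_upwards [this] with d hd
    push Not at hd
    exact hd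
  let u : E → E := fun d => ‖d‖⁻¹ • d
  have hu : ∀ᶠ d in F, u d ∈ Metric.sphere (0 : E) 1 := by
    filter_upwards [hev] with d hd
    have : ‖d‖ ≠ 0 := norm_ne_zero_iff.mpr hd.2
    rw [mem_sphere_zero_iff_norm, norm_smul, norm_inv, norm_norm, inv_mul_cancel₀ this]
  have hproper : ProperSpace E := FiniteDimensional.proper ℝ E
  obtain ⟨e, he, hcl⟩ := (isCompact_sphere (0 : E) 1).exists_mapClusterPt (f := F) (u := u)
    (le_principal_iff.mpr hu)
  have he0 : e = 0 := by
    refine hℓ e fun i => ?_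
    have hlim : Tendsto (fun d => ℓ i (u d)) F (𝓝 0) := by
      have h3 := (hasFDerivAt_iff_tendsto.mp (hφ i)).mono_left (inf_le_left : F ≤ 𝓝 0)
      rw [tendsto_zero_iff_norm_tendsto_zero]
      refine h3.congr' ?_
      filter_upwards [hev] with d hd
      rw [hd.1 i, h0 i]
      simp [u]
    have hcl2 : MapClusterPt (ℓ i e) F (fun d => ℓ i (u d)) :=
      hcl.continuousAt_comp (ℓ i).continuous.continuousAt
    by_contra hne
    have : ClusterPt (ℓ i e) (𝓝 0) := ClusterPt.mono hcl2 hlim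
    exact hne (eq_of_nhds_neBot this)
  simp [he0] at he

theorem eventually_eq_zero_of_isCompl {G : Set (Matrix (Fin n) (Fin n) ℝ)} (h1 : 1 ∈ G)
    {D : Submodule ℝ (Matrix (Fin n) (Fin n) ℝ)} (hD : Disjoint (tangentOne G) D) :
    ∀ᶠ d : D in 𝓝 0, (1 + d : Matrix (Fin n) (Fin n) ℝ) ∈ G → d = 0 := by
  let L : D →L[ℝ] (Fin n × Fin n → ℝ) :=
    (LinearMap.toContinuousLinearMap (flat (𝕜 := ℝ) (n := n)).toLinearMap).comp D.subtypeL
  have hL : ∀ d : D, L d = flat (d : Matrix (Fin n) (Fin n) ℝ) := fun _ => rfl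
  have key := eventually_eq_zero_of_hasFDerivAt (E := D)
    (ι := {p : MvPolynomial (Fin n × Fin n) ℝ // VanishesOn G p})
    (φ := fun p d => eval (flat 1 + L d) p.1)
    (ℓ := fun p => (polyDiff p.1 (flat 1)).comp L)
    (fun p => by
      refine HasFDerivAt.comp (0 : D) (g := fun y => eval y p.1)
        (f := fun d : D => flat 1 + L d) ?_ (L.hasFDerivAt.const_add _)
      simpa using hasFDerivAt_eval p.1 (flat 1))
    (fun p => by simpa using p.2 _ h1)
    (fun e he => by
      have heT : (e : Matrix (Fin n) (Fin n) ℝ) ∈ tangentOne G := fun p hp => he ⟨p, hp⟩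
      exact Subtype.ext (by simpa using hD.le_bot ⟨heT, e.2⟩))
  filter_upwards [key] with d hd hdG
  refine hd fun p => ?_
  rw [hL, ← map_add]
  exact p.2 _ hdG

/-- Near the identity, a closed matrix group is the product of the exponentials of two subspaces
spanning its Lie algebra. -/
theorem eventually_exists_exp_mul_exp {G : Set (Matrix (Fin n) (Fin n) ℝ)}
    (h1 : 1 ∈ G) (hmul : ∀ a ∈ G, ∀ b ∈ G, a * b ∈ G) (hZ : IsZClosedSet G)
    {S T : Submodule ℝ (Matrix (Fin n) (Fin n) ℝ)} (hST : S ⊔ T = tangentOne G)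
    {U : Set (Matrix (Fin n) (Fin n) ℝ)} (hU : U ∈ 𝓝 0) :
    ∀ᶠ g in 𝓝 (1 : Matrix (Fin n) (Fin n) ℝ), g ∈ G →
      ∃ B ∈ S, ∃ C ∈ T, B ∈ U ∧ C ∈ U ∧ g = NormedSpace.exp B * NormedSpace.exp C := by
  obtain ⟨D, hD⟩ := (tangentOne G).exists_isCompl
  let Φ : S × T × D → Matrix (Fin n) (Fin n) ℝ := fun x =>
    NormedSpace.exp (x.1 : Matrix (Fin n) (Fin n) ℝ) *
      NormedSpace.exp (x.2.1 : Matrix (Fin n) (Fin n) ℝ) * (1 + x.2.2)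
  let pS : S × T × D →L[ℝ] Matrix (Fin n) (Fin n) ℝ := S.subtypeL.comp (ContinuousLinearMap.fst ..)
  let pT : S × T × D →L[ℝ] Matrix (Fin n) (Fin n) ℝ :=
    T.subtypeL.comp ((ContinuousLinearMap.fst ..).comp (ContinuousLinearMap.snd ..))
  let pD : S × T × D →L[ℝ] Matrix (Fin n) (Fin n) ℝ :=
    D.subtypeL.comp ((ContinuousLinearMap.snd ..).comp (ContinuousLinearMap.snd ..))
  have hexp : HasStrictFDerivAt (NormedSpace.exp : Matrix (Fin n) (Fin n) ℝ → _)
      (1 : Matrix (Fin n) (Fin n) ℝ →L[ℝ] Matrix (Fin n) (Fin n) ℝ) 0 := hasStrictFDerivAt_exp_zero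
  have hS : HasStrictFDerivAt (fun x : S × T × D =>
      NormedSpace.exp (x.1 : Matrix (Fin n) (Fin n) ℝ)) pS 0 := by
    have := HasStrictFDerivAt.comp (0 : S × T × D) (g := NormedSpace.exp) (f := pS)
      (by simpa using hexp) pS.hasStrictFDerivAt
    exact this
  have hT : HasStrictFDerivAt (fun x : S × T × D =>
      NormedSpace.exp (x.2.1 : Matrix (Fin n) (Fin n) ℝ)) pT 0 := by
    have := HasStrictFDerivAt.comp (0 : S × T × D) (g := NormedSpace.exp) (f := pT)
      (by simpa using hexp) pT.hasStrictFDerivAt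
    exact this
  have hDd : HasStrictFDerivAt (fun x : S × T × D =>
      (1 + x.2.2 : Matrix (Fin n) (Fin n) ℝ)) pD 0 := pD.hasStrictFDerivAt.const_add 1
  have hΦ : HasStrictFDerivAt Φ (pS + pT + pD) 0 := by
    refine HasStrictFDerivAt.congr_fderiv ((hS.mul' hT).mul' hDd) ?_
    refine ContinuousLinearMap.ext fun x => ?_
    simp
    abel
  have hsurj : (pS + pT + pD).range = ⊤ := by
    rw [LinearMap.range_eq_top]
    intro M
    have hM : M ∈ S ⊔ T ⊔ D := by rw [hST, hD.sup_eq_top]; trivial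
    obtain ⟨m, hm, d, hd, rfl⟩ := Submodule.mem_sup.mp hM
    obtain ⟨s, hs, t, ht, rfl⟩ := Submodule.mem_sup.mp hm
    exact ⟨(⟨s, hs⟩, ⟨t, ht⟩, ⟨d, hd⟩), rfl⟩
  have hmap := hΦ.map_nhds_eq_of_surj hsurj
  have hΦ0 : Φ 0 = 1 := by simp [Φ]
  rw [hΦ0] at hmap
  have hcS : Tendsto pS (𝓝 0) (𝓝 0) := by simpa using pS.continuous.tendsto 0
  have hcT : Tendsto pT (𝓝 0) (𝓝 0) := by simpa using pT.continuous.tendsto 0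
  have hcD : Tendsto (fun x : S × T × D => x.2.2) (𝓝 0) (𝓝 0) :=
    (continuous_snd.comp continuous_snd).tendsto (0 : S × T × D)
  have hgood : ∀ᶠ x in 𝓝 (0 : S × T × D), (Φ x ∈ G → ∃ B ∈ S, ∃ C ∈ T, B ∈ U ∧ C ∈ U ∧
      Φ x = NormedSpace.exp B * NormedSpace.exp C) := by
    filter_upwards [hcS hU, hcT hU, hcD (eventually_eq_zero_of_isCompl h1 hD.disjoint)]
      with x hx1 hx2 hx3 hxG
    refine ⟨x.1, x.1.2, x.2.1, x.2.1.2, hx1, hx2, ?_⟩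
    have hB : (x.1 : Matrix (Fin n) (Fin n) ℝ) ∈ tangentOne G := hST ▸ Submodule.mem_sup_left x.1.2
    have hC : (x.2.1 : Matrix (Fin n) (Fin n) ℝ) ∈ tangentOne G :=
      hST ▸ Submodule.mem_sup_right x.2.1.2
    have hB' := exp_mem h1 hmul hZ (Submodule.neg_mem _ hB)
    have hC' := exp_mem h1 hmul hZ (Submodule.neg_mem _ hC)
    have hcancel : ∀ M : Matrix (Fin n) (Fin n) ℝ,
        NormedSpace.exp (-M) * NormedSpace.exp M = 1 := by
      intro M
      rw [← Matrix.exp_add_of_commute _ _ (Commute.neg_left (Commute.refl M))]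
      simp
    have : (1 + x.2.2 : Matrix (Fin n) (Fin n) ℝ) ∈ G := by
      have h := hmul _ hC' _ (hmul _ hB' _ hxG)
      have e : NormedSpace.exp (-(x.2.1 : Matrix (Fin n) (Fin n) ℝ)) *
          (NormedSpace.exp (-(x.1 : Matrix (Fin n) (Fin n) ℝ)) * Φ x) = 1 + x.2.2 := by
        simp only [Φ]
        rw [← mul_assoc (NormedSpace.exp (-(x.1 : Matrix (Fin n) (Fin n) ℝ))), ← mul_assoc
          (NormedSpace.exp (-(x.1 : Matrix (Fin n) (Fin n) ℝ))), hcancel, one_mul, ← mul_assoc,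
          hcancel, one_mul]
      rwa [e] at h
    have h0 := hx3 this
    simp [Φ, h0]
  rw [← hmap, eventually_map]
  exact hgood

end LocalStructure

section Isotropy

open Filter Topology

variable {𝕜 : Type} [RCLike 𝕜] {n : ℕ}

theorem mulVec_eval_flat (v : Fin n → 𝕜) (i : Fin n) : ∃ p : MvPolynomial (Fin n × Fin n) 𝕜,
    ∀ g : Matrix (Fin n) (Fin n) 𝕜, eval (flat g) p = g.mulVec v i - v i :=
  ⟨∑ j, X (i, j) * C (v j) - C (v i), fun g => by simp [flat_apply, Matrix.mulVec, dotProduct]⟩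

theorem isZClosedSet_isotropy {G : Set (Matrix (Fin n) (Fin n) 𝕜)} (hZ : IsZClosedSet G)
    (v : Fin n → 𝕜) : IsZClosedSet (isotropy 𝕜 n G v) := by
  intro g hg
  refine ⟨hZ g fun p hp => hg p fun k hk => hp k hk.1, ?_⟩
  ext i
  obtain ⟨p, hp⟩ := mulVec_eval_flat v i
  have := hg p fun k hk => by rw [hp, hk.2, sub_self]
  rw [hp] at this
  exact sub_eq_zero.mp this

theorem isMatSubgroup_isotropy {G : Set (Matrix (Fin n) (Fin n) 𝕜)} (hG : IsMatSubgroup 𝕜 n G)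
    (v : Fin n → 𝕜) : IsMatSubgroup 𝕜 n (isotropy 𝕜 n G v) := by
  refine ⟨⟨hG.1, Matrix.one_mulVec v⟩, fun a ha b hb => ⟨hG.2.1 a ha.1 b hb.1, ?_⟩,
    fun a ha => ⟨(hG.2.2 a ha.1).1, (hG.2.2 a ha.1).2, ?_⟩⟩
  · rw [← Matrix.mulVec_mulVec, hb.2, ha.2]
  · have hdet := (Matrix.isUnit_iff_isUnit_det a).mp (hG.2.2 a ha.1).1
    conv_lhs => rw [← ha.2]
    rw [Matrix.mulVec_mulVec, Matrix.nonsing_inv_mul _ hdet, Matrix.one_mulVec]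

theorem mem_tangentOne_isotropy {G : Set (Matrix (Fin n) (Fin n) 𝕜)} (hG : IsMatSubgroup 𝕜 n G)
    (hZ : IsZClosedSet G) (v : Fin n → 𝕜) (A : Matrix (Fin n) (Fin n) 𝕜) :
    A ∈ tangentOne (isotropy 𝕜 n G v) ↔ A ∈ tangentOne G ∧ A.mulVec v = 0 := by
  have hI := isMatSubgroup_isotropy hG v
  constructor
  · intro hA
    refine ⟨fun p hp => hA p fun k hk => hp k hk.1, ?_⟩
    apply mulVec_eq_zero_of_finite_range
    refine (Set.finite_singleton v).subset ?_
    rintro _ ⟨t, rfl⟩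
    exact (exp_smul_mem hI.1 hI.2.1 (isZClosedSet_isotropy hZ v) hA t).2
  · rintro ⟨hA, hAv⟩
    rw [← mem_lieAlgebra_iff hI.1 hI.2.1 (isZClosedSet_isotropy hZ v)]
    intro t
    rw [mexp_eq_exp]
    exact ⟨exp_smul_mem hG.1 hG.2.1 hZ hA t, exp_smul_mulVec_eq hAv t⟩

theorem isClosed_of_isZClosedSet {G : Set (Matrix (Fin n) (Fin n) 𝕜)} (hZ : IsZClosedSet G) :
    IsClosed G := by
  have : G = ⋂ p ∈ {p | VanishesOn G p}, {g | eval (flat g) p = 0} := by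
    ext g
    simp only [Set.mem_iInter, Set.mem_ofPred_eq]
    exact ⟨fun hg p hp => hp g hg, fun h => hZ g h⟩
  rw [this]
  refine isClosed_biInter fun p _ => isClosed_eq ?_ continuous_const
  refine (MvPolynomial.continuous_eval p).comp ?_
  exact continuous_pi fun ij => (continuous_apply_apply ij.1 ij.2)

theorem hasFiniteImageOn_of_lie {K : Set (Matrix (Fin n) (Fin n) ℝ)} (hK : IsMatSubgroup ℝ n K)
    (hc : IsCompact K) (hZ : IsZClosedSet K) {v : Fin n → ℝ} {N : Submodule ℝ (Fin n → ℝ)}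
    (hN : ∀ A ∈ tangentOne K, A.mulVec v = 0 → ∀ x ∈ N, A.mulVec x = 0) :
    HasFiniteImageOn ℝ n (isotropy ℝ n K v) N := by
  have hI := isMatSubgroup_isotropy hK v
  have hIZ := isZClosedSet_isotropy hZ v
  have hIc : IsCompact (isotropy ℝ n K v) :=
    hc.of_isClosed_subset (isClosed_of_isZClosedSet hIZ) fun g hg => hg.1
  have hloc := eventually_exists_exp_mul_exp hI.1 hI.2.1 hIZ (S := ⊥) (T := tangentOne (isotropy ℝ n K v))
    (bot_sup_eq _) (univ_mem (f := 𝓝 0))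
  have hcov : ∀ k ∈ isotropy ℝ n K v, {g | k⁻¹ * g ∈ isotropy ℝ n K v →
      ∀ x ∈ N, g.mulVec x = k.mulVec x} ∈ 𝓝 k := by
    intro k hk
    have hdet := (Matrix.isUnit_iff_isUnit_det k).mp (hI.2.2 k hk).1
    have hcont : Tendsto (fun g : Matrix (Fin n) (Fin n) ℝ => k⁻¹ * g) (𝓝 k) (𝓝 1) := by
      have : Continuous fun g : Matrix (Fin n) (Fin n) ℝ => k⁻¹ * g := by fun_prop
      simpa [Matrix.nonsing_inv_mul _ hdet] using this.tendsto k
    filter_upwards [hcont.eventually hloc] with g hg hgI x hx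
    obtain ⟨B, hB, C, hC, -, -, he⟩ := hg hgI
    have hB0 : B = 0 := by simpa using hB
    have hC' := (mem_tangentOne_isotropy hK hZ v C).mp hC
    have hfix : (NormedSpace.exp C).mulVec x = x := by
      simpa using exp_smul_mulVec_eq (𝕜 := ℝ) (hN C hC'.1 hC'.2 x hx) 1
    rw [hB0, NormedSpace.exp_zero, one_mul] at he
    have : g = k * (k⁻¹ * g) := by
      rw [← mul_assoc, Matrix.mul_nonsing_inv _ hdet, one_mul]
    rw [this, ← Matrix.mulVec_mulVec, he, hfix]
  obtain ⟨t, hsub⟩ := hIc.elim_nhds_subcover' _ hcov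
  refine (t.finite_toSet.image fun (k : isotropy ℝ n K v) (x : N) =>
    (k : Matrix (Fin n) (Fin n) ℝ).mulVec (x : Fin n → ℝ)).subset
    ?_
  rintro _ ⟨g, hg, rfl⟩
  have hgt := hsub hg
  rw [Set.mem_iUnion₂] at hgt
  obtain ⟨k, hk, hgk⟩ := hgt
  refine ⟨k, hk, ?_⟩
  ext1 x
  exact (hgk (hI.2.1 _ (hI.2.2 _ k.2).2 _ hg) x x.2).symm

end Isotropy
end ZPaper

namespace ZPaper

attribute [local instance] matNormedRing matNormedAlgebra

section Average

open MeasureTheory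

variable {𝕜 : Type} [RCLike 𝕜] {σ τ : Type} [Fintype σ] [Fintype τ]
variable {H : Type} [TopologicalSpace H] [CompactSpace H]

/-- A continuous family of linear maps expands a polynomial with continuous coefficients. -/
theorem exists_continuous_expansion {L : H → (σ → 𝕜) →ₗ[𝕜] (τ → 𝕜)}
    (hL : ∀ x, Continuous fun h => L h x) (p : MvPolynomial τ 𝕜) :
    ∃ (s : Finset (σ →₀ ℕ)) (c : (σ →₀ ℕ) → H → 𝕜), (∀ α, Continuous (c α)) ∧
      ∀ h, linSub (L h) p = ∑ α ∈ s, c α h • monomial α 1 := by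
  classical
  let P : MvPolynomial σ C(H, 𝕜) :=
    eval₂ (C.comp (algebraMap 𝕜 C(H, 𝕜)))
      (fun i => ∑ j, C (⟨fun h => L h (Pi.single j 1) i, (continuous_apply i).comp (hL _)⟩ : C(H, 𝕜))
        * X j) p
  let ev : H → C(H, 𝕜) →+* 𝕜 := fun h => (ContinuousMap.evalAlgHom 𝕜 𝕜 h).toRingHom
  have hP : ∀ h, map (ev h) P = linSub (L h) p := by
    intro h
    unfold linSub
    simp only [P]
    rw [← coe_eval₂Hom, ← RingHom.comp_apply, bind₁, ← AlgHom.coe_toRingHom]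
    congr 1
    apply MvPolynomial.ringHom_ext
    · intro r
      simp [ev]
    · intro i
      simp [ev]
  refine ⟨P.support, fun α h => ev h (coeff α P), fun α => (coeff α P).continuous, fun h => ?_⟩
  rw [← hP]
  conv_lhs => rw [P.as_sum, map_sum]
  refine Finset.sum_congr rfl fun α _ => ?_
  rw [map_monomial, smul_monomial, smul_eq_mul, mul_one]

theorem continuous_linSub {L : H → (σ → 𝕜) →ₗ[𝕜] (τ → 𝕜)}
    (hL : ∀ x, Continuous fun h => L h x) (p : MvPolynomial τ 𝕜)
    (Φ : MvPolynomial σ 𝕜 →ₗ[𝕜] 𝕜) : Continuous fun h => Φ (linSub (L h) p) := by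
  obtain ⟨s, c, hc, hs⟩ := exists_continuous_expansion hL p
  simp only [hs, map_sum, map_smul, smul_eq_mul]
  exact continuous_finsetSum _ fun α _ => (hc α).mul continuous_const

variable [MeasurableSpace H] [BorelSpace H]

theorem integrable_of_continuous {E : Type*} [NormedAddCommGroup E] [SecondCountableTopology E]
    (μ : Measure H) [IsFiniteMeasure μ] {f : H → E} (hf : Continuous f) : Integrable f μ := by
  obtain ⟨C, hC⟩ := (isCompact_range hf).isBounded.exists_norm_le
  have hm : AEStronglyMeasurable f μ := by
    borelize E
    exact hf.measurable.aestronglyMeasurable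
  exact Integrable.of_bound hm C (Filter.Eventually.of_forall fun h => hC _ ⟨h, rfl⟩)

/-- The average of the pullbacks of a polynomial along a continuous family of linear maps. -/
theorem exists_average (μ : Measure H) [IsFiniteMeasure μ] {L : H → (σ → 𝕜) →ₗ[𝕜] (τ → 𝕜)}
    (hL : ∀ x, Continuous fun h => L h x) (p : MvPolynomial τ 𝕜) :
    ∃ F : MvPolynomial σ 𝕜, ∀ Φ : MvPolynomial σ 𝕜 →ₗ[𝕜] 𝕜, Φ F = ∫ h, Φ (linSub (L h) p) ∂μ := by
  obtain ⟨s, c, hc, hs⟩ := exists_continuous_expansion hL p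
  refine ⟨∑ α ∈ s, (∫ h, c α h ∂μ) • monomial α 1, fun Φ => ?_⟩
  simp only [hs, map_sum, map_smul, smul_eq_mul]
  rw [integral_finsetSum _ fun α _ => (integrable_of_continuous μ (hc α)).mul_const _]
  exact Finset.sum_congr rfl fun α _ => (integral_mul_const _ _).symm

/-- Evaluation at a point as a linear functional on polynomials. -/
def evalLin (x : σ → 𝕜) : MvPolynomial σ 𝕜 →ₗ[𝕜] 𝕜 := (aeval x).toLinearMap

theorem evalLin_apply (x : σ → 𝕜) (p : MvPolynomial σ 𝕜) : evalLin x p = eval x p := by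
  simp [evalLin]

/-- Differentiation at a point in a direction as a linear functional on polynomials. -/
def polyDiffLin (x v : σ → 𝕜) : MvPolynomial σ 𝕜 →ₗ[𝕜] 𝕜 where
  toFun p := polyDiff p x v
  map_add' p q := polyDiff_add p q x v
  map_smul' c p := by
    simp [polyDiff_apply, Finset.mul_sum, smul_eval, mul_assoc]

theorem polyDiffLin_apply (x v : σ → 𝕜) (p : MvPolynomial σ 𝕜) :
    polyDiffLin x v p = polyDiff p x v := rfl

theorem exists_average_eval (μ : Measure H) [IsFiniteMeasure μ] {L : H → (σ → 𝕜) →ₗ[𝕜] (τ → 𝕜)}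
    (hL : ∀ x, Continuous fun h => L h x) (p : MvPolynomial τ 𝕜) :
    ∃ F : MvPolynomial σ 𝕜, (∀ v, eval v F = ∫ h, eval (L h v) p ∂μ) ∧
      ∀ v x, polyDiff F v x = ∫ h, polyDiff p (L h v) (L h x) ∂μ := by
  obtain ⟨F, hF⟩ := exists_average μ hL p
  refine ⟨F, fun v => ?_, fun v x => ?_⟩
  · have := hF (evalLin v)
    simpa only [evalLin_apply, eval_linSub] using this
  · have := hF (polyDiffLin v x)
    simpa only [polyDiffLin_apply, polyDiff_linSub] using this

end Average

section Haar

open MeasureTheory Topology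

variable {n : ℕ}

/-- A compact matrix group is the image of a compact topological group carrying a
right-invariant probability measure. -/
theorem exists_haar {K : Set (Matrix (Fin n) (Fin n) ℝ)} (hK : IsMatSubgroup ℝ n K)
    (hc : IsCompact K) :
    ∃ (H : Type) (_ : Group H) (_ : TopologicalSpace H) (_ : IsTopologicalGroup H)
      (_ : CompactSpace H) (_ : MeasurableSpace H) (_ : BorelSpace H) (μ : Measure H)
      (_ : IsProbabilityMeasure μ) (_ : μ.IsMulRightInvariant) (ρ : H →* Matrix (Fin n) (Fin n) ℝ),
      Continuous ρ ∧ Set.range ρ = K := by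
  let S : Submonoid (Matrix (Fin n) (Fin n) ℝ) :=
    { carrier := K, one_mem' := hK.1, mul_mem' := fun {a b} ha hb => hK.2.1 a ha b hb }
  let gS : Group S :=
    { (inferInstance : Monoid S) with
      inv := fun a => ⟨(a : Matrix (Fin n) (Fin n) ℝ)⁻¹, (hK.2.2 a a.2).2⟩
      inv_mul_cancel := fun a => Subtype.ext
        (Matrix.nonsing_inv_mul _ ((Matrix.isUnit_iff_isUnit_det _).mp (hK.2.2 a a.2).1)) }
  have hinv : Continuous fun a : S => a⁻¹ := by
    refine Continuous.subtype_mk (f := fun a : S => (a : Matrix (Fin n) (Fin n) ℝ)⁻¹) ?_ _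
    have : ∀ a : S, (a : Matrix (Fin n) (Fin n) ℝ)⁻¹ =
        (a : Matrix (Fin n) (Fin n) ℝ).det⁻¹ • (a : Matrix (Fin n) (Fin n) ℝ).adjugate := by
      intro a
      rw [Matrix.inv_def, Ring.inverse_eq_inv']
    simp only [this]
    have hv : Continuous fun a : S => (a : Matrix (Fin n) (Fin n) ℝ) := continuous_subtype_val
    refine (hv.matrix_det.inv₀ fun a => ?_).smul hv.matrix_adjugate
    exact ((Matrix.isUnit_iff_isUnit_det _).mp (hK.2.2 a a.2).1).ne_zero
  have tS : IsTopologicalGroup S := { continuous_inv := hinv }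
  have cS : CompactSpace S := isCompact_iff_compactSpace.mp hc
  let mS : MeasurableSpace S := borel S
  have bS : BorelSpace S := ⟨rfl⟩
  let μ₀ : Measure S := Measure.haarMeasure ⊤
  have hμ₀ : IsProbabilityMeasure μ₀ := ⟨by
    have := Measure.haarMeasure_self (G := S) (K₀ := ⊤)
    simpa using this⟩
  refine ⟨S, gS, inferInstance, tS, cS, mS, bS, μ₀.inv, ?_, inferInstance, S.subtype,
    continuous_subtype_val, Subtype.range_coe⟩
  exact ⟨by rw [Measure.inv_apply, Set.inv_univ, measure_univ]⟩

end Haar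
end ZPaper

namespace ZPaper

section PosDefFactor

open scoped MatrixOrder

theorem exists_transpose_mul_self_of_posDef {n : ℕ} {Q : Matrix (Fin n) (Fin n) ℝ}
    (hQ : Q.PosDef) : ∃ S : Matrix (Fin n) (Fin n) ℝ, IsUnit S.det ∧ S.transpose * S = Q := by
  have h0 : 0 ≤ Q := hQ.posSemidef.nonneg
  have hs : (CFC.sqrt Q) * CFC.sqrt Q = Q := CFC.sqrt_mul_sqrt_self Q h0
  have ht : (CFC.sqrt Q).transpose = CFC.sqrt Q := by
    have := (Matrix.nonneg_iff_posSemidef.mp (CFC.sqrt_nonneg Q)).isHermitian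
    rwa [Matrix.IsHermitian, Matrix.conjTranspose_eq_transpose_of_trivial] at this
  refine ⟨CFC.sqrt Q, ?_, by rw [ht, hs]⟩
  have hdet := (Matrix.isUnit_iff_isUnit_det Q).mp hQ.isUnit
  rw [← hs, Matrix.det_mul] at hdet
  exact isUnit_of_mul_isUnit_left hdet

end PosDefFactor

section Separation

open MeasureTheory

variable {σ : Type} [Fintype σ]

theorem exists_polynomial_near {A B : Set (σ → ℝ)} (hA : IsCompact A) (hB : IsCompact B)
    (hAB : Disjoint A B) : ∃ p : MvPolynomial σ ℝ, (∀ x ∈ A, eval x p ≤ 1 / 3) ∧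
      ∀ x ∈ B, 2 / 3 ≤ eval x p := by
  obtain ⟨f, hf0, hf1, -⟩ := exists_continuous_zero_one_of_isClosed hA.isClosed hB.isClosed hAB
  let φ : MvPolynomial σ ℝ →ₐ[ℝ] C(σ → ℝ, ℝ) :=
    aeval fun i => (⟨fun x => x i, continuous_apply i⟩ : C(σ → ℝ, ℝ))
  have hφ : ∀ p x, φ p x = eval x p := by
    intro p x
    have : (ContinuousMap.evalAlgHom ℝ ℝ x).comp φ = aeval x := by
      ext i
      simp [φ]
    simpa [coe_aeval_eq_eval] using DFunLike.congr_fun this p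
  have hsep : φ.range.SeparatesPoints := by
    intro x y hxy
    obtain ⟨i, hi⟩ := Function.ne_iff.mp hxy
    refine ⟨fun x => x i, ⟨φ (X i), ⟨X i, rfl⟩, ?_⟩, hi⟩
    ext x
    simp [hφ]
  obtain ⟨_, ⟨p, rfl⟩, hp⟩ :=
    ContinuousMap.exists_mem_subalgebra_near_continuous_of_isCompact_of_separatesPoints hsep f
      (hA.union hB) (ε := 1 / 3) (by norm_num)
  refine ⟨p, fun x hx => ?_, fun x hx => ?_⟩
  · have := hp x (Or.inl hx)
    have h0 : f x = 0 := hf0 hx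
    have e : (φ.toRingHom p) x = eval x p := hφ p x
    rw [h0, sub_zero, e, Real.norm_eq_abs] at this
    exact (abs_lt.mp this).2.le
  · have := hp x (Or.inr hx)
    have h0 : f x = 1 := hf1 hx
    have e : (φ.toRingHom p) x = eval x p := hφ p x
    rw [h0, e, Real.norm_eq_abs] at this
    linarith [(abs_lt.mp this).1]

variable {n : ℕ}

/-- Invariant polynomials of a compact group separate its orbits. -/
theorem exists_invariant_separating {K : Set (Matrix (Fin n) (Fin n) ℝ)} (hK : IsMatSubgroup ℝ n K)
    (hc : IsCompact K) (L : Matrix (Fin n) (Fin n) ℝ → (σ → ℝ) →ₗ[ℝ] (σ → ℝ))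
    (hL1 : L 1 = LinearMap.id) (hLm : ∀ a b, L (a * b) = L a ∘ₗ L b)
    (hLc : ∀ x, Continuous fun g => L g x) {w z : σ → ℝ} (hz : ∀ k ∈ K, L k w ≠ z) :
    ∃ F : MvPolynomial σ ℝ, (∀ k ∈ K, ∀ v, eval (L k v) F = eval v F) ∧ eval z F ≠ eval w F := by
  obtain ⟨H, _, _, _, _, _, _, μ, _, _, ρ, hρ, hr⟩ := exists_haar hK hc
  have hmem : ∀ h, ρ h ∈ K := fun h => hr ▸ Set.mem_range_self h
  have hcomp : ∀ x : σ → ℝ, IsCompact ((fun g => L g x) '' K) := fun x => hc.image (hLc x)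
  have hdis : Disjoint ((fun g => L g w) '' K) ((fun g => L g z) '' K) := by
    rw [Set.disjoint_left]
    rintro _ ⟨k, hk, rfl⟩ ⟨k', hk', he⟩
    have hdet := (Matrix.isUnit_iff_isUnit_det k').mp (hK.2.2 k' hk').1
    refine hz (k'⁻¹ * k) (hK.2.1 _ (hK.2.2 k' hk').2 _ hk) ?_
    have he' : L k' z = L k w := he
    rw [hLm, LinearMap.comp_apply, ← he', ← LinearMap.comp_apply, ← hLm,
      Matrix.nonsing_inv_mul _ hdet, hL1, LinearMap.id_apply]
  obtain ⟨p, hp1, hp2⟩ := exists_polynomial_near (hcomp w) (hcomp z) hdis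
  have hLρ : ∀ x, Continuous fun h => L (ρ h) x := fun x => (hLc x).comp hρ
  obtain ⟨F, hF, -⟩ := exists_average_eval μ hLρ p
  have hintg : ∀ x, Integrable (fun h => eval (L (ρ h) x) p) μ := by
    intro x
    refine integrable_of_continuous μ ?_
    have := continuous_linSub hLρ p (evalLin x)
    simpa only [evalLin_apply, eval_linSub] using this
  refine ⟨F, ?_, ?_⟩
  · intro k hk v
    rw [← hr] at hk
    obtain ⟨g, rfl⟩ := hk
    rw [hF, hF, ← integral_mul_right_eq_self (fun h => eval (L (ρ h) v) p) g]
    simp only [map_mul, hLm, LinearMap.comp_apply]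
  · have h1 : eval w F ≤ 1 / 3 := by
      rw [hF]
      calc _ ≤ ∫ _, (1 / 3 : ℝ) ∂μ := integral_mono (hintg w) (integrable_const _)
            fun h => hp1 _ ⟨ρ h, hmem h, rfl⟩
        _ = _ := by simp
    have h2 : 2 / 3 ≤ eval z F := by
      rw [hF]
      calc (2 / 3 : ℝ) = ∫ _, (2 / 3 : ℝ) ∂μ := by simp
        _ ≤ _ := integral_mono (integrable_const _) (hintg z)
            fun h => hp2 _ ⟨ρ h, hmem h, rfl⟩
    intro h
    linarith

theorem hasClosedOrbit_real {K : Set (Matrix (Fin n) (Fin n) ℝ)} (hK : IsMatSubgroup ℝ n K)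
    (hc : IsCompact K) (w : Fin n → ℝ) : HasClosedOrbit ℝ n K w := by
  intro z hz
  by_contra hcon
  obtain ⟨F, hF, hne⟩ := exists_invariant_separating hK hc (fun g => Matrix.mulVecLin g)
    Matrix.mulVecLin_one (fun a b => Matrix.mulVecLin_mul a b)
    (fun x => by
      simp only [Matrix.mulVecLin_apply]
      exact Continuous.matrix_mulVec continuous_id continuous_const) (w := w) (z := z)
    (fun k hk h => hcon ⟨k, hk, h⟩)
  have := hz (F - C (eval w F)) (by
    rintro _ ⟨k, hk, rfl⟩
    have := hF k hk w
    simpa [sub_eq_zero] using this)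
  rw [map_sub, eval_C, sub_eq_zero] at this
  exact hne this

theorem isZClosedSet_of_isCompact {K : Set (Matrix (Fin n) (Fin n) ℝ)} (hK : IsMatSubgroup ℝ n K)
    (hc : IsCompact K) : IsZClosedSet K := by
  intro g hg
  by_contra hcon
  have hflat : ∀ x, flat (flat.symm x : Matrix (Fin n) (Fin n) ℝ) = x := fun x =>
    flat.apply_symm_apply x
  obtain ⟨F, hF, hne⟩ := exists_invariant_separating hK hc (fun g => flatMulLeft g)
    (by
      refine LinearMap.ext fun x => ?_
      rw [← hflat x, flatMulLeft_flat, one_mul, LinearMap.id_apply])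
    (fun a b => by
      refine LinearMap.ext fun x => ?_
      rw [← hflat x, LinearMap.comp_apply, flatMulLeft_flat, flatMulLeft_flat, flatMulLeft_flat,
        mul_assoc])
    (fun x => by
      rw [← hflat x]
      simp only [flatMulLeft_flat]
      refine continuous_pi fun ij => ?_
      simp only [flat_apply]
      exact Continuous.matrix_elem (continuous_id.matrix_mul continuous_const) _ _)
    (w := flat 1) (z := flat g)
    (fun k hk h => hcon (by
      rw [flatMulLeft_flat, mul_one] at h
      exact flat.injective h ▸ hk))
  have := hg (F - C (eval (flat 1) F)) (by
    intro k hk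
    have := hF k hk (flat 1)
    rw [flatMulLeft_flat, mul_one] at this
    simpa [sub_eq_zero] using this)
  rw [map_sub, eval_C, sub_eq_zero] at this
  exact hne this

/-- A compact matrix group preserves an inner product. -/
theorem exists_orthogonalizer {K : Set (Matrix (Fin n) (Fin n) ℝ)} (hK : IsMatSubgroup ℝ n K)
    (hc : IsCompact K) : ∃ S : Matrix (Fin n) (Fin n) ℝ, IsUnit S.det ∧
      ∀ k ∈ K, k.transpose * (S.transpose * S) * k = S.transpose * S := by
  obtain ⟨H, _, _, _, _, _, _, μ, _, _, ρ, hρ, hr⟩ := exists_haar hK hc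
  have hcont : ∀ i j, Continuous fun h => ((ρ h).transpose * ρ h) i j := fun i j =>
    (hρ.matrix_transpose.matrix_mul hρ).matrix_elem i j
  let Q : Matrix (Fin n) (Fin n) ℝ := Matrix.of fun i j => ∫ h, ((ρ h).transpose * ρ h) i j ∂μ
  have hform : ∀ A B : Matrix (Fin n) (Fin n) ℝ, ∀ i j,
      (A * Q * B) i j = ∫ h, (A * ((ρ h).transpose * ρ h) * B) i j ∂μ := by
    intro A B i j
    simp only [Matrix.mul_apply, Matrix.of_apply, Q, Finset.sum_mul]
    rw [integral_finsetSum]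
    · refine Finset.sum_congr rfl fun x _ => ?_
      rw [integral_finsetSum]
      · refine Finset.sum_congr rfl fun y _ => ?_
        rw [integral_mul_const, integral_const_mul]
      · intro y _
        have := integrable_of_continuous μ (hcont y x)
        simp only [Matrix.mul_apply] at this
        exact (this.const_mul _).mul_const _
    · intro x _
      refine integrable_finsetSum _ fun y _ => ?_
      have := integrable_of_continuous μ (hcont y x)
      simp only [Matrix.mul_apply] at this
      exact (this.const_mul _).mul_const _
  have hinv : ∀ k ∈ K, k.transpose * Q * k = Q := by
    intro k hk
    rw [← hr] at hk
    obtain ⟨g, rfl⟩ := hk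
    ext i j
    rw [hform]
    simp only [Q, Matrix.of_apply]
    rw [← integral_mul_right_eq_self (fun h => ((ρ h).transpose * ρ h) i j) g]
    simp only [map_mul, Matrix.transpose_mul, mul_assoc]
  have hpos : Q.PosDef := by
    refine Matrix.PosDef.of_dotProduct_mulVec_pos ?_ ?_
    · ext i j
      simp [Q, Matrix.conjTranspose_apply, Matrix.mul_apply, mul_comm]
    · intro x hx
      have hval : star x ⬝ᵥ Q.mulVec x = ∫ h, (ρ h).mulVec x ⬝ᵥ (ρ h).mulVec x ∂μ := by
        have h1 := hform (Matrix.of fun _ j => x j) (Matrix.of fun j _ => x j)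
        rcases isEmpty_or_nonempty (Fin n) with hn | ⟨⟨i⟩⟩
        · exact absurd (Subsingleton.elim x 0) hx
        have h2 := h1 i i
        have h3 : ∀ M : Matrix (Fin n) (Fin n) ℝ,
            ((Matrix.of fun (_ : Fin n) j => x j) * M * (Matrix.of fun j (_ : Fin n) => x j)) i i =
              x ⬝ᵥ M.mulVec x := by
          intro M
          rw [mul_assoc]
          simp [Matrix.mul_apply, Matrix.mulVec, dotProduct]
        simp only [h3] at h2
        rw [star_trivial, h2]
        congr 1
        ext h
        rw [← Matrix.mulVec_mulVec, Matrix.dotProduct_mulVec, Matrix.vecMul_transpose]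
      rw [hval]
      have hc2 : Continuous fun h => (ρ h).mulVec x ⬝ᵥ (ρ h).mulVec x :=
        (hρ.matrix_mulVec continuous_const).dotProduct (hρ.matrix_mulVec continuous_const)
      have hp : ∀ h, 0 < (ρ h).mulVec x ⬝ᵥ (ρ h).mulVec x := by
        intro h
        have hne : (ρ h).mulVec x ≠ 0 := by
          intro h0
          apply hx
          have : (ρ h⁻¹).mulVec ((ρ h).mulVec x) = x := by
            rw [Matrix.mulVec_mulVec, ← map_mul, inv_mul_cancel, map_one, Matrix.one_mulVec]
          rw [← this, h0, Matrix.mulVec_zero]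
        have := Matrix.dotProduct_star_self_pos_iff.mpr hne
        simpa using this
      rw [integral_pos_iff_support_of_nonneg (fun h => (hp h).le) (integrable_of_continuous μ hc2)]
      have : Function.support (fun h => (ρ h).mulVec x ⬝ᵥ (ρ h).mulVec x) = Set.univ :=
        Set.eq_univ_of_forall fun h => (hp h).ne'
      rw [this]
      simp
  obtain ⟨S, hS, he⟩ := exists_transpose_mul_self_of_posDef hpos
  exact ⟨S, hS, fun k hk => by rw [he, hinv k hk]⟩

end Separation
end ZPaper

namespace ZPaper

section RealForms

variable {σ : Type} [Fintype σ]

/-- The inclusion of real vectors in complex vectors. -/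
def cv (w : σ → ℝ) : σ → ℂ := fun i => (w i : ℂ)

theorem cv_apply (w : σ → ℝ) (i : σ) : cv w i = (w i : ℂ) := rfl

/-- A real polynomial seen as a complex polynomial. -/
abbrev cPoly (p : MvPolynomial σ ℝ) : MvPolynomial σ ℂ := map Complex.ofRealHom p

theorem eval_cPoly (p : MvPolynomial σ ℝ) (x : σ → ℝ) :
    eval (cv x) (cPoly p) = ((eval x p : ℝ) : ℂ) := by
  induction p using MvPolynomial.induction_on with
  | C a => simp
  | add p q hp hq => simp only [map_add, hp, hq, Complex.ofReal_add, cPoly] at *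
  | mul_X p i hp => simp only [map_mul, hp, cPoly, map_X, eval_X, Complex.ofReal_mul, cv_apply] at *

theorem polyDiff_cPoly (p : MvPolynomial σ ℝ) (x v : σ → ℝ) :
    polyDiff (cPoly p) (cv x) (cv v) = ((polyDiff p x v : ℝ) : ℂ) := by
  simp only [polyDiff_apply, cPoly, pderiv_map, Complex.ofReal_sum, Complex.ofReal_mul]
  refine Finset.sum_congr rfl fun i _ => ?_
  rw [← eval_cPoly, cv_apply]

theorem exists_re_im (p : MvPolynomial σ ℂ) :
    ∃ p₁ p₂ : MvPolynomial σ ℝ, p = cPoly p₁ + C Complex.I * cPoly p₂ := by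
  induction p using MvPolynomial.induction_on with
  | C a =>
    refine ⟨C a.re, C a.im, ?_⟩
    simp only [cPoly, map_C, ← C_mul, ← C_add]
    congr 1
    exact (Complex.re_add_im a).symm.trans (by rw [mul_comm]; rfl)
  | add p q hp hq =>
    obtain ⟨p₁, p₂, hp⟩ := hp
    obtain ⟨q₁, q₂, hq⟩ := hq
    exact ⟨p₁ + q₁, p₂ + q₂, by rw [hp, hq]; simp only [cPoly, map_add]; ring⟩
  | mul_X p i hp =>
    obtain ⟨p₁, p₂, hp⟩ := hp
    exact ⟨p₁ * X i, p₂ * X i, by rw [hp]; simp only [cPoly, map_mul, map_X]; ring⟩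

theorem ofReal_add_I_mul_eq_zero {a b : ℝ} : (a : ℂ) + Complex.I * b = 0 ↔ a = 0 ∧ b = 0 := by
  simp [Complex.ext_iff]

/-- The complex conjugate of a complex vector. -/
def conjVec (v : σ → ℂ) : σ → ℂ := fun i => (starRingEnd ℂ) (v i)

theorem eval_conjVec (p : MvPolynomial σ ℂ) (x : σ → ℂ) :
    eval (conjVec x) p = (starRingEnd ℂ) (eval x (map (starRingEnd ℂ) p)) := by
  induction p using MvPolynomial.induction_on with
  | C a => simp
  | add p q hp hq => simp [hp, hq]
  | mul_X p i hp => simp [hp, conjVec]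

theorem conjVec_cv (x : σ → ℝ) : conjVec (cv x) = cv x := by
  ext i; simp [conjVec, cv]

end RealForms

section ComplexGroup

variable {n : ℕ}

/-- The inclusion of real matrices in complex matrices. -/
def cMat : Matrix (Fin n) (Fin n) ℝ →+* Matrix (Fin n) (Fin n) ℂ := Complex.ofRealHom.mapMatrix

theorem cMat_apply (A : Matrix (Fin n) (Fin n) ℝ) (i j : Fin n) : cMat A i j = (A i j : ℂ) := rfl

theorem flat_cMat (A : Matrix (Fin n) (Fin n) ℝ) : flat (cMat A) = cv (flat A) := rfl

theorem cMat_smul (t : ℝ) (A : Matrix (Fin n) (Fin n) ℝ) : cMat (t • A) = (t : ℂ) • cMat A := by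
  ext i j; simp [cMat_apply]

theorem cMat_transpose (A : Matrix (Fin n) (Fin n) ℝ) : (cMat A).transpose = cMat A.transpose := rfl

theorem cMat_mulVec (A : Matrix (Fin n) (Fin n) ℝ) (v : Fin n → ℝ) :
    (cMat A).mulVec (cv v) = cv (A.mulVec v) := by
  ext i
  simp [cMat_apply, cv_apply, Matrix.mulVec, dotProduct]

theorem cv_injective {σ : Type} : Function.Injective (cv (σ := σ)) := by
  intro x y h
  ext i
  have := congrFun h i
  simpa [cv] using this

variable {K : Set (Matrix (Fin n) (Fin n) ℝ)}

theorem mem_complexifiedGroup {g : Matrix (Fin n) (Fin n) ℂ} :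
    g ∈ complexifiedGroup n K ↔ ∀ p, VanishesOn (cMat '' K) p → eval (flat g) p = 0 := by
  have h1 : ∀ k : Matrix (Fin n) (Fin n) ℝ,
      (fun ij : Fin n × Fin n => (k ij.1 ij.2 : ℂ)) = flat (cMat k) := fun _ => rfl
  have h2 : (fun ij : Fin n × Fin n => g ij.1 ij.2) = flat g := rfl
  simp only [complexifiedGroup, Set.mem_ofPred_eq, h1, h2, VanishesOn, Set.forall_mem_image]

theorem cMat_mem {k : Matrix (Fin n) (Fin n) ℝ} (hk : k ∈ K) :
    cMat k ∈ complexifiedGroup n K :=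
  mem_complexifiedGroup.mpr fun _ hp => hp _ ⟨k, hk, rfl⟩

theorem vanishesOn_complexifiedGroup {p : MvPolynomial (Fin n × Fin n) ℂ} :
    VanishesOn (complexifiedGroup n K) p ↔ VanishesOn (cMat '' K) p := by
  constructor
  · rintro h _ ⟨k, hk, rfl⟩
    exact h _ (cMat_mem hk)
  · intro h g hg
    exact mem_complexifiedGroup.mp hg p h

theorem isZClosedSet_complexifiedGroup : IsZClosedSet (complexifiedGroup n K) := fun _ hg =>
  mem_complexifiedGroup.mpr fun p hp => hg p (vanishesOn_complexifiedGroup.mpr hp)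

/-- Right multiplication on flattened matrices. -/
def flatMulRight (g : Matrix (Fin n) (Fin n) ℂ) :
    (Fin n × Fin n → ℂ) →ₗ[ℂ] (Fin n × Fin n → ℂ) :=
  flat.toLinearMap ∘ₗ LinearMap.mulRight ℂ g ∘ₗ flat.symm.toLinearMap

theorem flatMulRight_flat (g A : Matrix (Fin n) (Fin n) ℂ) :
    flatMulRight g (flat A) = flat (A * g) := by
  simp [flatMulRight]

theorem mul_mem_complexifiedGroup (hK : IsMatSubgroup ℝ n K) {g h : Matrix (Fin n) (Fin n) ℂ}
    (hg : g ∈ complexifiedGroup n K) (hh : h ∈ complexifiedGroup n K) :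
    g * h ∈ complexifiedGroup n K := by
  rw [mem_complexifiedGroup]
  intro p hp
  have h1 : VanishesOn (cMat '' K) (linSub (flatMulRight h) p) := by
    rintro _ ⟨k, hk, rfl⟩
    rw [eval_linSub, flatMulRight_flat, ← flatMulLeft_flat, ← eval_linSub]
    refine mem_complexifiedGroup.mp hh _ ?_
    rintro _ ⟨k', hk', rfl⟩
    rw [eval_linSub, flatMulLeft_flat, ← map_mul]
    exact hp _ ⟨_, hK.2.1 k hk k' hk', rfl⟩
  have := mem_complexifiedGroup.mp hg _ h1
  rwa [eval_linSub, flatMulRight_flat] at this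

theorem transpose_mul_mul_of_mem {Q : Matrix (Fin n) (Fin n) ℝ}
    (hQ : ∀ k ∈ K, k.transpose * Q * k = Q) {g : Matrix (Fin n) (Fin n) ℂ}
    (hg : g ∈ complexifiedGroup n K) : g.transpose * cMat Q * g = cMat Q := by
  ext i j
  let p : MvPolynomial (Fin n × Fin n) ℂ :=
    (∑ b, (∑ a, X (a, i) * C (cMat Q a b)) * X (b, j)) - C (cMat Q i j)
  have hp : ∀ g, eval (flat g) p = (g.transpose * cMat Q * g) i j - cMat Q i j := by
    intro g
    simp [p, Matrix.mul_apply, flat_apply]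
  have := mem_complexifiedGroup.mp hg p (by
    rintro _ ⟨k, hk, rfl⟩
    rw [hp, cMat_transpose, ← map_mul, ← map_mul, hQ k hk, sub_self])
  rwa [hp, sub_eq_zero] at this

theorem isUnit_cMat_det {S : Matrix (Fin n) (Fin n) ℝ} (hS : IsUnit S.det) :
    IsUnit (cMat S).det := by
  have : (cMat S).det = ((S.det : ℝ) : ℂ) := (RingHom.map_det Complex.ofRealHom S).symm
  rw [this]
  simpa using hS.ne_zero

theorem isMatSubgroup_complexifiedGroup (hK : IsMatSubgroup ℝ n K) (hc : IsCompact K) :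
    IsMatSubgroup ℂ n (complexifiedGroup n K) := by
  refine ⟨by simpa using cMat_mem hK.1, fun a ha b hb => mul_mem_complexifiedGroup hK ha hb,
    fun g hg => ?_⟩
  obtain ⟨S, hS, hQ⟩ := exists_orthogonalizer hK hc
  set Q := S.transpose * S with hQdef
  have hQdet : IsUnit Q.det := by
    rw [hQdef, Matrix.det_mul, Matrix.det_transpose]
    exact hS.mul hS
  have hQc := isUnit_cMat_det hQdet
  have h1 : ((cMat Q)⁻¹ * g.transpose * cMat Q) * g = 1 := by
    rw [mul_assoc, mul_assoc, ← mul_assoc g.transpose, transpose_mul_mul_of_mem hQ hg,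
      Matrix.nonsing_inv_mul _ hQc]
  have hginv : g⁻¹ = (cMat Q)⁻¹ * g.transpose * cMat Q := Matrix.inv_eq_left_inv h1
  refine ⟨IsUnit.of_mul_eq_one_right _ h1, ?_⟩
  rw [hginv, mem_complexifiedGroup]
  intro p hp
  let L : (Fin n × Fin n → ℂ) →ₗ[ℂ] (Fin n × Fin n → ℂ) :=
    flat.toLinearMap ∘ₗ LinearMap.mulRight ℂ (cMat Q) ∘ₗ LinearMap.mulLeft ℂ (cMat Q)⁻¹ ∘ₗ
      (Matrix.transposeLinearEquiv (Fin n) (Fin n) ℂ ℂ).toLinearMap ∘ₗ flat.symm.toLinearMap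
  have hL : ∀ A, L (flat A) = flat ((cMat Q)⁻¹ * A.transpose * cMat Q) := by
    intro A
    simp [L]
  have := mem_complexifiedGroup.mp hg (linSub L p) (by
    rintro _ ⟨k, hk, rfl⟩
    have hkk : ((cMat Q)⁻¹ * (cMat k).transpose * cMat Q) * cMat k = 1 := by
      rw [mul_assoc, mul_assoc, ← mul_assoc (cMat k).transpose,
        transpose_mul_mul_of_mem hQ (cMat_mem hk), Matrix.nonsing_inv_mul _ hQc]
    have hkinv : (cMat k)⁻¹ = cMat k⁻¹ := by
      refine Matrix.inv_eq_left_inv ?_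
      rw [← map_mul, Matrix.nonsing_inv_mul _
        ((Matrix.isUnit_iff_isUnit_det k).mp (hK.2.2 k hk).1), map_one]
    rw [eval_linSub, hL, ← Matrix.inv_eq_left_inv hkk, hkinv]
    exact hp _ ⟨_, (hK.2.2 k hk).2, rfl⟩)
  rwa [eval_linSub, hL] at this

/-- The orbit map on flattened matrices. -/
def flatEvalAt (v : Fin n → ℂ) : (Fin n × Fin n → ℂ) →ₗ[ℂ] (Fin n → ℂ) :=
  evalAt v ∘ₗ flat.symm.toLinearMap

theorem flatEvalAt_flat (v : Fin n → ℂ) (g : Matrix (Fin n) (Fin n) ℂ) :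
    flatEvalAt v (flat g) = g.mulVec v := by
  simp [flatEvalAt, evalAt_apply]

theorem invariant_complexifiedGroup {p : MvPolynomial (Fin n) ℂ}
    (hp : ∀ k ∈ K, ∀ v, eval ((cMat k).mulVec v) p = eval v p) :
    Invariant ℂ n (complexifiedGroup n K) p := by
  intro g hg v
  have := mem_complexifiedGroup.mp hg (linSub (flatEvalAt v) p - C (eval v p)) (by
    rintro _ ⟨k, hk, rfl⟩
    rw [map_sub, eval_linSub, eval_C, flatEvalAt_flat, hp k hk, sub_self])
  rwa [map_sub, eval_linSub, eval_C, flatEvalAt_flat, sub_eq_zero] at this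

theorem conj_mem_complexifiedGroup {g : Matrix (Fin n) (Fin n) ℂ}
    (hg : g ∈ complexifiedGroup n K) : g.map (starRingEnd ℂ) ∈ complexifiedGroup n K := by
  rw [mem_complexifiedGroup]
  intro p hp
  have h1 : flat (g.map (starRingEnd ℂ)) = conjVec (flat g) := rfl
  rw [h1, eval_conjVec, mem_complexifiedGroup.mp hg, map_zero]
  rintro _ ⟨k, hk, rfl⟩
  have := hp _ ⟨k, hk, rfl⟩
  rw [flat_cMat, ← conjVec_cv, eval_conjVec, map_eq_zero] at this
  exact this

theorem mem_of_cMat_mem (hZ : IsZClosedSet K) {k : Matrix (Fin n) (Fin n) ℝ}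
    (hk : cMat k ∈ complexifiedGroup n K) : k ∈ K := by
  refine hZ k fun p hp => ?_
  have := mem_complexifiedGroup.mp hk (cPoly p) (by
    rintro _ ⟨k, hk, rfl⟩
    rw [flat_cMat, eval_cPoly, hp k hk, Complex.ofReal_zero])
  rw [flat_cMat, eval_cPoly] at this
  exact_mod_cast this

theorem mem_tangentOne_complexifiedGroup {A B : Matrix (Fin n) (Fin n) ℝ} :
    cMat A + Complex.I • cMat B ∈ tangentOne (complexifiedGroup n K) ↔
      A ∈ tangentOne K ∧ B ∈ tangentOne K := by
  have hflat1 : flat (1 : Matrix (Fin n) (Fin n) ℂ) = cv (flat 1) := by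
    rw [← flat_cMat, map_one cMat]
  constructor
  · intro h
    have key : ∀ p, VanishesOn K p → polyDiff p (flat 1) (flat A) = 0 ∧
        polyDiff p (flat 1) (flat B) = 0 := by
      intro p hp
      have := h (cPoly p) (vanishesOn_complexifiedGroup.mpr (by
        rintro _ ⟨k, hk, rfl⟩
        rw [flat_cMat, eval_cPoly, hp k hk, Complex.ofReal_zero]))
      rw [map_add, map_smul, map_add, map_smul, hflat1, flat_cMat, flat_cMat, polyDiff_cPoly,
        polyDiff_cPoly, smul_eq_mul] at this
      exact ofReal_add_I_mul_eq_zero.mp this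
    exact ⟨fun p hp => (key p hp).1, fun p hp => (key p hp).2⟩
  · rintro ⟨hA, hB⟩ p hp
    rw [vanishesOn_complexifiedGroup] at hp
    obtain ⟨p₁, p₂, rfl⟩ := exists_re_im p
    have hv : ∀ k ∈ K, eval (flat k) p₁ = 0 ∧ eval (flat k) p₂ = 0 := by
      intro k hk
      have := hp _ ⟨k, hk, rfl⟩
      rw [flat_cMat, map_add, map_mul, eval_C, eval_cPoly, eval_cPoly] at this
      exact ofReal_add_I_mul_eq_zero.mp this
    have h1 := fun k hk => (hv k hk).1
    have h2 := fun k hk => (hv k hk).2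
    rw [map_add, map_smul, map_add, map_smul, hflat1, flat_cMat, flat_cMat, polyDiff_add,
      polyDiff_add, polyDiff_mul, polyDiff_mul, polyDiff_C, polyDiff_C, polyDiff_cPoly,
      polyDiff_cPoly, polyDiff_cPoly, polyDiff_cPoly, hA _ h1, hA _ h2, hB _ h1, hB _ h2]
    simp

/-- The real part of a complex matrix. -/
def reMat (M : Matrix (Fin n) (Fin n) ℂ) : Matrix (Fin n) (Fin n) ℝ := M.map Complex.re

/-- The imaginary part of a complex matrix. -/
def imMat (M : Matrix (Fin n) (Fin n) ℂ) : Matrix (Fin n) (Fin n) ℝ := M.map Complex.im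

theorem cMat_re_add_im (M : Matrix (Fin n) (Fin n) ℂ) :
    cMat (reMat M) + Complex.I • cMat (imMat M) = M := by
  ext i j
  simp [cMat_apply, reMat, imMat, Complex.ext_iff]

end ComplexGroup
end ZPaper

namespace ZPaper

section Rank

variable {𝕜 : Type} [RCLike 𝕜] {σ τ : Type} [Fintype σ] [Fintype τ]

theorem exists_poly_finrank_le {ι : Type*} (s : ι → τ → MvPolynomial σ 𝕜) (y : σ → 𝕜) :
    ∃ f : MvPolynomial σ 𝕜, eval y f ≠ 0 ∧ ∀ v, eval v f ≠ 0 →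
      Module.finrank 𝕜 (Submodule.span 𝕜 (Set.range fun i => fun j => eval y (s i j))) ≤
        Module.finrank 𝕜 (Submodule.span 𝕜 (Set.range fun i => fun j => eval v (s i j))) := by
  obtain ⟨b, hb, -, hli⟩ := Submodule.exists_fun_fin_finrank_span_eq 𝕜
    (Set.range fun i => fun j => eval y (s i j))
  choose c hc using hb
  obtain ⟨f, hf, hfv⟩ := exists_poly_linearIndependent (fun i => s (c i)) y (by
    have : (fun i => fun j => eval y (s (c i) j)) = b := funext hc
    rw [this]; exact hli)
  refine ⟨f, hf, fun v hv => ?_⟩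
  have h1 := finrank_span_eq_card (hfv v hv)
  rw [Fintype.card_fin] at h1
  rw [← h1]
  apply Submodule.finrank_mono
  apply Submodule.span_mono
  rintro _ ⟨i, rfl⟩
  exact ⟨c i, rfl⟩

variable {n : ℕ}

/-- The vector field of a matrix, in coordinates. -/
def vectorField (A : Matrix (Fin n) (Fin n) 𝕜) (i : Fin n) : MvPolynomial (Fin n) 𝕜 :=
  ∑ j, C (A i j) * X j

theorem eval_vectorField (A : Matrix (Fin n) (Fin n) 𝕜) (v : Fin n → 𝕜) :
    (fun i => eval v (vectorField A i)) = A.mulVec v := by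
  ext i
  simp [vectorField, Matrix.mulVec, dotProduct]

theorem span_vectorField (S : Submodule 𝕜 (Matrix (Fin n) (Fin n) 𝕜)) (v : Fin n → 𝕜) :
    Submodule.span 𝕜 (Set.range fun A : S => fun i => eval v (vectorField (A : Matrix _ _ 𝕜) i)) =
      S.map (evalAt v) := by
  have h : (Set.range fun A : S => fun i => eval v (vectorField (A : Matrix _ _ 𝕜) i)) =
      (S.map (evalAt v) : Set (Fin n → 𝕜)) := by
    ext x
    constructor
    · rintro ⟨A, rfl⟩
      exact ⟨A, A.2, (eval_vectorField _ _).symm⟩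
    · rintro ⟨A, hA, rfl⟩
      exact ⟨⟨A, hA⟩, eval_vectorField _ _⟩
  rw [h, Submodule.span_eq]

theorem exists_poly_finrank_map_le (S : Submodule 𝕜 (Matrix (Fin n) (Fin n) 𝕜)) (y : Fin n → 𝕜) :
    ∃ f : MvPolynomial (Fin n) 𝕜, eval y f ≠ 0 ∧ ∀ v, eval v f ≠ 0 →
      Module.finrank 𝕜 (S.map (evalAt y)) ≤ Module.finrank 𝕜 (S.map (evalAt v)) := by
  obtain ⟨f, hf, h⟩ := exists_poly_finrank_le
    (fun A : S => fun i => vectorField (A : Matrix (Fin n) (Fin n) 𝕜) i) y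
  refine ⟨f, hf, fun v hv => ?_⟩
  rw [← span_vectorField, ← span_vectorField]
  exact h v hv

theorem finrank_map_le_of_forall {S : Submodule 𝕜 (Matrix (Fin n) (Fin n) 𝕜)} {y x : Fin n → 𝕜}
    (h : ∀ A ∈ S, A.mulVec y = 0 → A.mulVec x = 0) :
    Module.finrank 𝕜 (S.map (evalAt x)) ≤ Module.finrank 𝕜 (S.map (evalAt y)) := by
  have hr : ∀ v : Fin n → 𝕜, S.map (evalAt v) = LinearMap.range ((evalAt v).domRestrict S) := by
    intro v
    rw [LinearMap.range_domRestrict]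
  have h1 := LinearMap.finrank_range_add_finrank_ker ((evalAt x).domRestrict S)
  have h2 := LinearMap.finrank_range_add_finrank_ker ((evalAt y).domRestrict S)
  have h3 : LinearMap.ker ((evalAt y).domRestrict S) ≤ LinearMap.ker ((evalAt x).domRestrict S) :=
    fun A hA => h A A.2 hA
  have h4 := Submodule.finrank_mono h3
  rw [hr, hr]
  omega

theorem finrank_map_mulVec_le {G : Set (Matrix (Fin n) (Fin n) 𝕜)} (hG : IsMatSubgroup 𝕜 n G)
    (hZ : IsZClosedSet G) {g : Matrix (Fin n) (Fin n) 𝕜} (hg : g ∈ G) (u : Fin n → 𝕜) :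
    Module.finrank 𝕜 ((tangentOne G).map (evalAt (g.mulVec u))) ≤
      Module.finrank 𝕜 ((tangentOne G).map (evalAt u)) := by
  have hgi := hG.2.2 g hg
  have hdet := (Matrix.isUnit_iff_isUnit_det _).mp hgi.1
  have h : (tangentOne G).map (evalAt (g.mulVec u)) ≤
      ((tangentOne G).map (evalAt u)).map g.mulVecLin := by
    rintro _ ⟨A, hA, rfl⟩
    refine ⟨(g⁻¹ * A * g).mulVec u, ⟨g⁻¹ * A * g, ?_, rfl⟩, ?_⟩
    · have := conj_mem_tangentOne hG hZ hA hgi.2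
      rwa [Matrix.nonsing_inv_nonsing_inv _ hdet] at this
    · simp only [Matrix.mulVecLin_apply, evalAt_apply, Matrix.mulVec_mulVec, ← mul_assoc]
      rw [Matrix.mul_nonsing_inv _ hdet, one_mul]
  exact (Submodule.finrank_mono h).trans (Submodule.finrank_map_le _ _)

attribute [local instance] matNormedRing matNormedAlgebra

theorem eventually_exists_exp_mulVec {S : Submodule 𝕜 (Matrix (Fin n) (Fin n) 𝕜)} {y : Fin n → 𝕜}
    {N : Submodule 𝕜 (Fin n → 𝕜)} (h : S.map (evalAt y) ⊔ N = ⊤) :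
    ∀ᶠ v in nhds y, ∃ A ∈ S, ∃ x ∈ N, v = (NormedSpace.exp A).mulVec (y + x) := by
  let B : Matrix (Fin n) (Fin n) 𝕜 →L[𝕜] (Fin n → 𝕜) →L[𝕜] (Fin n → 𝕜) :=
    LinearMap.toContinuousLinearMap
      ((LinearMap.toContinuousLinearMap : _ ≃ₗ[𝕜] ((Fin n → 𝕜) →L[𝕜] (Fin n → 𝕜))).toLinearMap ∘ₗ
        (Matrix.mulVecBilin 𝕜 𝕜))
  have hB : ∀ A x, B A x = A.mulVec x := fun A x => rfl
  have hexp : HasStrictFDerivAt (fun q : S × N => NormedSpace.exp (q.1 : Matrix (Fin n) (Fin n) 𝕜))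
      (S.subtypeL ∘L ContinuousLinearMap.fst 𝕜 S N) 0 := by
    have h1 : HasStrictFDerivAt (fun q : S × N => (q.1 : Matrix (Fin n) (Fin n) 𝕜))
      (S.subtypeL ∘L ContinuousLinearMap.fst 𝕜 S N) 0 :=
      (S.subtypeL ∘L ContinuousLinearMap.fst 𝕜 S N).hasStrictFDerivAt
    have h2 := (hasStrictFDerivAt_exp_zero (𝕂 := 𝕜) (𝔸 := Matrix (Fin n) (Fin n) 𝕜))
    have h3 := HasStrictFDerivAt.comp (x := (0 : S × N)) (f := fun q : S × N => (q.1 : Matrix (Fin n) (Fin n) 𝕜)) (g := NormedSpace.exp) h2 h1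
    exact h3
  have hx : HasStrictFDerivAt (fun q : S × N => y + (q.2 : Fin n → 𝕜))
      (N.subtypeL ∘L ContinuousLinearMap.snd 𝕜 S N) 0 :=
    ((N.subtypeL ∘L ContinuousLinearMap.snd 𝕜 S N).hasStrictFDerivAt).const_add y
  have hmain := B.hasStrictFDerivAt_of_bilinear hexp hx
  have hmap := hmain.map_nhds_eq_of_surj (by
    rw [eq_top_iff, ← h, sup_le_iff]
    constructor
    · rintro _ ⟨A, hA, rfl⟩
      refine ⟨(⟨A, hA⟩, 0), ?_⟩
      simp [hB, evalAt_apply]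
    · intro x hx
      refine ⟨(0, ⟨x, hx⟩), ?_⟩
      simp [hB])
  have h0 : B (NormedSpace.exp ((0 : S × N).1 : Matrix (Fin n) (Fin n) 𝕜)) (y + ((0 : S × N).2 : Fin n → 𝕜)) = y := by
    simp [hB]
  rw [h0] at hmap
  rw [← hmap, Filter.eventually_map]
  exact Filter.Eventually.of_forall fun q => ⟨q.1, q.1.2, q.2, q.2.2, (hB _ _)⟩

theorem finrank_map_le_of_slice {G : Set (Matrix (Fin n) (Fin n) 𝕜)} (hG : IsMatSubgroup 𝕜 n G)
    (hZ : IsZClosedSet G) {y : Fin n → 𝕜} {N : Submodule 𝕜 (Fin n → 𝕜)}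
    (hN : (tangentOne G).map (evalAt y) ⊔ N = ⊤)
    (hk : ∀ A ∈ tangentOne G, A.mulVec y = 0 → ∀ x ∈ N, A.mulVec x = 0) (v : Fin n → 𝕜) :
    Module.finrank 𝕜 ((tangentOne G).map (evalAt v)) ≤
      Module.finrank 𝕜 ((tangentOne G).map (evalAt y)) := by
  by_contra! hlt
  obtain ⟨f, hf, hfv⟩ := exists_poly_finrank_map_le (tangentOne G) v
  apply hf
  refine eval_eq_zero_of_eventually f y ?_ v
  filter_upwards [eventually_exists_exp_mulVec hN] with u hu
  obtain ⟨A, hA, x, hx, rfl⟩ := hu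
  by_contra hne
  have h1 := hfv _ hne
  have h2 := finrank_map_mulVec_le hG hZ (exp_mem hG.1 hG.2.1 hZ hA) (y + x)
  have h3 : Module.finrank 𝕜 ((tangentOne G).map (evalAt (y + x))) ≤
      Module.finrank 𝕜 ((tangentOne G).map (evalAt y)) := by
    apply finrank_map_le_of_forall
    intro B hB hBy
    rw [Matrix.mulVec_add, hBy, hk B hB hBy x hx, add_zero]
  omega

theorem mulVec_eq_zero_of_maximal_finrank {S : Submodule 𝕜 (Matrix (Fin n) (Fin n) 𝕜)}
    {v : Fin n → 𝕜}
    (hmax : ∀ u, Module.finrank 𝕜 (S.map (evalAt u)) ≤ Module.finrank 𝕜 (S.map (evalAt v)))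
    {N : Submodule 𝕜 (Fin n → 𝕜)} (hN : Disjoint (S.map (evalAt v)) N)
    {A : Matrix (Fin n) (Fin n) 𝕜} (hA : A ∈ S) (hAv : A.mulVec v = 0) {x : Fin n → 𝕜}
    (hx : A.mulVec x ∈ N) : A.mulVec x = 0 := by
  by_contra hne
  obtain ⟨b, hb, hspan, hli⟩ := Submodule.exists_fun_fin_finrank_span_eq 𝕜
    (S.map (evalAt v) : Set (Fin n → 𝕜))
  replace hspan := hspan.trans (Submodule.span_eq _)
  choose c hc hcb using hb
  let s : Fin (_ + 1) → Fin n → MvPolynomial (Fin n) 𝕜 :=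
    Fin.cons (fun j => C (A.mulVec x j)) (fun i => vectorField (c i))
  have hs : ∀ u, (fun i => fun j => eval u (s i j)) =
      Fin.cons (A.mulVec x) (fun i => (c i).mulVec u) := by
    intro u
    funext i
    refine Fin.cases ?_ (fun i => ?_) i
    · change (fun j => eval u (C (A.mulVec x j))) = A.mulVec x
      simp
    · simp only [s, Fin.cons_succ, eval_vectorField]
  obtain ⟨f, hf, hfv⟩ := exists_poly_linearIndependent s v (by
    rw [hs, linearIndependent_finCons]
    have : (fun i => (c i).mulVec v) = b := funext hcb
    rw [this]
    refine ⟨hli, fun hmem => hne ?_⟩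
    rw [hspan] at hmem
    exact Submodule.disjoint_def.mp hN _ hmem hx)
  obtain ⟨t, ht, htf⟩ := exists_ne_zero_near f v x hf Polynomial.X Polynomial.X_ne_zero
  have hl := hfv _ htf
  rw [hs] at hl
  have hcard := finrank_span_eq_card hl
  have hle : Submodule.span 𝕜 (Set.range (Fin.cons (A.mulVec x)
      (fun i => (c i).mulVec (v + t • x)) : Fin (_ + 1) → Fin n → 𝕜)) ≤
      S.map (evalAt (v + t • x)) := by
    rw [Submodule.span_le]
    rintro _ ⟨i, rfl⟩
    refine Fin.cases ?_ (fun i => ?_) i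
    · refine ⟨t⁻¹ • A, S.smul_mem _ hA, ?_⟩
      rw [Polynomial.eval_X] at ht
      change _ = A.mulVec x
      simp [evalAt_apply, Matrix.mulVec_add, hAv, Matrix.mulVec_smul, smul_smul, inv_mul_cancel₀ ht]
    · exact ⟨c i, hc i, rfl⟩
  have h1 := Submodule.finrank_mono hle
  have h2 := hmax (v + t • x)
  rw [hcard, Fintype.card_fin, Submodule.span_eq] at h1
  omega

end Rank
end ZPaper

namespace ZPaper

section ExpSums

open scoped ComplexOrder

/-- Exponentials with real frequency. -/
def expChar (b : ℝ) : ℂ → ℂ := fun t => Complex.exp (t * b)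

/-- Exponential sums with real frequencies. -/
def expSums : Subalgebra ℂ (ℂ → ℂ) := Algebra.adjoin ℂ (Set.range expChar)

theorem expSums_eq_span : Subalgebra.toSubmodule expSums =
    Submodule.span ℂ (Set.range expChar) := by
  let M : Submonoid (ℂ → ℂ) :=
    { carrier := Set.range expChar
      one_mem' := ⟨0, by ext t; simp [expChar]⟩
      mul_mem' := by
        rintro _ _ ⟨a, rfl⟩ ⟨b, rfl⟩
        refine ⟨a + b, ?_⟩
        ext t
        simp [expChar, mul_add, Complex.exp_add] }
  have h : (Submonoid.closure (Set.range expChar) : Set (ℂ → ℂ)) = Set.range expChar :=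
    congrArg (fun N : Submonoid (ℂ → ℂ) => (N : Set (ℂ → ℂ))) (Submonoid.closure_eq M)
  rw [expSums, Algebra.adjoin_eq_span, h]

theorem linearIndependent_exp_pow :
    LinearIndependent ℂ (fun b : ℝ => fun m : ℕ => (Real.exp b : ℂ) ^ m) := by
  have h := (linearIndependent_monoidHom (Multiplicative ℕ) ℂ).comp
    (fun b : ℝ => powersHom ℂ (Real.exp b : ℂ)) (by
      intro a b hab
      have := (powersHom ℂ).injective hab
      exact Real.exp_injective (by exact_mod_cast this))
  exact h

theorem eq_zero_of_mem_expSums {f : ℂ → ℂ} (hf : f ∈ expSums) (h : ∀ m : ℕ, f m = 0) : f = 0 := by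
  have hf' : f ∈ Subalgebra.toSubmodule expSums := hf
  rw [expSums_eq_span, Finsupp.mem_span_range_iff_exists_finsupp] at hf'
  obtain ⟨c, rfl⟩ := hf'
  have hc : c = 0 := by
    refine linearIndependent_iff.mp linearIndependent_exp_pow c ?_
    ext m
    have := h m
    simp only [Finsupp.sum, Finset.sum_apply, Pi.smul_apply, expChar] at this
    simp only [Finsupp.linearCombination_apply, Finsupp.sum, Finset.sum_apply, Pi.smul_apply,
      Pi.zero_apply]
    rw [← this]
    refine Finset.sum_congr rfl fun b _ => ?_
    rw [Complex.ofReal_exp, ← Complex.exp_nat_mul]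
  simp [hc]

theorem eval_mem_expSums {σ : Type} (p : MvPolynomial σ ℂ) (x : σ → ℂ → ℂ)
    (hx : ∀ i, x i ∈ expSums) : (fun t => eval (fun i => x i t) p) ∈ expSums := by
  induction p using MvPolynomial.induction_on with
  | C a =>
    simp only [eval_C]
    exact expSums.algebraMap_mem a
  | add p q hp hq =>
    simp only [map_add]
    exact expSums.add_mem hp hq
  | mul_X p i hp =>
    simp only [map_mul, eval_X]
    exact expSums.mul_mem hp (hx i)

variable {n : ℕ}

/-- A one-parameter group of diagonalizable matrices with positive eigenvalues. -/
def diagFlow (R : Matrix (Fin n) (Fin n) ℂ) (l : Fin n → ℝ) (t : ℂ) : Matrix (Fin n) (Fin n) ℂ :=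
  R * Matrix.diagonal (fun i => Complex.exp (t * l i)) * R⁻¹

theorem diagFlow_mem_expSums (R : Matrix (Fin n) (Fin n) ℂ) (l : Fin n → ℝ) (i j : Fin n) :
    (fun t => diagFlow R l t i j) ∈ expSums := by
  have : (fun t => diagFlow R l t i j) =
      ∑ k, (R i k * R⁻¹ k j) • expChar (l k) := by
    ext t
    rw [diagFlow, Matrix.mul_apply]
    simp only [Matrix.mul_diagonal, Finset.sum_apply, Pi.smul_apply, smul_eq_mul, expChar]
    exact Finset.sum_congr rfl fun k _ => by ring
  rw [this]
  exact expSums.sum_mem fun k _ => expSums.smul_mem (Algebra.subset_adjoin ⟨l k, rfl⟩) _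

theorem diagFlow_add {R : Matrix (Fin n) (Fin n) ℂ} (hR : IsUnit R.det) (l : Fin n → ℝ)
    (s t : ℂ) : diagFlow R l (s + t) = diagFlow R l s * diagFlow R l t := by
  have : diagFlow R l s * diagFlow R l t = R * Matrix.diagonal (fun i => Complex.exp (s * l i)) *
      (R⁻¹ * R) * Matrix.diagonal (fun i => Complex.exp (t * l i)) * R⁻¹ := by
    simp only [diagFlow, mul_assoc]
  rw [this, Matrix.nonsing_inv_mul _ hR, mul_one, mul_assoc R, Matrix.diagonal_mul_diagonal]
  simp only [diagFlow, add_mul, Complex.exp_add]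

theorem diagFlow_zero {R : Matrix (Fin n) (Fin n) ℂ} (hR : IsUnit R.det) (l : Fin n → ℝ) :
    diagFlow R l 0 = 1 := by
  simp [diagFlow, Matrix.mul_nonsing_inv _ hR]

theorem diagFlow_natCast {R : Matrix (Fin n) (Fin n) ℂ} (hR : IsUnit R.det) (l : Fin n → ℝ)
    (m : ℕ) : diagFlow R l m = diagFlow R l 1 ^ m := by
  induction m with
  | zero => simp [diagFlow_zero hR]
  | succ m ih => rw [Nat.cast_succ, diagFlow_add hR, ih, pow_succ]

/-- The generator of `diagFlow`. -/
def diagGen (R : Matrix (Fin n) (Fin n) ℂ) (l : Fin n → ℝ) : Matrix (Fin n) (Fin n) ℂ :=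
  R * Matrix.diagonal (fun i => (l i : ℂ)) * R⁻¹

theorem exp_smul_diagGen {R : Matrix (Fin n) (Fin n) ℂ} (hR : IsUnit R.det) (l : Fin n → ℝ)
    (t : ℂ) : NormedSpace.exp (t • diagGen R l) = diagFlow R l t := by
  have h : t • diagGen R l = R * Matrix.diagonal (fun i => t * (l i : ℂ)) * R⁻¹ := by
    rw [diagGen, ← Matrix.smul_mul, ← Matrix.mul_smul, ← Matrix.diagonal_smul]
    rfl
  rw [h, Matrix.exp_conj _ _ ((Matrix.isUnit_iff_isUnit_det _).mpr hR), Matrix.exp_diagonal,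
    diagFlow]
  congr 3
  ext i
  rw [Pi.coe_exp, Complex.exp_eq_exp_ℂ]

theorem diagGen_mulVec_eq_zero {R : Matrix (Fin n) (Fin n) ℂ} (hR : IsUnit R.det) {l : Fin n → ℝ}
    {x : Fin n → ℂ} (h : (diagFlow R l 1).mulVec x = x) : (diagGen R l).mulVec x = 0 := by
  have h1 : (Matrix.diagonal (fun i => Complex.exp (1 * l i))).mulVec (R⁻¹.mulVec x) =
      R⁻¹.mulVec x := by
    conv_rhs => rw [← h]
    rw [diagFlow, Matrix.mulVec_mulVec, Matrix.mulVec_mulVec, ← mul_assoc, ← mul_assoc,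
      Matrix.nonsing_inv_mul _ hR, one_mul]
  have h2 : (Matrix.diagonal (fun i => (l i : ℂ))).mulVec (R⁻¹.mulVec x) = 0 := by
    ext i
    have := congrFun h1 i
    rw [Matrix.mulVec_diagonal] at this ⊢
    rw [Pi.zero_apply, mul_eq_zero]
    by_cases hx : R⁻¹.mulVec x i = 0
    · exact Or.inr hx
    · left
      have h3 := mul_right_cancel₀ hx (this.trans (one_mul _).symm)
      rw [one_mul, ← Complex.ofReal_exp] at h3
      have h4 : Real.exp (l i) = 1 := by exact_mod_cast h3
      rw [Real.exp_eq_one_iff] at h4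
      simp [h4]
  rw [diagGen, mul_assoc, ← Matrix.mulVec_mulVec, ← Matrix.mulVec_mulVec, h2, Matrix.mulVec_zero]

theorem exists_diagFlow_of_posDef {P T : Matrix (Fin n) (Fin n) ℂ} (hT : IsUnit T.det)
    (h : (T * P * T⁻¹).PosDef) : ∃ R l, IsUnit R.det ∧ P = diagFlow R l 1 := by
  have hU : IsUnit (h.1.eigenvectorUnitary : Matrix (Fin n) (Fin n) ℂ).det :=
    (Matrix.isUnit_iff_isUnit_det _).mp (Unitary.isUnit_coe (U := h.1.eigenvectorUnitary))
  set U : Matrix (Fin n) (Fin n) ℂ := h.1.eigenvectorUnitary.val with hUdef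
  have hUi : U⁻¹ = star U := Matrix.inv_eq_left_inv (Unitary.coe_star_mul_self h.1.eigenvectorUnitary)
  refine ⟨T⁻¹ * U, fun i => Real.log (h.1.eigenvalues i), ?_, ?_⟩
  · rw [Matrix.det_mul]
    exact (Matrix.isUnit_nonsing_inv_det _ hT).mul hU
  · have hs := h.1.spectral_theorem
    have hd : (fun i => Complex.exp (1 * (Real.log (h.1.eigenvalues i) : ℝ))) =
        (RCLike.ofReal ∘ h.1.eigenvalues : Fin n → ℂ) := by
      ext i
      rw [one_mul, ← Complex.ofReal_exp, Real.exp_log (h.eigenvalues_pos i)]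
      rfl
    rw [diagFlow, hd, Matrix.mul_inv_rev, Matrix.nonsing_inv_nonsing_inv _ hT]
    have hs' : T * P * T⁻¹ = U * Matrix.diagonal (RCLike.ofReal ∘ h.1.eigenvalues) * U⁻¹ := by
      rw [hUi]
      exact hs
    have : T⁻¹ * (T * P * T⁻¹) * T = P := by
      rw [mul_assoc T, ← mul_assoc T⁻¹, Matrix.nonsing_inv_mul _ hT, one_mul, mul_assoc P,
        Matrix.nonsing_inv_mul _ hT, mul_one]
    refine this.symm.trans ((congrArg (fun M => T⁻¹ * M * T) hs').trans ?_)
    simp only [mul_assoc]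

end ExpSums

section Polar

open scoped ComplexOrder

variable {n : ℕ} {K : Set (Matrix (Fin n) (Fin n) ℝ)}

theorem diagGen_mem_tangentOne (hK : IsMatSubgroup ℝ n K) (hc : IsCompact K)
    {R : Matrix (Fin n) (Fin n) ℂ} (hR : IsUnit R.det) {l : Fin n → ℝ}
    (h : diagFlow R l 1 ∈ complexifiedGroup n K) :
    diagGen R l ∈ tangentOne (complexifiedGroup n K) := by
  obtain ⟨h1, hmul, -⟩ := isMatSubgroup_complexifiedGroup hK hc
  rw [← mem_lieAlgebra_iff h1 hmul isZClosedSet_complexifiedGroup]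
  intro t
  rw [mexp_eq_exp, exp_smul_diagGen hR, mem_complexifiedGroup]
  intro p hp
  have hp' := vanishesOn_complexifiedGroup.mpr hp
  have hmem := eval_mem_expSums p (fun ij t => diagFlow R l t ij.1 ij.2)
    fun ij => diagFlow_mem_expSums R l ij.1 ij.2
  refine congrFun (eq_zero_of_mem_expSums hmem fun m => ?_) t
  refine hp' (diagFlow R l m) ?_
  rw [diagFlow_natCast hR]
  induction m with
  | zero => simpa using h1
  | succ m ih => rw [pow_succ]; exact hmul _ ih _ h

theorem exists_cMat_of_conj_eq {M : Matrix (Fin n) (Fin n) ℂ} (h : M.map (starRingEnd ℂ) = M) :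
    ∃ k, M = cMat k := by
  refine ⟨reMat M, ?_⟩
  ext i j
  have := congrFun (congrFun h i) j
  rw [Matrix.map_apply, Complex.conj_eq_iff_re] at this
  exact this.symm

/-- Polar decomposition of the isotropy group of a real point. -/
theorem exists_polar (hK : IsMatSubgroup ℝ n K) (hc : IsCompact K) {w : Fin n → ℝ}
    {g : Matrix (Fin n) (Fin n) ℂ} (hg : g ∈ complexifiedGroup n K)
    (hgw : g.mulVec (cv w) = cv w) :
    ∃ k ∈ K, k.mulVec w = w ∧ ∃ A ∈ tangentOne (complexifiedGroup n K), A.mulVec (cv w) = 0 ∧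
      g = cMat k * NormedSpace.exp A := by
  have hG := isMatSubgroup_complexifiedGroup hK hc
  obtain ⟨S, hS, hQ⟩ := exists_orthogonalizer hK hc
  have hT := isUnit_cMat_det hS
  set T := cMat S with hTdef
  let cj : Matrix (Fin n) (Fin n) ℂ →+* Matrix (Fin n) (Fin n) ℂ := (starRingEnd ℂ).mapMatrix
  have hcjT : cj T = T := by ext i j; simp [cj, hTdef, cMat_apply]
  have hcjinv : ∀ M, cj (cj M) = M := by intro M; ext i j; simp [cj]
  have hcjI : ∀ M : Matrix (Fin n) (Fin n) ℂ, IsUnit M.det → cj M⁻¹ = (cj M)⁻¹ := by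
    intro M hM
    refine (Matrix.inv_eq_left_inv ?_).symm
    rw [← map_mul, Matrix.nonsing_inv_mul _ hM, map_one]
  have hcg : cj g ∈ complexifiedGroup n K := conj_mem_complexifiedGroup hg
  have hgd := (Matrix.isUnit_iff_isUnit_det _).mp (hG.2.2 g hg).1
  have hcgd := (Matrix.isUnit_iff_isUnit_det _).mp (hG.2.2 _ hcg).1
  have hcgw : (cj g).mulVec (cv w) = cv w := by
    have := congrArg conjVec hgw
    rw [conjVec_cv] at this
    conv_rhs => rw [← this]
    ext i
    simp [cj, conjVec, Matrix.mulVec, dotProduct, cv_apply]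
  set P := (cj g)⁻¹ * g with hP
  have hPG : P ∈ complexifiedGroup n K := hG.2.1 _ (hG.2.2 _ hcg).2 _ hg
  have hPw : P.mulVec (cv w) = cv w := by
    rw [hP, ← Matrix.mulVec_mulVec, hgw]
    conv_lhs => rw [← hcgw]
    rw [Matrix.mulVec_mulVec, Matrix.nonsing_inv_mul _ hcgd, Matrix.one_mulVec]
  have hcP : cj P = P⁻¹ := by
    rw [hP, map_mul, hcjI _ hcgd, hcjinv, Matrix.mul_inv_rev, Matrix.nonsing_inv_nonsing_inv _ hcgd]
  have hTT : T.transpose * T = cMat (S.transpose * S) := by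
    rw [map_mul, cMat_transpose]
  have hTH : T.conjTranspose = T.transpose := by
    ext i j; simp [hTdef, cMat_apply]
  have hcq : (cj g).transpose * (T.transpose * T) * cj g = T.transpose * T := by
    rw [hTT]; exact transpose_mul_mul_of_mem hQ hcg
  have hgH : g.conjTranspose = (cj g).transpose := by
    ext i j; simp [cj]
  have hpd : (T * P * T⁻¹).PosDef := by
    have hinj : Function.Injective (T * g * T⁻¹).mulVec := by
      apply Matrix.mulVec_injective_of_isUnit
      rw [Matrix.isUnit_iff_isUnit_det, Matrix.det_mul, Matrix.det_mul]
      exact (hT.mul hgd).mul (Matrix.isUnit_nonsing_inv_det _ hT)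
    have := Matrix.PosDef.conjTranspose_mul_self _ hinj
    convert this using 1
    rw [Matrix.conjTranspose_mul, Matrix.conjTranspose_mul, hTH, hgH,
      Matrix.conjTranspose_nonsing_inv, hTH]
    have hTt : IsUnit T.transpose.det := by rwa [Matrix.det_transpose]
    have h3 : (T.transpose)⁻¹ * ((cj g).transpose * T.transpose) * (T * cj g * P * T⁻¹) =
        T * P * T⁻¹ := by
      calc _ = (T.transpose)⁻¹ * ((cj g).transpose * (T.transpose * T) * cj g) * P * T⁻¹ := by
            simp only [mul_assoc]
        _ = ((T.transpose)⁻¹ * T.transpose) * T * P * T⁻¹ := by rw [hcq]; simp only [mul_assoc]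
        _ = _ := by rw [Matrix.nonsing_inv_mul _ hTt, one_mul]
    have h4 : T * cj g * P * T⁻¹ = T * g * T⁻¹ := by
      rw [hP, mul_assoc T, ← mul_assoc (cj g), Matrix.mul_nonsing_inv _ hcgd, one_mul]
    rw [← h3, h4]
  obtain ⟨R, l, hR, hPR⟩ := exists_diagFlow_of_posDef hT hpd
  have hgen := diagGen_mem_tangentOne hK hc hR (hPR ▸ hPG)
  have hgenw := diagGen_mulVec_eq_zero hR (hPR ▸ hPw)
  have hcR : IsUnit (cj R).det := by
    have : (cj R).det = (starRingEnd ℂ) R.det := ((starRingEnd ℂ).map_det R).symm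
    rw [this]; exact hR.map _
  have hPd : IsUnit P.det := (Matrix.isUnit_iff_isUnit_det _).mp (hG.2.2 _ hPG).1
  have hcflow : ∀ t : ℝ, cj (diagFlow R l t) = diagFlow (cj R) l t := by
    intro t
    rw [diagFlow, map_mul, map_mul, hcjI _ hR, diagFlow]
    congr 2
    ext i j
    by_cases hij : i = j
    · subst hij
      simp [cj, ← Complex.exp_conj]
    · simp [cj, hij]
  have hneg : ∀ (R : Matrix (Fin n) (Fin n) ℂ) (l : Fin n → ℝ) (t : ℂ),
      diagFlow R l (-t) = diagFlow R (fun i => - l i) t := by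
    intro R l t
    simp [diagFlow]
  have hflow : ∀ t, diagFlow (cj R) l t = diagFlow R l (-t) := by
    intro t
    ext i j
    have hm : (fun t => diagFlow (cj R) l t i j - diagFlow R l (-t) i j) ∈ expSums := by
      refine expSums.sub_mem (diagFlow_mem_expSums (cj R) l i j) ?_
      simp only [hneg]
      exact diagFlow_mem_expSums R _ i j
    have := congrFun (eq_zero_of_mem_expSums hm fun m => ?_) t
    · exact sub_eq_zero.mp this
    · have e1 : diagFlow (cj R) l 1 = P⁻¹ := by
        have := hcflow 1
        rw [Complex.ofReal_one] at this
        rw [← this, ← hPR, hcP]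
      have e2 : diagFlow R (fun i => - l i) 1 = P⁻¹ := by
        rw [← hneg]
        refine (Matrix.inv_eq_left_inv ?_).symm
        rw [hPR, ← diagFlow_add hR, neg_add_cancel, diagFlow_zero hR]
      simp only [hneg]
      rw [diagFlow_natCast hcR, diagFlow_natCast hR, e1, e2, sub_self]
  set E := diagFlow R l (1 / 2) with hE
  set E' := diagFlow R l (-(1 / 2)) with hE'
  have hEE' : E' * E = 1 := by rw [← diagFlow_add hR, neg_add_cancel, diagFlow_zero hR]
  have hPE : P * E' = E := by
    rw [hPR, hE', ← diagFlow_add hR, hE]; norm_num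
  have hcE' : cj E' = E := by
    have h1 := hcflow (-(1 / 2))
    push_cast at h1
    rw [hE', h1, hflow, neg_neg]
  have hgP : g = cj g * P := by rw [hP, ← mul_assoc, Matrix.mul_nonsing_inv _ hcgd, one_mul]
  have hreal : cj (g * E') = g * E' := by
    conv_rhs => rw [hgP, mul_assoc, hPE]
    rw [map_mul, hcE']
  obtain ⟨k, hk⟩ := exists_cMat_of_conj_eq hreal
  have hE'exp : E' = NormedSpace.exp ((-(1 / 2) : ℂ) • diagGen R l) := (exp_smul_diagGen hR _ _).symm
  have hkK : k ∈ K := by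
    apply mem_of_cMat_mem (isZClosedSet_of_isCompact hK hc)
    rw [← hk]
    refine hG.2.1 _ hg _ ?_
    rw [hE'exp]
    exact exp_smul_mem hG.1 hG.2.1 isZClosedSet_complexifiedGroup hgen _
  refine ⟨k, hkK, ?_, (1 / 2 : ℂ) • diagGen R l, Submodule.smul_mem _ _ hgen, ?_, ?_⟩
  · apply cv_injective
    rw [← cMat_mulVec, ← hk, ← Matrix.mulVec_mulVec, hE'exp, exp_smul_mulVec_eq hgenw, hgw]
  · rw [Matrix.smul_mulVec, hgenw, smul_zero]
  · rw [exp_smul_diagGen hR, ← hk, mul_assoc, hEE', mul_one]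

end Polar
end ZPaper

namespace ZPaper

section ComplexSubspace

variable {n : ℕ} {K : Set (Matrix (Fin n) (Fin n) ℝ)}

/-- The real part of a complex vector. -/
def reVec (v : Fin n → ℂ) : Fin n → ℝ := fun i => (v i).re

/-- The imaginary part of a complex vector. -/
def imVec (v : Fin n → ℂ) : Fin n → ℝ := fun i => (v i).im

theorem cv_re_add_im (v : Fin n → ℂ) : cv (reVec v) + Complex.I • cv (imVec v) = v := by
  ext i
  simp [cv_apply, reVec, imVec, Complex.ext_iff]

theorem reVec_add_I (a b : Fin n → ℝ) : reVec (cv a + Complex.I • cv b) = a := by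
  ext i; simp [reVec, cv_apply]

theorem imVec_add_I (a b : Fin n → ℝ) : imVec (cv a + Complex.I • cv b) = b := by
  ext i; simp [imVec, cv_apply]

/-- The complexification of a real subspace. -/
def cpl (T : Submodule ℝ (Fin n → ℝ)) : Submodule ℂ (Fin n → ℂ) where
  carrier := {v | reVec v ∈ T ∧ imVec v ∈ T}
  zero_mem' := by
    have h : reVec (0 : Fin n → ℂ) = 0 := by ext i; simp [reVec]
    have h' : imVec (0 : Fin n → ℂ) = 0 := by ext i; simp [imVec]
    exact ⟨h ▸ T.zero_mem, h' ▸ T.zero_mem⟩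
  add_mem' := by
    intro a b ha hb
    have h : reVec (a + b) = reVec a + reVec b := by ext i; simp [reVec]
    have h' : imVec (a + b) = imVec a + imVec b := by ext i; simp [imVec]
    exact ⟨h ▸ T.add_mem ha.1 hb.1, h' ▸ T.add_mem ha.2 hb.2⟩
  smul_mem' := by
    intro c v hv
    have h : reVec (c • v) = c.re • reVec v - c.im • imVec v := by
      ext i; simp [reVec, imVec]
    have h' : imVec (c • v) = c.re • imVec v + c.im • reVec v := by
      ext i; simp [reVec, imVec]
    exact ⟨h ▸ T.sub_mem (T.smul_mem _ hv.1) (T.smul_mem _ hv.2),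
      h' ▸ T.add_mem (T.smul_mem _ hv.2) (T.smul_mem _ hv.1)⟩

theorem mem_cpl {T : Submodule ℝ (Fin n → ℝ)} {v : Fin n → ℂ} :
    v ∈ cpl T ↔ reVec v ∈ T ∧ imVec v ∈ T := Iff.rfl

theorem add_I_mem_cpl {T : Submodule ℝ (Fin n → ℝ)} {a b : Fin n → ℝ} :
    cv a + Complex.I • cv b ∈ cpl T ↔ a ∈ T ∧ b ∈ T := by
  rw [mem_cpl, reVec_add_I, imVec_add_I]

theorem isCompl_cpl {T N : Submodule ℝ (Fin n → ℝ)} (h : IsCompl T N) :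
    IsCompl (cpl T) (cpl N) := by
  constructor
  · rw [Submodule.disjoint_def]
    intro v hT hN
    have h1 := Submodule.disjoint_def.mp h.disjoint _ hT.1 hN.1
    have h2 := Submodule.disjoint_def.mp h.disjoint _ hT.2 hN.2
    rw [← cv_re_add_im v, h1, h2]
    ext i
    simp [cv_apply]
  · rw [codisjoint_iff, eq_top_iff]
    intro v _
    have hs : ∀ u, ∃ a ∈ T, ∃ b ∈ N, a + b = u := fun u =>
      Submodule.mem_sup.mp (h.sup_eq_top ▸ Submodule.mem_top)
    obtain ⟨a, ha, b, hb, hab⟩ := hs (reVec v)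
    obtain ⟨a', ha', b', hb', hab'⟩ := hs (imVec v)
    refine Submodule.mem_sup.mpr ⟨cv a + Complex.I • cv a', add_I_mem_cpl.mpr ⟨ha, ha'⟩,
      cv b + Complex.I • cv b', add_I_mem_cpl.mpr ⟨hb, hb'⟩, ?_⟩
    rw [← cv_re_add_im v, ← hab, ← hab']
    ext i
    simp [cv_apply]
    ring

theorem add_I_mulVec_cv (A B : Matrix (Fin n) (Fin n) ℝ) (w : Fin n → ℝ) :
    (cMat A + Complex.I • cMat B).mulVec (cv w) =
      cv (A.mulVec w) + Complex.I • cv (B.mulVec w) := by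
  rw [Matrix.add_mulVec, Matrix.smul_mulVec, cMat_mulVec, cMat_mulVec]

theorem cMat_mulVec_add_I (k : Matrix (Fin n) (Fin n) ℝ) (a b : Fin n → ℝ) :
    (cMat k).mulVec (cv a + Complex.I • cv b) =
      cv (k.mulVec a) + Complex.I • cv (k.mulVec b) := by
  rw [Matrix.mulVec_add, Matrix.mulVec_smul, cMat_mulVec, cMat_mulVec]

theorem map_evalAt_cv (w : Fin n → ℝ) :
    (tangentOne (complexifiedGroup n K)).map (evalAt (cv w)) =
      cpl ((tangentOne K).map (evalAt w)) := by
  ext v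
  constructor
  · rintro ⟨A, hA, rfl⟩
    rw [SetLike.mem_coe, ← cMat_re_add_im A, mem_tangentOne_complexifiedGroup] at hA
    rw [evalAt_apply, ← cMat_re_add_im A, add_I_mulVec_cv, add_I_mem_cpl]
    exact ⟨⟨_, hA.1, rfl⟩, ⟨_, hA.2, rfl⟩⟩
  · intro hv
    rw [← cv_re_add_im v]
    obtain ⟨⟨A, hA, hAv⟩, ⟨B, hB, hBv⟩⟩ := hv
    refine ⟨cMat A + Complex.I • cMat B, mem_tangentOne_complexifiedGroup.mpr ⟨hA, hB⟩, ?_⟩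
    rw [evalAt_apply, add_I_mulVec_cv, ← hAv, ← hBv]
    rfl

theorem mulVec_eq_zero_of_mem_cpl {w : Fin n → ℝ} {N : Submodule ℝ (Fin n → ℝ)}
    (hk : ∀ A ∈ tangentOne K, A.mulVec w = 0 → ∀ x ∈ N, A.mulVec x = 0)
    {A : Matrix (Fin n) (Fin n) ℂ} (hA : A ∈ tangentOne (complexifiedGroup n K))
    (hAw : A.mulVec (cv w) = 0) {x : Fin n → ℂ} (hx : x ∈ cpl N) : A.mulVec x = 0 := by
  rw [← cMat_re_add_im A, mem_tangentOne_complexifiedGroup] at hA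
  have hcv0 : cv (0 : Fin n → ℝ) = 0 := by ext i; simp [cv_apply]
  have h0 : (reMat A).mulVec w = 0 ∧ (imMat A).mulVec w = 0 := by
    rw [← cMat_re_add_im A, add_I_mulVec_cv] at hAw
    have h1 := congrArg reVec hAw
    have h2 := congrArg imVec hAw
    rw [reVec_add_I] at h1
    rw [imVec_add_I] at h2
    exact ⟨by rw [h1]; ext i; simp [reVec], by rw [h2]; ext i; simp [imVec]⟩
  rw [← cv_re_add_im x, ← cMat_re_add_im A, Matrix.mulVec_add, Matrix.mulVec_smul,
    add_I_mulVec_cv, add_I_mulVec_cv, hk _ hA.1 h0.1 _ hx.1, hk _ hA.2 h0.2 _ hx.1,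
    hk _ hA.1 h0.1 _ hx.2, hk _ hA.2 h0.2 _ hx.2, hcv0]
  simp

/-- The isotropy group of a real point acts on the complexified slice through `K`. -/
theorem exists_mulVec_eq_on_cpl (hK : IsMatSubgroup ℝ n K) (hc : IsCompact K) {w : Fin n → ℝ}
    {N : Submodule ℝ (Fin n → ℝ)}
    (hk : ∀ A ∈ tangentOne K, A.mulVec w = 0 → ∀ x ∈ N, A.mulVec x = 0)
    {g : Matrix (Fin n) (Fin n) ℂ} (hg : g ∈ isotropy ℂ n (complexifiedGroup n K) (cv w)) :
    ∃ k ∈ isotropy ℝ n K w, ∀ x ∈ cpl N, g.mulVec x = (cMat k).mulVec x := by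
  obtain ⟨k, hkK, hkw, A, hA, hAw, rfl⟩ := exists_polar hK hc hg.1 hg.2
  refine ⟨k, ⟨hkK, hkw⟩, fun x hx => ?_⟩
  have := exp_smul_mulVec_eq (mulVec_eq_zero_of_mem_cpl hk hA hAw hx) 1
  rw [one_smul] at this
  rw [← Matrix.mulVec_mulVec, this]

theorem orbitTangent_complexifiedGroup (hK : IsMatSubgroup ℝ n K) (hc : IsCompact K)
    (w : Fin n → ℝ) :
    orbitTangent ℂ n (complexifiedGroup n K) (cv w) = cpl (orbitTangent ℝ n K w) := by
  obtain ⟨h1, hmul, -⟩ := isMatSubgroup_complexifiedGroup hK hc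
  rw [orbitTangent_eq h1 hmul isZClosedSet_complexifiedGroup, map_evalAt_cv,
    orbitTangent_eq hK.1 hK.2.1 (isZClosedSet_of_isCompact hK hc)]

theorem mulVec_eq_zero_of_hasFiniteImageOn (hK : IsMatSubgroup ℝ n K) (hc : IsCompact K)
    {w : Fin n → ℝ} {N : Submodule ℝ (Fin n → ℝ)}
    (hN : HasFiniteImageOn ℝ n (isotropy ℝ n K w) N) :
    ∀ A ∈ tangentOne K, A.mulVec w = 0 → ∀ x ∈ N, A.mulVec x = 0 := fun _ hA hAw _ hx =>
  mulVec_eq_zero_of_finiteImage hK.1 hK.2.1 (isZClosedSet_of_isCompact hK hc) hN hA hAw hx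

theorem isSliceComplement_cpl (hK : IsMatSubgroup ℝ n K) (hc : IsCompact K) {w : Fin n → ℝ}
    {N : Submodule ℝ (Fin n → ℝ)} (hN : IsSliceComplement ℝ n K w N)
    (hf : HasFiniteImageOn ℝ n (isotropy ℝ n K w) N) :
    IsSliceComplement ℂ n (complexifiedGroup n K) (cv w) (cpl N) := by
  refine ⟨?_, fun g hg x hx => ?_⟩
  · rw [orbitTangent_complexifiedGroup hK hc]
    exact isCompl_cpl hN.1
  · obtain ⟨k, hk, hgk⟩ :=
      exists_mulVec_eq_on_cpl hK hc (mulVec_eq_zero_of_hasFiniteImageOn hK hc hf) hg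
    rw [hgk x hx, ← cv_re_add_im x, cMat_mulVec_add_I, add_I_mem_cpl]
    exact ⟨hN.2 k hk _ hx.1, hN.2 k hk _ hx.2⟩

theorem actsTriviallyOn_cpl (hK : IsMatSubgroup ℝ n K) (hc : IsCompact K) {w : Fin n → ℝ}
    {N : Submodule ℝ (Fin n → ℝ)} (ht : ActsTriviallyOn ℝ n (isotropy ℝ n K w) N) :
    ActsTriviallyOn ℂ n (isotropy ℂ n (complexifiedGroup n K) (cv w)) (cpl N) := by
  intro g hg x hx
  obtain ⟨k, hk, hgk⟩ := exists_mulVec_eq_on_cpl hK hc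
    (mulVec_eq_zero_of_hasFiniteImageOn hK hc (hasFiniteImageOn_of_actsTriviallyOn ht)) hg
  rw [hgk x hx, ← cv_re_add_im x, cMat_mulVec_add_I, ht k hk _ hx.1, ht k hk _ hx.2]

theorem hasFiniteImageOn_cpl (hK : IsMatSubgroup ℝ n K) (hc : IsCompact K) {w : Fin n → ℝ}
    {N : Submodule ℝ (Fin n → ℝ)} (hf : HasFiniteImageOn ℝ n (isotropy ℝ n K w) N) :
    HasFiniteImageOn ℂ n (isotropy ℂ n (complexifiedGroup n K) (cv w)) (cpl N) := by
  let Φ : (N → Fin n → ℝ) → (cpl N → Fin n → ℂ) := fun f x =>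
    cv (f ⟨reVec x, x.2.1⟩) + Complex.I • cv (f ⟨imVec x, x.2.2⟩)
  refine (hf.image Φ).subset ?_
  rintro _ ⟨g, hg, rfl⟩
  obtain ⟨k, hk, hgk⟩ :=
    exists_mulVec_eq_on_cpl hK hc (mulVec_eq_zero_of_hasFiniteImageOn hK hc hf) hg
  refine ⟨_, ⟨k, hk, rfl⟩, ?_⟩
  funext x
  change cv (k.mulVec (reVec x)) + Complex.I • cv (k.mulVec (imVec x)) = g.mulVec x
  rw [hgk x x.2, ← cMat_mulVec_add_I, cv_re_add_im]

end ComplexSubspace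
end ZPaper

namespace ZPaper

section GenericReal

variable {n : ℕ} {K : Set (Matrix (Fin n) (Fin n) ℝ)}

theorem exists_sliceComplement_real (hK : IsMatSubgroup ℝ n K) (hc : IsCompact K)
    (w : Fin n → ℝ) : ∃ N, IsSliceComplement ℝ n K w N ∧
      ∀ A ∈ tangentOne K, A.mulVec w = 0 → ∀ x ∈ N, A.mulVec x ∈ N := by
  obtain ⟨S, hS, hQ⟩ := exists_orthogonalizer hK hc
  have hZ := isZClosedSet_of_isCompact hK hc
  let B : LinearMap.BilinForm ℝ (Fin n → ℝ) :=
    LinearMap.mk₂ ℝ (fun x y => S.mulVec x ⬝ᵥ S.mulVec y)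
      (fun x y z => by simp only [Matrix.mulVec_add, add_dotProduct])
      (fun c x y => by simp only [Matrix.mulVec_smul, smul_dotProduct])
      (fun x y z => by simp only [Matrix.mulVec_add, dotProduct_add])
      (fun c x y => by simp only [Matrix.mulVec_smul, dotProduct_smul])
  have hB : ∀ x y, B x y = S.mulVec x ⬝ᵥ S.mulVec y := fun _ _ => rfl
  have hinv : ∀ k ∈ K, ∀ x y, B (k.mulVec x) (k.mulVec y) = B x y := by
    intro k hk x y
    have h1 : ∀ (M : Matrix (Fin n) (Fin n) ℝ), M.mulVec x ⬝ᵥ M.mulVec y =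
        x ⬝ᵥ (M.transpose * M).mulVec y := by
      intro M
      rw [← Matrix.mulVec_mulVec, Matrix.dotProduct_mulVec x, Matrix.vecMul_transpose]
    rw [hB, hB, Matrix.mulVec_mulVec, Matrix.mulVec_mulVec, h1, h1, Matrix.transpose_mul]
    rw [← hQ k hk]
    simp only [mul_assoc]
  have hrefl : B.IsRefl := by
    intro x y h
    rw [hB] at h ⊢
    rw [dotProduct_comm, h]
  set T := orbitTangent ℝ n K w with hT
  have hTeq : T = (tangentOne K).map (evalAt w) := orbitTangent_eq hK.1 hK.2.1 hZ w
  have hstab : ∀ k ∈ isotropy ℝ n K w, ∀ x ∈ B.orthogonal T, k.mulVec x ∈ B.orthogonal T := by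
    intro k hk x hx u hu
    have hkd := (Matrix.isUnit_iff_isUnit_det _).mp (hK.2.2 k hk.1).1
    have hki := (hK.2.2 k hk.1).2
    rw [hTeq] at hu
    obtain ⟨A, hA, rfl⟩ := hu
    have h1 : k.mulVec ((k⁻¹ * A * k).mulVec w) = A.mulVec w := by
      rw [Matrix.mulVec_mulVec, ← mul_assoc, ← mul_assoc, Matrix.mul_nonsing_inv _ hkd, one_mul,
        ← Matrix.mulVec_mulVec, hk.2]
    have h2 : k⁻¹ * A * k ∈ tangentOne K := by
      have := conj_mem_tangentOne hK hZ hA hki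
      rwa [Matrix.nonsing_inv_nonsing_inv _ hkd] at this
    rw [evalAt_apply, ← h1, hinv k hk.1]
    refine hx _ ?_
    rw [hTeq]
    exact ⟨_, h2, rfl⟩
  refine ⟨B.orthogonal T, ⟨?_, hstab⟩, ?_⟩
  · rw [LinearMap.BilinForm.isCompl_orthogonal_iff_disjoint hrefl, Submodule.disjoint_def]
    intro x hx hx'
    have h1 : S.mulVec x = 0 := by
      have := hx' x hx
      rw [hB] at this
      exact dotProduct_self_eq_zero.mp this
    have h2 : (S⁻¹ * S).mulVec x = 0 := by
      rw [← Matrix.mulVec_mulVec, h1, Matrix.mulVec_zero]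
    rwa [Matrix.nonsing_inv_mul _ hS, Matrix.one_mulVec] at h2
  · intro A hA hAw x hx u hu
    have hd := (LinearMap.toContinuousLinearMap (B u)).hasFDerivAt.comp_hasDerivAt (0 : ℝ)
      (hasDerivAt_exp_mulVec A x 0)
    have h0 : (LinearMap.toContinuousLinearMap (B u)) ∘
        (fun s : ℝ => (NormedSpace.exp (s • A)).mulVec x) = fun _ => 0 := by
      funext t
      exact hstab _ ⟨exp_smul_mem hK.1 hK.2.1 hZ hA t, exp_smul_mulVec_eq hAw t⟩ x hx u hu
    rw [h0] at hd
    have := hd.unique (hasDerivAt_const (0 : ℝ) (0 : ℝ))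
    simpa using this

theorem finrank_map_le_of_isSliceComplement (hK : IsMatSubgroup ℝ n K) (hc : IsCompact K)
    {y : Fin n → ℂ} {N : Submodule ℂ (Fin n → ℂ)}
    (hN : IsSliceComplement ℂ n (complexifiedGroup n K) y N)
    (hf : HasFiniteImageOn ℂ n (isotropy ℂ n (complexifiedGroup n K) y) N) (v : Fin n → ℂ) :
    Module.finrank ℂ ((tangentOne (complexifiedGroup n K)).map (evalAt v)) ≤
      Module.finrank ℂ ((tangentOne (complexifiedGroup n K)).map (evalAt y)) := by
  have hG := isMatSubgroup_complexifiedGroup hK hc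
  have hZ : IsZClosedSet (complexifiedGroup n K) := isZClosedSet_complexifiedGroup
  refine finrank_map_le_of_slice hG hZ (N := N) ?_ ?_ v
  · rw [← orbitTangent_eq hG.1 hG.2.1 hZ]
    exact hN.1.sup_eq_top
  · intro A hA hAy x hx
    exact mulVec_eq_zero_of_finiteImage hG.1 hG.2.1 hZ hf hA hAy hx

/-- Real points where the complex orbit has maximal dimension are almost principal. -/
theorem mulVec_eq_zero_of_maximal_real (hK : IsMatSubgroup ℝ n K) (hc : IsCompact K)
    {w : Fin n → ℝ} {N : Submodule ℝ (Fin n → ℝ)}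
    (hN : IsSliceComplement ℝ n K w N)
    (hNl : ∀ A ∈ tangentOne K, A.mulVec w = 0 → ∀ x ∈ N, A.mulVec x ∈ N)
    (hmax : ∀ u, Module.finrank ℂ ((tangentOne (complexifiedGroup n K)).map (evalAt u)) ≤
      Module.finrank ℂ ((tangentOne (complexifiedGroup n K)).map (evalAt (cv w)))) :
    ∀ A ∈ tangentOne K, A.mulVec w = 0 → ∀ x ∈ N, A.mulVec x = 0 := by
  intro A hA hAw x hx
  have hcv0 : cv (0 : Fin n → ℝ) = 0 := by ext i; simp [cv_apply]
  have hG := isMatSubgroup_complexifiedGroup hK hc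
  have hcA : cMat A ∈ tangentOne (complexifiedGroup n K) := by
    have := mem_tangentOne_complexifiedGroup.mpr ⟨hA, (tangentOne K).zero_mem⟩
    simpa using this
  have hdisj : Disjoint ((tangentOne (complexifiedGroup n K)).map (evalAt (cv w))) (cpl N) := by
    rw [← orbitTangent_eq hG.1 hG.2.1 isZClosedSet_complexifiedGroup,
      orbitTangent_complexifiedGroup hK hc]
    exact (isCompl_cpl hN.1).disjoint
  have := mulVec_eq_zero_of_maximal_finrank hmax hdisj hcA (x := cv x)
    (by rw [cMat_mulVec, hAw, hcv0]) (by
      rw [cMat_mulVec]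
      have h := hNl A hA hAw x hx
      have := add_I_mem_cpl.mpr ⟨h, N.zero_mem⟩
      simpa [hcv0] using this)
  rw [cMat_mulVec] at this
  exact cv_injective (this.trans hcv0.symm)

theorem isAlmostPrincipalPt_of_maximal (hK : IsMatSubgroup ℝ n K) (hc : IsCompact K)
    {w : Fin n → ℝ}
    (hmax : ∀ u, Module.finrank ℂ ((tangentOne (complexifiedGroup n K)).map (evalAt u)) ≤
      Module.finrank ℂ ((tangentOne (complexifiedGroup n K)).map (evalAt (cv w)))) :
    IsAlmostPrincipalPt ℝ n K w := by
  obtain ⟨N, hN, hNl⟩ := exists_sliceComplement_real hK hc w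
  exact ⟨hasClosedOrbit_real hK hc w, N, hN, hasFiniteImageOn_of_lie hK hc
    (isZClosedSet_of_isCompact hK hc) (mulVec_eq_zero_of_maximal_real hK hc hN hNl hmax)⟩

theorem exists_poly_isAlmostPrincipalPt (hK : IsMatSubgroup ℝ n K) (hc : IsCompact K)
    {y : Fin n → ℂ} (hy : IsAlmostPrincipalPt ℂ n (complexifiedGroup n K) y) :
    ∃ f : MvPolynomial (Fin n) ℂ, eval y f ≠ 0 ∧
      ∀ w : Fin n → ℝ, eval (cv w) f ≠ 0 → IsAlmostPrincipalPt ℝ n K w := by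
  obtain ⟨-, N, hN, hf⟩ := hy
  obtain ⟨f, hfy, hfv⟩ := exists_poly_finrank_map_le (tangentOne (complexifiedGroup n K)) y
  exact ⟨f, hfy, fun w hw => isAlmostPrincipalPt_of_maximal hK hc fun u =>
    (finrank_map_le_of_isSliceComplement hK hc hN hf u).trans (hfv _ hw)⟩

end GenericReal
end ZPaper

namespace ZPaper

section Constructible

variable {σ τ : Type} [Finite σ] [Finite τ]

/-- A nonempty finite union of sets `V(S) ∖ V(f)` contains a nonempty relatively open subset of
its Zariski closure. -/
theorem exists_open_subset_of_constructible
    (s : Finset (Set (MvPolynomial σ ℂ) × MvPolynomial σ ℂ)) :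
    (∃ z : σ → ℂ, ∃ c ∈ s, (∀ p ∈ c.1, eval z p = 0) ∧ eval z c.2 ≠ 0) →
    ∃ f : MvPolynomial σ ℂ,
      (∃ z : σ → ℂ, (∃ c ∈ s, (∀ p ∈ c.1, eval z p = 0) ∧ eval z c.2 ≠ 0) ∧ eval z f ≠ 0) ∧
      ∀ z : σ → ℂ, (∀ q, (∀ u : σ → ℂ, (∃ c ∈ s, (∀ p ∈ c.1, eval u p = 0) ∧ eval u c.2 ≠ 0) →
        eval u q = 0) → eval z q = 0) → eval z f ≠ 0 →
        ∃ c ∈ s, (∀ p ∈ c.1, eval z p = 0) ∧ eval z c.2 ≠ 0 := by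
  classical
  induction s using Finset.induction_on with
  | empty => rintro ⟨z, c, hc, -⟩; simp at hc
  | insert a s ha ih =>
    rintro ⟨z₀, c₀, hc₀, h₀, h₀'⟩
    by_cases hex : ∃ b : MvPolynomial σ ℂ, (∀ u : σ → ℂ,
        (∃ c ∈ s, (∀ p ∈ c.1, eval u p = 0) ∧ eval u c.2 ≠ 0) → eval u b = 0) ∧
        ∃ u : σ → ℂ, ((∀ p ∈ a.1, eval u p = 0) ∧ eval u a.2 ≠ 0) ∧ eval u b ≠ 0
    · obtain ⟨b, hb, u, hu, hub⟩ := hex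
      refine ⟨b * a.2, ⟨u, ⟨a, Finset.mem_insert_self _ _, hu⟩, ?_⟩, fun z hz hzf => ?_⟩
      · rw [map_mul]; exact mul_ne_zero hub hu.2
      · rw [map_mul] at hzf
        refine ⟨a, Finset.mem_insert_self _ _, fun p hp => ?_, right_ne_zero_of_mul hzf⟩
        have := hz (b * p) ?_
        · rw [map_mul] at this
          exact (mul_eq_zero.mp this).resolve_left (left_ne_zero_of_mul hzf)
        · rintro v ⟨c, hc, hv⟩
          rw [map_mul]
          rcases Finset.mem_insert.mp hc with rfl | hc
          · rw [hv.1 p hp, mul_zero]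
          · rw [hb v ⟨c, hc, hv⟩, zero_mul]
    · push Not at hex
      have hz : ∃ z : σ → ℂ, ∃ c ∈ s, (∀ p ∈ c.1, eval z p = 0) ∧ eval z c.2 ≠ 0 := by
        by_contra hne
        push Not at hne
        have := hex 1 (fun u ⟨c, hc, h1, h2⟩ => absurd (hne u c hc h1) h2) z₀
        rcases Finset.mem_insert.mp hc₀ with rfl | hc
        · simpa using this ⟨h₀, h₀'⟩
        · exact h₀' (hne z₀ c₀ hc h₀)
      obtain ⟨f, ⟨z, ⟨c, hc, hzc⟩, hzf⟩, hf⟩ := ih hz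
      refine ⟨f, ⟨z, ⟨c, Finset.mem_insert_of_mem hc, hzc⟩, hzf⟩, fun z hz hzf => ?_⟩
      have hz' : ∀ q, (∀ u : σ → ℂ,
          (∃ c ∈ s, (∀ p ∈ c.1, eval u p = 0) ∧ eval u c.2 ≠ 0) → eval u q = 0) →
          eval z q = 0 := by
        intro q hq
        refine hz q ?_
        rintro u ⟨c, hc, hu⟩
        rcases Finset.mem_insert.mp hc with rfl | hc
        · exact hex q hq u hu
        · exact hq u ⟨c, hc, hu⟩
      obtain ⟨c, hc, h⟩ := hf z hz' hzf
      exact ⟨c, Finset.mem_insert_of_mem hc, h⟩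

theorem mem_image_comap_iff (P : σ → MvPolynomial τ ℂ) (S : Set (MvPolynomial τ ℂ)) (z : σ → ℂ) :
    pointToPoint (k := ℂ) z ∈ PrimeSpectrum.comap (bind₁ P).toRingHom '' PrimeSpectrum.zeroLocus S ↔
      ∃ x : τ → ℂ, (∀ p ∈ S, eval x p = 0) ∧ z = fun i => eval x (P i) := by
  have hev : ∀ (x : τ → ℂ) (p : MvPolynomial σ ℂ),
      eval x (bind₁ P p) = eval (fun i => eval x (P i)) p := by
    intro x p
    have : (eval x).comp (bind₁ P).toRingHom = eval fun i => eval x (P i) :=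
      MvPolynomial.ringHom_ext (by simp) (by simp)
    exact congrArg (fun φ => φ p) this
  constructor
  · rintro ⟨𝔭, h𝔭, h⟩
    obtain ⟨𝔪, h𝔪, hle⟩ := Ideal.exists_le_maximal 𝔭.asIdeal 𝔭.isPrime.ne_top
    obtain ⟨x, rfl⟩ := isMaximal_iff_eq_vanishingIdeal_singleton.mp h𝔪
    refine ⟨x, fun p hp => ?_, ?_⟩
    · have := hle (h𝔭 hp)
      rw [mem_vanishingIdeal_singleton_iff] at this
      simpa using this
    · funext i
      have h1 : (X i - C (z i) : MvPolynomial σ ℂ) ∈ (pointToPoint (k := ℂ) z).asIdeal := by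
        change _ ∈ MvPolynomial.vanishingIdeal ℂ {z}
        rw [mem_vanishingIdeal_singleton_iff]
        simp
      rw [← h] at h1
      have h2 := hle (show bind₁ P (X i - C (z i)) ∈ 𝔭.asIdeal from h1)
      rw [mem_vanishingIdeal_singleton_iff] at h2
      simp only [MvPolynomial.aeval_eq_eval] at h2
      have h3 : eval x (bind₁ P (X i - C (z i))) = 0 := h2
      rw [hev] at h3
      simp only [map_sub, eval_X, eval_C] at h3
      exact (sub_eq_zero.mp h3).symm
  · rintro ⟨x, hx, rfl⟩
    refine ⟨pointToPoint (k := ℂ) x, fun p hp => ?_, ?_⟩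
    · change p ∈ MvPolynomial.vanishingIdeal ℂ {x}
      rw [mem_vanishingIdeal_singleton_iff]
      simpa using hx p hp
    · ext p
      change bind₁ P p ∈ MvPolynomial.vanishingIdeal ℂ {x} ↔ p ∈ MvPolynomial.vanishingIdeal ℂ {_}
      rw [mem_vanishingIdeal_singleton_iff, mem_vanishingIdeal_singleton_iff]
      simp only [MvPolynomial.aeval_eq_eval]
      rw [← hev x p]

theorem exists_open_subset_of_image (P : σ → MvPolynomial τ ℂ) (S : Set (MvPolynomial τ ℂ))
    {x₀ : τ → ℂ} (hx₀ : ∀ p ∈ S, eval x₀ p = 0) :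
    ∃ f : MvPolynomial σ ℂ,
      (∃ x : τ → ℂ, (∀ p ∈ S, eval x p = 0) ∧ eval (fun i => eval x (P i)) f ≠ 0) ∧
      ∀ z : σ → ℂ, (∀ q : MvPolynomial σ ℂ, (∀ x : τ → ℂ, (∀ p ∈ S, eval x p = 0) →
        eval (fun i => eval x (P i)) q = 0) → eval z q = 0) → eval z f ≠ 0 →
        ∃ x : τ → ℂ, (∀ p ∈ S, eval x p = 0) ∧ z = fun i => eval x (P i) := by
  classical
  have hcons : Topology.IsConstructible (PrimeSpectrum.zeroLocus S) := by
    rw [← PrimeSpectrum.zeroLocus_span, ← Topology.isConstructible_compl]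
    exact (PrimeSpectrum.isRetrocompact_zeroLocus_compl_of_fg
      (IsNoetherian.noetherian _)).isConstructible (PrimeSpectrum.isClosed_zeroLocus _).isOpen_compl
  have hft : (bind₁ P).toRingHom.FinitePresentation := by
    rw [← RingHom.FinitePresentation.of_finiteType]
    refine RingHom.FiniteType.of_comp_finiteType (f := (C : ℂ →+* MvPolynomial σ ℂ)) ?_
    have : (bind₁ P).toRingHom.comp (C : ℂ →+* MvPolynomial σ ℂ) = algebraMap ℂ _ := by
      ext; simp [MvPolynomial.algebraMap_eq]
    rw [this]
    exact RingHom.finiteType_algebraMap.mpr inferInstance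
  obtain ⟨T, hT⟩ := PrimeSpectrum.exists_constructibleSetData_iff.mpr
    (PrimeSpectrum.isConstructible_comap_image hft hcons)
  set s : Finset (Set (MvPolynomial σ ℂ) × MvPolynomial σ ℂ) :=
    T.image (fun c => (Set.range c.g, c.f)) with hs
  have key : ∀ z : σ → ℂ, (∃ c ∈ s, (∀ p ∈ c.1, eval z p = 0) ∧ eval z c.2 ≠ 0) ↔
      ∃ x : τ → ℂ, (∀ p ∈ S, eval x p = 0) ∧ z = fun i => eval x (P i) := by
    intro z
    rw [← mem_image_comap_iff, ← hT]
    have hm : ∀ q : MvPolynomial σ ℂ, q ∈ (pointToPoint (k := ℂ) z).asIdeal ↔ eval z q = 0 := by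
      intro q
      change q ∈ MvPolynomial.vanishingIdeal ℂ {z} ↔ _
      rw [mem_vanishingIdeal_singleton_iff]
      simp
    simp only [hs, Finset.mem_image, PrimeSpectrum.ConstructibleSetData.toSet, Set.mem_iUnion,
      PrimeSpectrum.BasicConstructibleSetData.toSet, Set.mem_sdiff, PrimeSpectrum.mem_zeroLocus,
      Set.subset_def, SetLike.mem_coe, hm, Set.mem_singleton_iff, forall_eq]
    constructor
    · rintro ⟨_, ⟨c, hc, rfl⟩, h1, h2⟩
      exact ⟨c, hc, h1, h2⟩
    · rintro ⟨c, hc, h1, h2⟩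
      exact ⟨_, ⟨c, hc, rfl⟩, h1, h2⟩
  obtain ⟨f, ⟨z, hz, hzf⟩, hf⟩ := exists_open_subset_of_constructible s
    ⟨_, (key _).mpr ⟨x₀, hx₀, rfl⟩⟩
  obtain ⟨x, hx, rfl⟩ := (key z).mp hz
  refine ⟨f, ⟨x, hx, hzf⟩, fun z hz hzf => (key z).mp (hf z (fun q hq => hz q fun x hx => ?_) hzf)⟩
  exact hq _ ((key _).mpr ⟨x, hx, rfl⟩)

end Constructible

end ZPaper

namespace ZPaper

section ClosedOrbit

open MeasureTheory

variable {n : ℕ} {H : Type} [Group H] [TopologicalSpace H] [IsTopologicalGroup H] [CompactSpace H]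
  [MeasurableSpace H] [BorelSpace H] {K : Set (Matrix (Fin n) (Fin n) ℝ)}

theorem isOpenPosMeasure_of_isMulRightInvariant (μ : Measure H) [IsProbabilityMeasure μ]
    [μ.IsMulRightInvariant] : μ.IsOpenPosMeasure := by
  refine ⟨fun U hU ⟨a, ha⟩ h0 => ?_⟩
  obtain ⟨t, ht⟩ := isCompact_univ.elim_finite_subcover (fun g : H => (fun h => h * g) ⁻¹' U)
    (fun g => hU.preimage (continuous_mul_const g))
    (fun h _ => Set.mem_iUnion.mpr ⟨h⁻¹ * a, by simpa using ha⟩)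
  have h1 : μ Set.univ ≤ ∑ g ∈ t, μ ((fun h => h * g) ⁻¹' U) :=
    (measure_mono ht).trans (measure_biUnion_finset_le t _)
  simp [measure_preimage_mul_right, h0] at h1

theorem continuous_cMat_mulVec {ρ : H → Matrix (Fin n) (Fin n) ℝ} (hρ : Continuous ρ)
    (v : Fin n → ℂ) : Continuous fun h => (cMat (ρ h)).mulVec v := by
  refine Continuous.matrix_mulVec (continuous_pi fun i => continuous_pi fun j => ?_)
    continuous_const
  exact Complex.continuous_ofReal.comp (hρ.matrix_elem i j)

/-- Averaging a polynomial over the compact group gives an invariant of the complexification. -/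
theorem exists_invariant_average (μ : Measure H) [IsProbabilityMeasure μ] [μ.IsMulRightInvariant]
    {ρ : H →* Matrix (Fin n) (Fin n) ℝ} (hρ : Continuous ρ) (hr : Set.range ρ = K)
    (p : MvPolynomial (Fin n) ℂ) :
    ∃ F : MvPolynomial (Fin n) ℂ, Invariant ℂ n (complexifiedGroup n K) F ∧
      (∀ v, eval v F = ∫ h, eval ((cMat (ρ h)).mulVec v) p ∂μ) ∧
      ∀ v x, polyDiff F v x =
        ∫ h, polyDiff p ((cMat (ρ h)).mulVec v) ((cMat (ρ h)).mulVec x) ∂μ := by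
  obtain ⟨F, hF, hF'⟩ := exists_average_eval μ (L := fun h => Matrix.mulVecLin (cMat (ρ h)))
    (fun v => by simpa only [Matrix.mulVecLin_apply] using continuous_cMat_mulVec hρ v) p
  simp only [Matrix.mulVecLin_apply] at hF hF'
  refine ⟨F, invariant_complexifiedGroup fun k hk v => ?_, hF, hF'⟩
  rw [← hr] at hk
  obtain ⟨g, rfl⟩ := hk
  rw [hF, hF, ← integral_mul_right_eq_self (fun h => eval ((cMat (ρ h)).mulVec v) p) g]
  simp only [map_mul, Matrix.mulVec_mulVec]

theorem exists_invariant_ne_zero (hK : IsMatSubgroup ℝ n K) (hc : IsCompact K) {w : Fin n → ℝ}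
    {f : MvPolynomial (Fin n) ℂ} (hf : eval (cv w) f ≠ 0) :
    ∃ F : MvPolynomial (Fin n) ℂ, Invariant ℂ n (complexifiedGroup n K) F ∧ eval (cv w) F ≠ 0 ∧
      ∀ z, (∀ k ∈ K, eval ((cMat k).mulVec z) f = 0) → eval z F = 0 := by
  obtain ⟨H, _, _, _, _, _, _, μ, _, _, ρ, hρ, hr⟩ := exists_haar hK hc
  have := isOpenPosMeasure_of_isMulRightInvariant μ
  obtain ⟨f₁, f₂, hff⟩ := exists_re_im f
  obtain ⟨F, hFi, hF, -⟩ := exists_invariant_average μ hρ hr (cPoly (f₁ * f₁ + f₂ * f₂))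
  refine ⟨F, hFi, ?_, fun z hz => ?_⟩
  · rw [hF]
    simp only [cMat_mulVec, eval_cPoly]
    rw [integral_complex_ofReal, Complex.ofReal_ne_zero]
    have hcont : Continuous fun h => eval ((ρ h).mulVec w) (f₁ * f₁ + f₂ * f₂) :=
      (MvPolynomial.continuous_eval _).comp (Continuous.matrix_mulVec hρ continuous_const)
    have h0 : ∀ h, 0 ≤ eval ((ρ h).mulVec w) (f₁ * f₁ + f₂ * f₂) := fun h => by
      simp only [map_add, map_mul]; exact add_nonneg (mul_self_nonneg _) (mul_self_nonneg _)
    refine ne_of_gt (hcont.integral_pos_of_hasCompactSupport_nonneg_nonzero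
      (HasCompactSupport.of_compactSpace _) h0 (x := 1) ?_)
    intro h1
    apply hf
    rw [map_one, Matrix.one_mulVec, map_add, map_mul, map_mul] at h1
    have h2 : eval w f₁ = 0 := by nlinarith [sq_nonneg (eval w f₁), sq_nonneg (eval w f₂)]
    have h3 : eval w f₂ = 0 := by nlinarith [sq_nonneg (eval w f₁), sq_nonneg (eval w f₂)]
    rw [hff, map_add, map_mul, eval_cPoly, eval_cPoly, h2, h3]
    simp
  · rw [hF]
    refine integral_eq_zero_of_ae (Filter.Eventually.of_forall fun h => ?_)
    have h1 := hz (ρ h) (hr ▸ Set.mem_range_self h)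
    have h2 : cPoly (f₁ * f₁ + f₂ * f₂) = f * (cPoly f₁ - C Complex.I * cPoly f₂) := by
      have hI : (C Complex.I * C Complex.I : MvPolynomial (Fin n) ℂ) = -1 := by
        rw [← C_mul, Complex.I_mul_I, C_neg, C_1]
      rw [hff]
      simp only [cPoly, map_add, map_mul]
      linear_combination (map Complex.ofRealHom f₂ * map Complex.ofRealHom f₂) * hI
    change eval _ (cPoly _) = 0
    rw [h2, map_mul, h1, zero_mul]

/-- The complex orbit of a real point is Zariski closed. -/
theorem hasClosedOrbit_complexifiedGroup (hK : IsMatSubgroup ℝ n K) (hc : IsCompact K)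
    (w : Fin n → ℝ) : HasClosedOrbit ℂ n (complexifiedGroup n K) (cv w) := by
  have hG := isMatSubgroup_complexifiedGroup hK hc
  intro z hz
  by_contra hcon
  have hmem : ∀ x : Fin n × Fin n → ℂ,
      (∀ p ∈ {p | VanishesOn (cMat '' K) p}, eval x p = 0) ↔
        flat.symm x ∈ complexifiedGroup n K := by
    intro x
    rw [mem_complexifiedGroup, flat.apply_symm_apply]
    rfl
  obtain ⟨P, hP⟩ : ∃ P : Fin n → MvPolynomial (Fin n × Fin n) ℂ, ∀ x,
      (fun i => eval x (P i)) = (flat.symm x).mulVec (cv w) := by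
    refine ⟨fun i => linSub (flatEvalAt (cv w)) (X i), fun x => ?_⟩
    funext i
    rw [eval_linSub, eval_X, ← flatEvalAt_flat, flat.apply_symm_apply]
  obtain ⟨f, ⟨x, hx, hxf⟩, hf⟩ := exists_open_subset_of_image P {p | VanishesOn (cMat '' K) p}
    (x₀ := flat 1) ((hmem _).mpr (by rw [flat.symm_apply_apply]; exact hG.1))
  rw [hmem] at hx
  rw [hP] at hxf
  set g := flat.symm x with hg
  have horb : ∀ u ∈ zclosure ℂ n (orbit ℂ n (complexifiedGroup n K) (cv w)),
      eval u f ≠ 0 → u ∈ orbit ℂ n (complexifiedGroup n K) (cv w) := by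
    intro u hu huf
    obtain ⟨x, hx, rfl⟩ := hf u (fun q hq => hu q (by
      rintro _ ⟨a, ha, rfl⟩
      have := hq (flat a) ((hmem _).mpr (by rwa [flat.symm_apply_apply]))
      rwa [hP, flat.symm_apply_apply] at this)) huf
    rw [hP]
    exact ⟨_, (hmem x).mp hx, rfl⟩
  have hstab : ∀ a ∈ complexifiedGroup n K,
      ∀ u ∈ zclosure ℂ n (orbit ℂ n (complexifiedGroup n K) (cv w)),
      a.mulVec u ∈ zclosure ℂ n (orbit ℂ n (complexifiedGroup n K) (cv w)) := by
    intro a ha u hu p hp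
    have := hu (linSub (Matrix.mulVecLin a) p) (by
      rintro _ ⟨b, hb, rfl⟩
      rw [eval_linSub, Matrix.mulVecLin_apply, Matrix.mulVec_mulVec]
      exact hp _ ⟨_, hG.2.1 a ha b hb, rfl⟩)
    rwa [eval_linSub, Matrix.mulVecLin_apply] at this
  have hback : ∀ a ∈ complexifiedGroup n K, ∀ u,
      a.mulVec u ∈ orbit ℂ n (complexifiedGroup n K) (cv w) →
      u ∈ orbit ℂ n (complexifiedGroup n K) (cv w) := by
    rintro a ha u ⟨b, hb, hbu⟩
    refine ⟨a⁻¹ * b, hG.2.1 _ (hG.2.2 a ha).2 b hb, ?_⟩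
    have hbu' : b.mulVec (cv w) = a.mulVec u := hbu
    change (a⁻¹ * b).mulVec (cv w) = u
    rw [← Matrix.mulVec_mulVec, hbu', Matrix.mulVec_mulVec,
      Matrix.nonsing_inv_mul _ ((Matrix.isUnit_iff_isUnit_det _).mp (hG.2.2 a ha).1),
      Matrix.one_mulVec]
  have hfw : eval (cv w) (linSub (Matrix.mulVecLin g) f) ≠ 0 := by
    rwa [eval_linSub, Matrix.mulVecLin_apply]
  obtain ⟨F, hFi, hFw, hF⟩ := exists_invariant_ne_zero hK hc hfw
  have hz0 : eval z F = 0 := by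
    refine hF z fun k hk => ?_
    rw [eval_linSub, Matrix.mulVecLin_apply]
    by_contra hne
    have h1 := hstab _ (cMat_mem hk) z hz
    exact hcon (hback _ (cMat_mem hk) _ (hback _ hx _ (horb _ (hstab _ hx _ h1) hne)))
  have := hz (F - C (eval (cv w) F)) (by
    rintro _ ⟨a, ha, rfl⟩
    have := hFi a ha (cv w)
    simpa [sub_eq_zero] using this)
  rw [map_sub, eval_C, hz0, zero_sub, neg_eq_zero] at this
  exact hFw this

end ClosedOrbit

end ZPaper

namespace ZPaper

section Laplace

open MeasureTheory

theorem exp_mul_quartic_le (x : ℝ) :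
    Real.exp (-(x ^ 2) / 2) * (x + x ^ 3 + x ^ 4) ≤ 32 * Real.exp (-(x ^ 2) / 8) := by
  have h1 := Real.quadratic_le_exp_of_nonneg (x := 3 * x ^ 2 / 8) (by positivity)
  have h2 : x + x ^ 3 + x ^ 4 ≤ 32 * Real.exp (3 * x ^ 2 / 8) := by
    nlinarith [sq_nonneg (x - 1), sq_nonneg (x * (x - 1)), sq_nonneg x, sq_nonneg (x ^ 2)]
  calc _ ≤ Real.exp (-(x ^ 2) / 2) * (32 * Real.exp (3 * x ^ 2 / 8)) := by gcongr
    _ = 32 * (Real.exp (-(x ^ 2) / 2) * Real.exp (3 * x ^ 2 / 8)) := by ring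
    _ = _ := by rw [← Real.exp_add]; congr 2; ring

variable {Ω : Type} [MeasurableSpace Ω]

theorem norm_exp_mul_sub_le {s r θ C : ℝ} {u u₀ : ℂ} (hs : 1 ≤ s) (hr : 0 ≤ r) (hC : 0 ≤ C)
    (hθ : |θ| ≤ C * r ^ 3) (hu : ‖u - u₀‖ ≤ C * (r + s * r ^ 4)) :
    ‖Complex.exp (s * (((-(r ^ 2) / 2 : ℝ) : ℂ) + Complex.I * θ)) * u
        - (Real.exp (-(s * r ^ 2) / 2) : ℂ) * u₀‖ ≤
      32 * C * (1 + ‖u₀‖) / Real.sqrt s * Real.exp (-(s / 4 * r ^ 2) / 2) := by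
  have hs0 : 0 < s := by linarith
  have hq : 1 ≤ Real.sqrt s := Real.one_le_sqrt.mpr hs
  have hq0 : 0 < Real.sqrt s := by linarith
  have hsq : Real.sqrt s ^ 2 = s := Real.sq_sqrt hs0.le
  set q := Real.sqrt s with hqdef
  have e1 : Complex.exp (s * (((-(r ^ 2) / 2 : ℝ) : ℂ) + Complex.I * θ)) =
      (Real.exp (-(s * r ^ 2) / 2) : ℂ) * Complex.exp (Complex.I * ((s * θ : ℝ) : ℂ)) := by
    rw [Complex.ofReal_exp, ← Complex.exp_add]
    congr 1
    push_cast
    ring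
  have e2 : ‖Complex.exp (Complex.I * ((s * θ : ℝ) : ℂ)) * u - u₀‖ ≤
      s * (C * r ^ 3) * ‖u₀‖ + C * (r + s * r ^ 4) := by
    have h1 : Complex.exp (Complex.I * ((s * θ : ℝ) : ℂ)) * u - u₀ =
        (Complex.exp (Complex.I * ((s * θ : ℝ) : ℂ)) - 1) * u₀ +
          Complex.exp (Complex.I * ((s * θ : ℝ) : ℂ)) * (u - u₀) := by ring
    rw [h1]
    refine (norm_add_le _ _).trans (add_le_add ?_ ?_)
    · rw [norm_mul]
      refine mul_le_mul_of_nonneg_right ?_ (norm_nonneg _)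
      refine Real.norm_exp_I_mul_ofReal_sub_one_le.trans ?_
      rw [Real.norm_eq_abs, abs_mul, abs_of_pos hs0]
      gcongr
    · rw [norm_mul, mul_comm Complex.I, Complex.norm_exp_ofReal_mul_I, one_mul]
      exact hu
  rw [e1, mul_assoc, ← mul_sub, norm_mul, Complex.norm_real, Real.norm_eq_abs,
    abs_of_pos (Real.exp_pos _)]
  have h3 := exp_mul_quartic_le (q * r)
  have h4 : Real.exp (-((q * r) ^ 2) / 2) = Real.exp (-(s * r ^ 2) / 2) := by
    rw [mul_pow, hsq]
  have h5 : Real.exp (-((q * r) ^ 2) / 8) = Real.exp (-(s / 4 * r ^ 2) / 2) := by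
    rw [mul_pow, hsq]; congr 1; ring
  rw [h4, h5] at h3
  have h6 : s * (C * r ^ 3) * ‖u₀‖ + C * (r + s * r ^ 4) ≤
      C * (1 + ‖u₀‖) / q * (q * r + (q * r) ^ 3 + (q * r) ^ 4) := by
    have h7 : C * (1 + ‖u₀‖) / q * (q * r + (q * r) ^ 3 + (q * r) ^ 4) =
        C * (1 + ‖u₀‖) * (r + q ^ 2 * r ^ 3 + q ^ 3 * r ^ 4) := by
      field_simp
    rw [h7, ← hsq]
    have h8 : q ^ 2 * r ^ 4 ≤ q ^ 3 * r ^ 4 := by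
      have : q ^ 2 ≤ q ^ 3 := pow_le_pow_right₀ hq (by norm_num)
      gcongr
    have h9 := mul_le_mul_of_nonneg_left h8 hC
    have h10 : 0 ≤ C * ‖u₀‖ * r := by positivity
    have h11 : 0 ≤ C * ‖u₀‖ * (q ^ 3 * r ^ 4) := by positivity
    have h12 : 0 ≤ C * (q ^ 2 * r ^ 3) := by positivity
    nlinarith
  calc _ ≤ Real.exp (-(s * r ^ 2) / 2) *
        (C * (1 + ‖u₀‖) / q * (q * r + (q * r) ^ 3 + (q * r) ^ 4)) := by
        gcongr
        exact e2.trans h6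
    _ = C * (1 + ‖u₀‖) / q * (Real.exp (-(s * r ^ 2) / 2) *
        (q * r + (q * r) ^ 3 + (q * r) ^ 4)) := by ring
    _ ≤ C * (1 + ‖u₀‖) / q * (32 * Real.exp (-(s / 4 * r ^ 2) / 2)) := by gcongr
    _ = _ := by ring

/-- A quantity whose Laplace-type averages vanish has vanishing value at the concentration
point. -/
theorem eq_zero_of_integral_exp_eq_zero (μ : Measure Ω) [IsProbabilityMeasure μ] {r θ : Ω → ℝ}
    {u : ℝ → Ω → ℂ} {u₀ : ℂ} {C C₀ c : ℝ} {D : ℕ} (hrm : Measurable r) (hr : ∀ ω, 0 ≤ r ω)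
    (hC : 0 ≤ C) (hθ : ∀ ω, |θ ω| ≤ C * r ω ^ 3)
    (hu : ∀ s, 1 ≤ s → ∀ ω, ‖u s ω - u₀‖ ≤ C * (r ω + s * r ω ^ 4)) (hc : 0 < c)
    (hgrow : ∀ j : ℕ, c / 2 ^ (j * D) ≤ μ.real {ω | r ω ≤ C₀ / 2 ^ j})
    (hintg : ∀ s, Integrable (fun ω => Complex.exp ((s : ℝ) *
      (((-(r ω ^ 2) / 2 : ℝ) : ℂ) + Complex.I * θ ω)) * u s ω) μ)
    (h0 : ∀ s, 1 ≤ s → ∫ ω, Complex.exp ((s : ℝ) *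
      (((-(r ω ^ 2) / 2 : ℝ) : ℂ) + Complex.I * θ ω)) * u s ω ∂μ = 0) : u₀ = 0 := by
  by_contra hne
  have hupos : 0 < ‖u₀‖ := norm_pos_iff.mpr hne
  set L : ℝ → ℝ := fun s => ∫ ω, Real.exp (-(s * r ω ^ 2) / 2) ∂μ with hL
  have hLint : ∀ s, 0 ≤ s → Integrable (fun ω => Real.exp (-(s * r ω ^ 2) / 2)) μ := by
    intro s hs
    refine Integrable.of_bound (Measurable.aestronglyMeasurable (by fun_prop)) 1
      (Filter.Eventually.of_forall fun ω => ?_)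
    rw [Real.norm_eq_abs, abs_of_pos (Real.exp_pos _), Real.exp_le_one_iff]
    have : 0 ≤ s * r ω ^ 2 := by positivity
    linarith
  have hLle : ∀ s, 0 ≤ s → L s ≤ 1 := by
    intro s hs
    calc L s ≤ ∫ _, (1 : ℝ) ∂μ := by
          refine integral_mono (hLint s hs) (integrable_const _) fun ω => ?_
          change Real.exp _ ≤ 1
          rw [Real.exp_le_one_iff]
          have : 0 ≤ s * r ω ^ 2 := by positivity
          linarith
      _ = 1 := by simp
  have hstep : ∀ s, 1 ≤ s → ‖u₀‖ * L s ≤ 32 * C * (1 + ‖u₀‖) / Real.sqrt s * L (s / 4) := by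
    intro s hs
    have h1 : ((L s : ℝ) : ℂ) * u₀ = ∫ ω, (Real.exp (-(s * r ω ^ 2) / 2) : ℂ) * u₀ ∂μ := by
      rw [integral_mul_const, hL, ← integral_complex_ofReal]
    have hi : Integrable (fun ω => (Real.exp (-(s * r ω ^ 2) / 2) : ℂ) * u₀) μ :=
      ((hLint s (by linarith)).ofReal).mul_const _
    have h2 : ‖u₀‖ * L s = ‖∫ ω, (Complex.exp (s * (((-(r ω ^ 2) / 2 : ℝ) : ℂ) +
        Complex.I * θ ω)) * u s ω - (Real.exp (-(s * r ω ^ 2) / 2) : ℂ) * u₀) ∂μ‖ := by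
      rw [integral_sub (hintg s) hi, h0 s hs, zero_sub, norm_neg, ← h1, norm_mul,
        Complex.norm_real, Real.norm_eq_abs, abs_of_nonneg, mul_comm]
      exact integral_nonneg fun ω => (Real.exp_pos _).le
    rw [h2, hL]
    refine (norm_integral_le_integral_norm _).trans ?_
    rw [← integral_const_mul]
    refine integral_mono ((hintg s).sub hi).norm ((hLint (s / 4) (by linarith)).const_mul _)
      fun ω => ?_
    exact norm_exp_mul_sub_le hs (hr ω) hC (hθ ω) (hu s hs ω)
  set C₁ := 32 * C * (1 + ‖u₀‖) / ‖u₀‖ with hC₁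
  have hC₁0 : 0 ≤ C₁ := by positivity
  obtain ⟨s₀, hs₀, hs₀'⟩ : ∃ s₀ : ℝ, 1 ≤ s₀ ∧ C₁ * 2 ^ (D + 1) ≤ Real.sqrt s₀ :=
    ⟨(1 + C₁ * 2 ^ (D + 1)) ^ 2, by nlinarith [show 0 ≤ C₁ * 2 ^ (D + 1) by positivity],
      by rw [Real.sqrt_sq (by positivity)]; linarith⟩
  have hdec : ∀ j : ℕ, L (4 ^ j * s₀) ≤ (1 / 2 ^ (D + 1)) ^ j := by
    intro j
    induction j with
    | zero => simpa using hLle s₀ (by linarith)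
    | succ j ih =>
      have h4 : (1 : ℝ) ≤ 4 ^ (j + 1) := one_le_pow₀ (by norm_num)
      have hge : s₀ ≤ 4 ^ (j + 1) * s₀ := by nlinarith
      have h1 := hstep (4 ^ (j + 1) * s₀) (by linarith)
      have h2 : (4 : ℝ) ^ (j + 1) * s₀ / 4 = 4 ^ j * s₀ := by rw [pow_succ]; ring
      rw [h2] at h1
      have hqpos : 0 < Real.sqrt (4 ^ (j + 1) * s₀) := Real.sqrt_pos.mpr (by positivity)
      have h3 : L (4 ^ (j + 1) * s₀) ≤ C₁ / Real.sqrt (4 ^ (j + 1) * s₀) * L (4 ^ j * s₀) := by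
        have : C₁ / Real.sqrt (4 ^ (j + 1) * s₀) * L (4 ^ j * s₀) =
            (32 * C * (1 + ‖u₀‖) / Real.sqrt (4 ^ (j + 1) * s₀) * L (4 ^ j * s₀)) / ‖u₀‖ := by
          rw [hC₁]; ring
        rw [this, le_div_iff₀ hupos, mul_comm]
        exact h1
      have h5 : C₁ / Real.sqrt (4 ^ (j + 1) * s₀) ≤ 1 / 2 ^ (D + 1) := by
        rw [div_le_div_iff₀ hqpos (by positivity), one_mul]
        exact hs₀'.trans (Real.sqrt_le_sqrt hge)
      have hLnn : 0 ≤ L (4 ^ j * s₀) := integral_nonneg fun ω => (Real.exp_pos _).le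
      calc _ ≤ _ := h3
        _ ≤ 1 / 2 ^ (D + 1) * (1 / 2 ^ (D + 1)) ^ j := by gcongr
        _ = _ := by rw [pow_succ]; ring
  have hlow : ∀ j : ℕ, Real.exp (-(s₀ * C₀ ^ 2) / 2) * (c / 2 ^ (j * D)) ≤ L (4 ^ j * s₀) := by
    intro j
    have hm : MeasurableSet {ω | r ω ≤ C₀ / 2 ^ j} := measurableSet_le hrm measurable_const
    have h1 : ∫ ω, Set.indicator {ω | r ω ≤ C₀ / 2 ^ j}
        (fun _ => Real.exp (-(s₀ * C₀ ^ 2) / 2)) ω ∂μ ≤ L (4 ^ j * s₀) := by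
      refine integral_mono ((integrable_const _).indicator hm) (hLint _ (by positivity))
        fun ω => ?_
      by_cases hω : ω ∈ {ω | r ω ≤ C₀ / 2 ^ j}
      · rw [Set.indicator_of_mem hω]
        have hω' : r ω ≤ C₀ / 2 ^ j := hω
        have h2 : r ω * 2 ^ j ≤ C₀ := by rwa [le_div_iff₀ (by positivity)] at hω'
        have h3 : (r ω * 2 ^ j) ^ 2 ≤ C₀ ^ 2 :=
          pow_le_pow_left₀ (mul_nonneg (hr ω) (by positivity)) h2 2
        have h4 : (4 : ℝ) ^ j = (2 ^ j) ^ 2 := by rw [← pow_mul, mul_comm, pow_mul]; norm_num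
        change Real.exp _ ≤ Real.exp _
        rw [Real.exp_le_exp, h4]
        nlinarith
      · rw [Set.indicator_of_notMem hω]
        exact (Real.exp_pos _).le
    rw [integral_indicator hm, setIntegral_const, smul_eq_mul, mul_comm] at h1
    exact (mul_le_mul_of_nonneg_left (hgrow j) (Real.exp_pos _).le).trans h1
  have hfin : ∀ j : ℕ, Real.exp (-(s₀ * C₀ ^ 2) / 2) * c ≤ (1 / 2) ^ j := by
    intro j
    have h1 := (hlow j).trans (hdec j)
    have h2 : (0 : ℝ) < 2 ^ (j * D) := by positivity
    have h3 : ((1 : ℝ) / 2 ^ (D + 1)) ^ j = (1 / 2) ^ j / 2 ^ (j * D) := by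
      rw [div_pow, one_pow, ← pow_mul, div_pow, one_pow, div_div, ← pow_add]
      congr 2; ring
    rw [h3, ← mul_div_assoc, div_le_div_iff_of_pos_right h2] at h1
    exact h1
  have hpos : 0 < Real.exp (-(s₀ * C₀ ^ 2) / 2) * c := mul_pos (Real.exp_pos _) hc
  obtain ⟨j, hj⟩ := exists_pow_lt_of_lt_one hpos (by norm_num : (1 / 2 : ℝ) < 1)
  exact absurd (hfin j) (not_le.mpr hj)

end Laplace

end ZPaper

namespace ZPaper

section Growth

open MeasureTheory

variable {H : Type} [Group H] [TopologicalSpace H] [IsTopologicalGroup H] [MeasurableSpace H]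
  [BorelSpace H]

/-- The sublevel sets of a gauge of finite-dimensional type have at most polynomially small
measure. -/
theorem exists_measure_sublevel_ge (μ : Measure H) [IsProbabilityMeasure μ]
    [μ.IsMulRightInvariant] {m : ℕ} {f : H → Fin m → ℝ} {r : H → ℝ} {R C₀ : ℝ}
    (hf : ∀ h i, |f h i| ≤ R)
    (hr : ∀ ε : ℝ, ∀ h h₀, (∀ i, |f h i - f h₀ i| ≤ ε) → r (h * h₀⁻¹) ≤ C₀ * ε) :
    ∃ c : ℝ, 0 < c ∧ ∀ j : ℕ, c / 2 ^ (j * m) ≤ μ.real {h | r h ≤ C₀ / 2 ^ j} := by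
  obtain ⟨M, hM⟩ := exists_nat_ge R
  refine ⟨1 / (2 * M + 1) ^ m, by positivity, fun j => ?_⟩
  set N : ℕ := 2 ^ j with hN
  have hN1 : 1 ≤ N := Nat.one_le_two_pow
  have hNpos : (0 : ℝ) < N := by exact_mod_cast hN1
  set φ : H → Fin m → ℤ := fun h i => ⌊(N : ℝ) * f h i⌋ with hφ
  set T : Finset (Fin m → ℤ) :=
    Fintype.piFinset fun _ => Finset.Icc (-((M : ℤ) * N)) ((M : ℤ) * N) with hT
  have hφT : ∀ h, φ h ∈ T := by
    intro h
    rw [hT, Fintype.mem_piFinset]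
    intro i
    have h1 := abs_le.mp ((hf h i).trans hM)
    rw [Finset.mem_Icc]
    constructor
    · rw [Int.le_floor]
      push_cast
      nlinarith
    · have : (φ h i : ℝ) ≤ M * N := (Int.floor_le _).trans (by nlinarith)
      exact_mod_cast this
  have hcard : (T.card : ℝ) = (2 * M * N + 1) ^ m := by
    have h1 : ((M : ℤ) * N + 1 - -((M : ℤ) * N)).toNat = 2 * M * N + 1 := by
      have : ((M : ℤ) * N + 1 - -((M : ℤ) * N)) = ((2 * M * N + 1 : ℕ) : ℤ) := by
        push_cast; ring
      rw [this, Int.toNat_natCast]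
    rw [hT, Fintype.card_piFinset]
    simp only [Int.card_Icc, h1, Finset.prod_const, Finset.card_univ, Fintype.card_fin]
    push_cast
    ring
  have hcpos : (0 : ℝ) < T.card := by rw [hcard]; positivity
  obtain ⟨t, -, ht⟩ : ∃ t ∈ T, 1 / (T.card : ℝ) ≤ μ.real (φ ⁻¹' {t}) := by
    by_contra hcon
    push Not at hcon
    have hne : T.Nonempty := ⟨φ 1, hφT 1⟩
    have h1 : ∑ t ∈ T, μ.real (φ ⁻¹' {t}) < ∑ _t ∈ T, 1 / (T.card : ℝ) :=
      Finset.sum_lt_sum_of_nonempty hne hcon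
    rw [Finset.sum_const, nsmul_eq_mul, mul_one_div_cancel hcpos.ne'] at h1
    have h2 : μ.real Set.univ ≤ ∑ t ∈ T, μ.real (φ ⁻¹' {t}) := by
      have : (Set.univ : Set H) ⊆ ⋃ t ∈ T, φ ⁻¹' {t} := fun h _ => by
        rw [Set.mem_iUnion₂]
        exact ⟨φ h, hφT h, rfl⟩
      exact (measureReal_mono this (measure_ne_top _ _)).trans (measureReal_biUnion_finset_le _ _)
    rw [probReal_univ] at h2
    linarith
  have hpos : 0 < μ.real (φ ⁻¹' {t}) := lt_of_lt_of_le (by positivity) ht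
  obtain ⟨h₀, hh₀⟩ : (φ ⁻¹' {t}).Nonempty := by
    by_contra hemp
    rw [Set.not_nonempty_iff_eq_empty] at hemp
    simp [hemp] at hpos
  have hsub : φ ⁻¹' {t} ⊆ (fun h => h * h₀⁻¹) ⁻¹' {h | r h ≤ C₀ / 2 ^ j} := by
    intro h hh
    have heq : φ h = φ h₀ := Eq.trans hh (Eq.symm hh₀)
    have h1 := hr (1 / N) h h₀ fun i => by
      have h2 : ⌊(N : ℝ) * f h i⌋ = ⌊(N : ℝ) * f h₀ i⌋ := congrFun heq i
      have h3 := Int.abs_sub_lt_one_of_floor_eq_floor h2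
      rw [← mul_sub, abs_mul, abs_of_pos hNpos] at h3
      rw [le_div_iff₀ hNpos, mul_comm]
      exact h3.le
    have h4 : C₀ * (1 / (N : ℝ)) = C₀ / 2 ^ j := by rw [hN]; push_cast; ring
    rw [h4] at h1
    exact h1
  have h5 : μ.real (φ ⁻¹' {t}) ≤ μ.real {h | r h ≤ C₀ / 2 ^ j} := by
    refine (measureReal_mono hsub).trans (le_of_eq ?_)
    simp only [measureReal_def, measure_preimage_mul_right]
  refine le_trans ?_ (ht.trans h5)
  rw [hcard, pow_mul, div_div, ← mul_pow]
  have hN' : ((2 : ℝ) ^ j) = N := by rw [hN]; push_cast; rfl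
  rw [hN']
  gcongr
  have : (1 : ℝ) ≤ N := by exact_mod_cast hN1
  nlinarith

/-- The exponential generating series of the moments of a bounded function. -/
theorem hasSum_integral_pow_mul [CompactSpace H] (μ : Measure H) [IsFiniteMeasure μ] {a b : H → ℂ}
    (ha : Continuous a) (hb : Continuous b) (s : ℝ) :
    HasSum (fun k : ℕ => (s : ℂ) ^ k / (k.factorial : ℂ) * ∫ h, a h ^ k * b h ∂μ)
      (∫ h, Complex.exp (s * a h) * b h ∂μ) := by
  obtain ⟨A, hA⟩ := (isCompact_range ha).isBounded.exists_norm_le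
  obtain ⟨B, hB⟩ := (isCompact_range hb).isBounded.exists_norm_le
  have hA' : ∀ h, ‖a h‖ ≤ A := fun h => hA _ ⟨h, rfl⟩
  have hB' : ∀ h, ‖b h‖ ≤ B := fun h => hB _ ⟨h, rfl⟩
  have hA0 : 0 ≤ A := (norm_nonneg _).trans (hA' 1)
  have hB0 : 0 ≤ B := (norm_nonneg _).trans (hB' 1)
  have hintg : ∀ k : ℕ, Integrable
      (fun h => (s : ℂ) ^ k / (k.factorial : ℂ) * (a h ^ k * b h)) μ := fun k =>
    integrable_of_continuous μ (continuous_const.mul ((ha.pow k).mul hb))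
  have h1 := hasSum_integral_of_summable_integral_norm hintg (by
    refine Summable.of_nonneg_of_le (fun k => integral_nonneg fun h => norm_nonneg _) (fun k => ?_)
      ((Real.summable_pow_div_factorial (|s| * A)).mul_right (B * μ.real Set.univ))
    calc ∫ h, ‖(s : ℂ) ^ k / (k.factorial : ℂ) * (a h ^ k * b h)‖ ∂μ
        ≤ ∫ _, (|s| * A) ^ k / k.factorial * B ∂μ := by
          refine integral_mono (hintg k).norm (integrable_const _) fun h => ?_
          change ‖_‖ ≤ _
          rw [norm_mul, norm_div, norm_pow, norm_mul, norm_pow, Complex.norm_real,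
            Complex.norm_natCast, Real.norm_eq_abs, mul_pow, ← mul_assoc, mul_div_right_comm]
          have := hA' h
          have := hB' h
          gcongr
      _ = _ := by rw [integral_const, smul_eq_mul]; ring)
  have h2 : ∀ h, ∑' k : ℕ, (s : ℂ) ^ k / (k.factorial : ℂ) * (a h ^ k * b h) =
      Complex.exp (s * a h) * b h := by
    intro h
    rw [Complex.exp_eq_exp_ℂ, NormedSpace.exp_eq_tsum_div, ← tsum_mul_right]
    refine tsum_congr fun k => ?_
    rw [mul_pow]
    ring
  simp only [h2] at h1
  simpa only [integral_const_mul] using h1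

end Growth

end ZPaper

namespace ZPaper

section Estimates

open Filter Topology Asymptotics

theorem exists_exp_taylor_le (𝔸 : Type*) [NormedRing 𝔸] [NormedAlgebra ℝ 𝔸] [CompleteSpace 𝔸] :
    ∃ C : ℝ, 0 ≤ C ∧ ∀ᶠ B in 𝓝 (0 : 𝔸),
      ‖NormedSpace.exp B - 1 - B - (2⁻¹ : ℝ) • (B * B)‖ ≤ C * ‖B‖ ^ 3 := by
  have h := (NormedSpace.exp_hasFPowerSeriesAt_zero (𝕂 := ℝ) (𝔸 := 𝔸)).isBigO_sub_partialSum_pow 3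
  obtain ⟨C, hC, hb⟩ := h.exists_nonneg
  refine ⟨C, hC, ?_⟩
  filter_upwards [hb.bound] with B hB
  have h2 : (NormedSpace.expSeries ℝ 𝔸).partialSum 3 B = 1 + B + (2⁻¹ : ℝ) • (B * B) := by
    simp [FormalMultilinearSeries.partialSum, Finset.sum_range_succ,
      NormedSpace.expSeries_apply_eq, pow_two]
  rw [zero_add, h2, norm_pow, norm_norm] at hB
  rwa [sub_sub, sub_sub, ← add_assoc]

local notation "⟪" x "," y "⟫" => inner ℂ x y

variable {𝔸 E : Type*} [NormedRing 𝔸] [NormedAlgebra ℝ 𝔸] [CompleteSpace 𝔸]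
  [NormedAddCommGroup E] [InnerProductSpace ℂ E] [NormedSpace ℝ E]

/-- Bounds for matrix coefficients along a one-step exponential chart, in terms of the
displacement of the first vector. -/
theorem exists_coefficient_bounds (Ψ Φ : 𝔸 →L[ℝ] E) (S : Submodule ℝ 𝔸) {c : ℝ} (hc : 0 < c)
    (hS : ∀ B ∈ S, c * ‖B‖ ≤ ‖Ψ B‖) (h1 : ∀ B ∈ S, ⟪Ψ 1, Ψ B⟫ = 0)
    (h2 : ∀ B ∈ S, (⟪Ψ 1, Ψ ((2⁻¹ : ℝ) • (B * B))⟫).im = 0) (h3 : ∀ B ∈ S, ⟪Ψ 1, Φ B⟫ = 0)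
    (h4 : ∀ B ∈ S, ⟪Φ 1, Ψ B⟫ = 0) :
    ∃ C : ℝ, 0 ≤ C ∧ ∀ᶠ B in 𝓝 (0 : 𝔸), B ∈ S →
      |(⟪Ψ 1, Ψ (NormedSpace.exp B)⟫).im| ≤ C * ‖Ψ (NormedSpace.exp B) - Ψ 1‖ ^ 3 ∧
      ‖⟪Ψ 1, Φ (NormedSpace.exp B)⟫ - ⟪Ψ 1, Φ 1⟫‖ ≤ C * ‖Ψ (NormedSpace.exp B) - Ψ 1‖ ^ 2 ∧
      ‖⟪Φ 1, Ψ (NormedSpace.exp B)⟫ - ⟪Φ 1, Ψ 1⟫‖ ≤ C * ‖Ψ (NormedSpace.exp B) - Ψ 1‖ ^ 2 ∧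
      ‖⟪Φ 1, Φ (NormedSpace.exp B)⟫ - ⟪Φ 1, Φ 1⟫‖ ≤ C * ‖Ψ (NormedSpace.exp B) - Ψ 1‖ := by
  obtain ⟨C₁, hC₁, hev⟩ := exists_exp_taylor_le 𝔸
  set C₂ : ℝ := C₁ + 1 with hC₂
  have hev2 : ∀ᶠ B in 𝓝 (0 : 𝔸), ‖NormedSpace.exp B - 1 - B‖ ≤ C₂ * ‖B‖ ^ 2 := by
    have hball : ∀ᶠ B in 𝓝 (0 : 𝔸), ‖B‖ < 1 := by
      filter_upwards [Metric.ball_mem_nhds (0 : 𝔸) one_pos] with B hB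
      simpa using hB
    filter_upwards [hev, hball] with B hB hB1
    have h5 : ‖(2⁻¹ : ℝ) • (B * B)‖ ≤ ‖B‖ ^ 2 := by
      rw [norm_smul, Real.norm_of_nonneg (by norm_num : (0 : ℝ) ≤ 2⁻¹)]
      nlinarith [norm_mul_le B B, norm_nonneg (B * B), sq_nonneg ‖B‖]
    have h6 := norm_add_le (NormedSpace.exp B - 1 - B - (2⁻¹ : ℝ) • (B * B)) ((2⁻¹ : ℝ) • (B * B))
    rw [sub_add_cancel] at h6
    have h7 : C₁ * ‖B‖ ^ 3 ≤ C₁ * ‖B‖ ^ 2 :=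
      mul_le_mul_of_nonneg_left (pow_le_pow_of_le_one (norm_nonneg _) hB1.le (by norm_num)) hC₁
    rw [hC₂]
    linarith
  have hC₂0 : 0 ≤ C₂ := by positivity
  set P := max ‖Ψ‖ ‖Φ‖ with hP
  have hP0 : 0 ≤ P := (norm_nonneg _).trans (le_max_left _ _)
  have hΨ : ∀ X, ‖Ψ X‖ ≤ P * ‖X‖ := fun X =>
    (Ψ.le_opNorm X).trans (mul_le_mul_of_nonneg_right (le_max_left _ _) (norm_nonneg _))
  have hΦ : ∀ X, ‖Φ X‖ ≤ P * ‖X‖ := fun X =>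
    (Φ.le_opNorm X).trans (mul_le_mul_of_nonneg_right (le_max_right _ _) (norm_nonneg _))
  set Q := max ‖Ψ 1‖ ‖Φ 1‖ with hQ
  have hQ0 : 0 ≤ Q := (norm_nonneg _).trans (le_max_left _ _)
  set D := 2 / c with hD
  have hD0 : 0 < D := by positivity
  set M := Q * P * (C₂ + 1) with hM
  have hM0 : 0 ≤ M := by positivity
  refine ⟨M * D ^ 3 + M * D ^ 2 + M * D, by positivity, ?_⟩
  have hsmall : ∀ᶠ B in 𝓝 (0 : 𝔸), P * C₂ * ‖B‖ < c / 2 ∧ ‖B‖ < 1 := by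
    have hcont : Continuous fun B : 𝔸 => P * C₂ * ‖B‖ := by fun_prop
    have hcont' : Continuous fun B : 𝔸 => ‖B‖ := by fun_prop
    refine (hcont.tendsto 0 |>.eventually_lt_const ?_).and
      (hcont'.tendsto 0 |>.eventually_lt_const ?_) <;> simp [hc]
  filter_upwards [hev, hev2, hsmall] with B hB3 hB2 hBs hBS
  obtain ⟨hBs, hB1⟩ := hBs
  set r := ‖Ψ (NormedSpace.exp B) - Ψ 1‖ with hr
  have hb0 := norm_nonneg B
  have hr0 : 0 ≤ r := norm_nonneg _
  have hBr : ‖B‖ ≤ D * r := by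
    have h5 : Ψ (NormedSpace.exp B) - Ψ 1 = Ψ B + Ψ (NormedSpace.exp B - 1 - B) := by
      simp only [map_sub]; abel
    have h6 : ‖Ψ B‖ ≤ r + ‖Ψ (NormedSpace.exp B - 1 - B)‖ := by
      have : Ψ B = (Ψ (NormedSpace.exp B) - Ψ 1) - Ψ (NormedSpace.exp B - 1 - B) := by
        rw [h5]; abel
      rw [this]
      exact norm_sub_le _ _
    have h7 := (hΨ (NormedSpace.exp B - 1 - B)).trans (mul_le_mul_of_nonneg_left hB2 hP0)
    have h8 := hS B hBS
    have h9 : c / 2 * ‖B‖ ≤ r := by nlinarith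
    rw [hD, div_mul_eq_mul_div, le_div_iff₀ hc]
    linarith
  have hr2 : ‖B‖ ^ 2 ≤ D ^ 2 * r ^ 2 := by
    rw [← mul_pow]; exact pow_le_pow_left₀ hb0 hBr 2
  have hr3 : ‖B‖ ^ 3 ≤ D ^ 3 * r ^ 3 := by
    rw [← mul_pow]; exact pow_le_pow_left₀ hb0 hBr 3
  have hlow : ∀ k : ℕ, M * (D ^ k * r ^ k) = M * D ^ k * r ^ k := fun k => by ring
  have hQΨ : ‖Ψ 1‖ ≤ Q := le_max_left _ _
  have hQΦ : ‖Φ 1‖ ≤ Q := le_max_right _ _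
  have key : ∀ (u : E) (Θ : 𝔸 →L[ℝ] E) (X : 𝔸) (k : ℕ) , ‖u‖ ≤ Q → (∀ X, ‖Θ X‖ ≤ P * ‖X‖) →
      ‖X‖ ≤ (C₂ + 1) * ‖B‖ ^ k → ‖⟪u, Θ X⟫‖ ≤ M * (D ^ k * r ^ k) := by
    intro u Θ X k hu hΘ hX
    have hBk : ‖B‖ ^ k ≤ D ^ k * r ^ k := by
      rw [← mul_pow]; exact pow_le_pow_left₀ hb0 hBr k
    calc ‖⟪u, Θ X⟫‖ ≤ ‖u‖ * ‖Θ X‖ := norm_inner_le_norm _ _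
      _ ≤ Q * (P * ((C₂ + 1) * ‖B‖ ^ k)) := by
          refine mul_le_mul hu ((hΘ X).trans (mul_le_mul_of_nonneg_left hX hP0)) (norm_nonneg _) hQ0
      _ = M * ‖B‖ ^ k := by rw [hM]; ring
      _ ≤ _ := mul_le_mul_of_nonneg_left hBk hM0
  have hX2 : ‖NormedSpace.exp B - 1 - B‖ ≤ (C₂ + 1) * ‖B‖ ^ 2 := hB2.trans (by gcongr; linarith)
  have hX3 : ‖NormedSpace.exp B - 1 - B - (2⁻¹ : ℝ) • (B * B)‖ ≤ (C₂ + 1) * ‖B‖ ^ 3 :=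
    hB3.trans (by gcongr; linarith)
  have hX1 : ‖NormedSpace.exp B - 1‖ ≤ (C₂ + 1) * ‖B‖ ^ 1 := by
    have h5 := norm_add_le (NormedSpace.exp B - 1 - B) B
    rw [sub_add_cancel] at h5
    have : C₂ * ‖B‖ ^ 2 ≤ C₂ * ‖B‖ :=
      mul_le_mul_of_nonneg_left (by nlinarith) hC₂0
    rw [pow_one]
    linarith
  have hpos1 : 0 ≤ M * D * r := by positivity
  have hMD1 : 0 ≤ M * D := by positivity
  have hMD2 : 0 ≤ M * D ^ 2 := by positivity
  have hMD3 : 0 ≤ M * D ^ 3 := by positivity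
  refine ⟨?_, ?_, ?_, ?_⟩
  · have h5 : (⟪Ψ 1, Ψ (NormedSpace.exp B)⟫).im =
        (⟪Ψ 1, Ψ (NormedSpace.exp B - 1 - B - (2⁻¹ : ℝ) • (B * B))⟫).im := by
      rw [map_sub, map_sub, map_sub, inner_sub_right, inner_sub_right, inner_sub_right, h1 B hBS,
        Complex.sub_im, Complex.sub_im, Complex.sub_im, h2 B hBS]
      have : (⟪Ψ 1, Ψ 1⟫).im = 0 := inner_self_im (𝕜 := ℂ) _
      rw [this]
      simp
    rw [h5]
    refine (Complex.abs_im_le_norm _).trans ((key _ Ψ _ 3 hQΨ hΨ hX3).trans ?_)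
    rw [hlow]
    gcongr
    linarith
  · have h5 : ⟪Ψ 1, Φ (NormedSpace.exp B)⟫ - ⟪Ψ 1, Φ 1⟫ = ⟪Ψ 1, Φ (NormedSpace.exp B - 1 - B)⟫ := by
      rw [map_sub, map_sub, inner_sub_right, inner_sub_right, h3 B hBS, sub_zero]
    rw [h5]
    refine (key _ Φ _ 2 hQΨ hΦ hX2).trans ?_
    rw [hlow]
    gcongr
    linarith
  · have h5 : ⟪Φ 1, Ψ (NormedSpace.exp B)⟫ - ⟪Φ 1, Ψ 1⟫ = ⟪Φ 1, Ψ (NormedSpace.exp B - 1 - B)⟫ := by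
      rw [map_sub, map_sub, inner_sub_right, inner_sub_right, h4 B hBS, sub_zero]
    rw [h5]
    refine (key _ Ψ _ 2 hQΦ hΨ hX2).trans ?_
    rw [hlow]
    gcongr
    linarith
  · have h5 : ⟪Φ 1, Φ (NormedSpace.exp B)⟫ - ⟪Φ 1, Φ 1⟫ = ⟪Φ 1, Φ (NormedSpace.exp B - 1)⟫ := by
      rw [map_sub, inner_sub_right]
    rw [h5]
    refine (key _ Φ _ 1 hQΦ hΦ hX1).trans ?_
    rw [hlow, pow_one, pow_one]
    gcongr
    linarith

end Estimates

end ZPaper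

namespace ZPaper

attribute [local instance] matNormedRing matNormedAlgebra

section Unitary

open Filter Topology

local notation "⟪" x "," y "⟫" => inner ℂ x y

variable {n : ℕ} {K : Set (Matrix (Fin n) (Fin n) ℝ)}

/-- Linear coordinates in which a matrix group acts by isometries. -/
def IsUnitarization (K : Set (Matrix (Fin n) (Fin n) ℝ))
    (T : (Fin n → ℂ) ≃ₗ[ℂ] EuclideanSpace ℂ (Fin n)) : Prop :=
  ∀ k ∈ K, ∀ u v, ⟪T ((cMat k).mulVec u), T ((cMat k).mulVec v)⟫ = ⟪T u, T v⟫

theorem star_cMat_mulVec (k : Matrix (Fin n) (Fin n) ℝ) (u : Fin n → ℂ) :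
    star ((cMat k).mulVec u) = (cMat k).mulVec (star u) := by
  funext i
  simp [Matrix.mulVec, dotProduct, cMat_apply]

theorem exists_isUnitarization (hK : IsMatSubgroup ℝ n K) (hc : IsCompact K) :
    ∃ T, IsUnitarization K T := by
  obtain ⟨S, hS, h⟩ := exists_orthogonalizer hK hc
  have hinj : Function.Injective (cMat S).mulVecLin := by
    intro u v huv
    exact Matrix.mulVec_injective_of_isUnit ((Matrix.isUnit_iff_isUnit_det _).mpr
      (isUnit_cMat_det hS)) huv
  refine ⟨(LinearEquiv.ofInjectiveEndo _ hinj).trans (WithLp.linearEquiv 2 ℂ _).symm, ?_⟩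
  intro k hk u v
  have key : ∀ a b : Fin n → ℂ, ((cMat S).mulVec b) ⬝ᵥ star ((cMat S).mulVec a) =
      (star a) ⬝ᵥ (cMat (S.transpose * S)).mulVec b := by
    intro a b
    rw [dotProduct_comm, star_cMat_mulVec, map_mul, ← Matrix.mulVec_mulVec,
      Matrix.dotProduct_mulVec (star a), ← cMat_transpose, Matrix.vecMul_transpose]
  have hM : (cMat k).transpose * cMat (S.transpose * S) * cMat k = cMat (S.transpose * S) := by
    rw [cMat_transpose, ← map_mul, ← map_mul, h k hk]
  simp only [LinearEquiv.trans_apply, EuclideanSpace.inner_eq_star_dotProduct]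
  change ((cMat S).mulVec _) ⬝ᵥ star ((cMat S).mulVec _) =
    ((cMat S).mulVec _) ⬝ᵥ star ((cMat S).mulVec _)
  rw [key, key, star_cMat_mulVec]
  conv_rhs => rw [← hM, ← Matrix.mulVec_mulVec, ← Matrix.mulVec_mulVec,
    Matrix.dotProduct_mulVec (star u), Matrix.vecMul_transpose]

variable {T : (Fin n → ℂ) ≃ₗ[ℂ] EuclideanSpace ℂ (Fin n)}

theorem exists_eq_cv (v : Fin n → ℂ) : ∃ a b : Fin n → ℝ, v = cv a + Complex.I • cv b :=
  ⟨_, _, (cv_re_add_im v).symm⟩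

theorem hasDerivAt_cMat_exp_mulVec (A : Matrix (Fin n) (Fin n) ℝ) (v : Fin n → ℂ) :
    HasDerivAt (fun t : ℝ => (cMat (NormedSpace.exp (t • A))).mulVec v) ((cMat A).mulVec v) 0 := by
  obtain ⟨a, b, rfl⟩ := exists_eq_cv v
  have h : ∀ a : Fin n → ℝ, HasDerivAt (fun t : ℝ => (NormedSpace.exp (t • A)).mulVec a)
      (A.mulVec a) 0 := fun a => by simpa using hasDerivAt_exp_mulVec A a 0
  simp only [cMat_mulVec_add_I]
  rw [hasDerivAt_pi]
  intro i
  have h1 := (hasDerivAt_pi.mp (h a) i).ofReal_comp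
  have h2 := ((hasDerivAt_pi.mp (h b) i).ofReal_comp).const_mul Complex.I
  exact h1.add h2

theorem inner_mulVec_add_inner (hT : IsUnitarization K T) (hK : IsMatSubgroup ℝ n K)
    (hZ : IsZClosedSet K) {A : Matrix (Fin n) (Fin n) ℝ} (hA : A ∈ tangentOne K)
    (u v : Fin n → ℂ) :
    ⟪T ((cMat A).mulVec u), T v⟫ + ⟪T u, T ((cMat A).mulVec v)⟫ = 0 := by
  let L : (Fin n → ℂ) →L[ℝ] EuclideanSpace ℂ (Fin n) :=
    LinearMap.toContinuousLinearMap ((T : (Fin n → ℂ) →ₗ[ℂ] _).restrictScalars ℝ)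
  have h : ∀ u, HasDerivAt (fun t : ℝ => T ((cMat (NormedSpace.exp (t • A))).mulVec u))
      (T ((cMat A).mulVec u)) 0 := fun u =>
    L.hasFDerivAt.comp_hasDerivAt (0 : ℝ) (hasDerivAt_cMat_exp_mulVec A u)
  have h1 := (h u).inner ℂ (h v)
  have h2 : (fun t : ℝ => ⟪T ((cMat (NormedSpace.exp (t • A))).mulVec u),
      T ((cMat (NormedSpace.exp (t • A))).mulVec v)⟫) = fun _ => ⟪T u, T v⟫ := by
    funext t
    exact hT _ (exp_smul_mem hK.1 hK.2.1 hZ hA t) u v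
  rw [h2] at h1
  have h3 := h1.unique (hasDerivAt_const _ _)
  simp only [zero_smul, NormedSpace.exp_zero, map_one, Matrix.one_mulVec] at h3
  rw [add_comm]
  exact h3

end Unitary

end ZPaper

namespace ZPaper

attribute [local instance] matNormedRing matNormedAlgebra

section Displacement

open Filter Topology

local notation "⟪" x "," y "⟫" => inner ℂ x y

variable {n : ℕ} {K : Set (Matrix (Fin n) (Fin n) ℝ)}
  {T : (Fin n → ℂ) ≃ₗ[ℂ] EuclideanSpace ℂ (Fin n)}

/-- The real linear map `B ↦ T (B v)` on real matrices. -/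
def coordEval (T : (Fin n → ℂ) ≃ₗ[ℂ] EuclideanSpace ℂ (Fin n)) (v : Fin n → ℂ) :
    Matrix (Fin n) (Fin n) ℝ →L[ℝ] EuclideanSpace ℂ (Fin n) :=
  LinearMap.toContinuousLinearMap
    { toFun := fun B => T ((cMat B).mulVec v)
      map_add' := fun A B => by rw [map_add, Matrix.add_mulVec, map_add]
      map_smul' := fun t B => by
        have : ((cMat (t • B)).mulVec v) = t • (cMat B).mulVec v := by
          rw [cMat_smul, Matrix.smul_mulVec]
          funext i
          simp
        rw [this]
        exact (((T : (Fin n → ℂ) →ₗ[ℂ] EuclideanSpace ℂ (Fin n)).restrictScalars ℝ).map_smul t _) }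

theorem coordEval_apply (v : Fin n → ℂ) (B : Matrix (Fin n) (Fin n) ℝ) :
    coordEval T v B = T ((cMat B).mulVec v) := rfl

/-- Bounds for the matrix coefficients of `k` on the vectors `y` and `x` in terms of the
displacement of `y`. -/
def CoefficientBounds (T : (Fin n → ℂ) ≃ₗ[ℂ] EuclideanSpace ℂ (Fin n)) (y x : Fin n → ℂ) (C : ℝ)
    (k : Matrix (Fin n) (Fin n) ℝ) : Prop :=
  |(⟪T y, T ((cMat k).mulVec y)⟫).im| ≤ C * ‖T ((cMat k).mulVec y) - T y‖ ^ 3 ∧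
  ‖⟪T y, T ((cMat k).mulVec x)⟫ - ⟪T y, T x⟫‖ ≤ C * ‖T ((cMat k).mulVec y) - T y‖ ^ 2 ∧
  ‖⟪T x, T ((cMat k).mulVec y)⟫ - ⟪T x, T y⟫‖ ≤ C * ‖T ((cMat k).mulVec y) - T y‖ ^ 2 ∧
  ‖⟪T x, T ((cMat k).mulVec x)⟫ - ⟪T x, T x⟫‖ ≤ C * ‖T ((cMat k).mulVec y) - T y‖

theorem CoefficientBounds.mono {y x : Fin n → ℂ} {C D : ℝ} {k : Matrix (Fin n) (Fin n) ℝ}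
    (h : CoefficientBounds T y x C k) (hCD : C ≤ D) : CoefficientBounds T y x D k := by
  obtain ⟨h1, h2, h3, h4⟩ := h
  refine ⟨h1.trans ?_, h2.trans ?_, h3.trans ?_, h4.trans ?_⟩ <;> gcongr

theorem IsUnitarization.norm_eq (hT : IsUnitarization K T) {k : Matrix (Fin n) (Fin n) ℝ}
    (hk : k ∈ K) (v : Fin n → ℂ) : ‖T ((cMat k).mulVec v)‖ = ‖T v‖ := by
  rw [@norm_eq_sqrt_re_inner ℂ, @norm_eq_sqrt_re_inner ℂ _ _ _ _ (T v), hT k hk]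

theorem cMat_exp_mulVec_eq {A : Matrix (Fin n) (Fin n) ℝ} {v : Fin n → ℂ}
    (h : (cMat A).mulVec v = 0) : (cMat (NormedSpace.exp A)).mulVec v = v := by
  obtain ⟨a, b, rfl⟩ := exists_eq_cv v
  rw [cMat_mulVec_add_I] at h ⊢
  have ha : A.mulVec a = 0 := by
    have := congrArg reVec h
    rw [reVec_add_I] at this
    rw [this]; funext i; simp [reVec]
  have hb : A.mulVec b = 0 := by
    have := congrArg imVec h
    rw [imVec_add_I] at this
    rw [this]; funext i; simp [imVec]
  have ea := exp_smul_mulVec_eq ha 1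
  have eb := exp_smul_mulVec_eq hb 1
  rw [one_smul] at ea eb
  rw [ea, eb]

theorem exists_coefficientBounds_near_one (hT : IsUnitarization K T) (hK : IsMatSubgroup ℝ n K)
    (hZ : IsZClosedSet K) {y x : Fin n → ℂ}
    (hy : ∀ A ∈ tangentOne K, ⟪T y, T ((cMat A).mulVec y)⟫ = 0)
    (hx : ∀ A ∈ tangentOne K, ⟪T x, T ((cMat A).mulVec y)⟫ = 0)
    (hfix : ∀ k ∈ K, (cMat k).mulVec y = y → (cMat k).mulVec x = x) :
    ∃ C : ℝ, 0 ≤ C ∧ ∀ᶠ k in 𝓝 (1 : Matrix (Fin n) (Fin n) ℝ), k ∈ K →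
      CoefficientBounds T y x C k := by
  let N : Submodule ℝ (Matrix (Fin n) (Fin n) ℝ) :=
    tangentOne K ⊓ LinearMap.ker (coordEval T y).toLinearMap
  obtain ⟨S', hS'⟩ := N.exists_isCompl
  let S := S' ⊓ tangentOne K
  have hNle : N ≤ tangentOne K := inf_le_left
  have hSN : S ⊔ N = tangentOne K := by
    rw [sup_comm, ← sup_inf_assoc_of_le _ hNle, hS'.sup_eq_top, top_inf_eq]
  have hSinj : LinearMap.ker ((coordEval T y).toLinearMap.domRestrict S) =
      ⊥ := by
    rw [LinearMap.ker_eq_bot']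
    intro B hB
    have h1 : (B : Matrix (Fin n) (Fin n) ℝ) ∈ N := ⟨B.2.2, hB⟩
    have h2 := (Submodule.disjoint_def.mp hS'.disjoint) _ h1 B.2.1
    exact Subtype.ext h2
  obtain ⟨κ, hκ, hanti⟩ := LinearMap.exists_antilipschitzWith _ hSinj
  have hlow : ∀ B ∈ S, (κ : ℝ)⁻¹ * ‖B‖ ≤ ‖coordEval T y B‖ := by
    intro B hB
    have h1 := hanti.le_mul_dist ⟨B, hB⟩ 0
    rw [map_zero, dist_zero_right, dist_zero_right] at h1
    rw [inv_mul_le_iff₀ (by exact_mod_cast hκ)]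
    exact h1
  have hskew := fun A hA u v => inner_mulVec_add_inner hT hK hZ (A := A) hA u v
  obtain ⟨C, hC, hev⟩ := exists_coefficient_bounds (coordEval T y) (coordEval T x) S
    (c := (κ : ℝ)⁻¹) (by positivity) hlow
    (fun B hB => by simpa [coordEval_apply] using hy B hB.2)
    (fun B hB => by
      have h1 := hskew B hB.2 y ((cMat B).mulVec y)
      have h2 : (⟪T ((cMat B).mulVec y), T ((cMat B).mulVec y)⟫).im = 0 :=
        inner_self_im (𝕜 := ℂ) _
      have h3 : ⟪T y, T ((cMat B).mulVec ((cMat B).mulVec y))⟫ =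
        -⟪T ((cMat B).mulVec y), T ((cMat B).mulVec y)⟫ := eq_neg_of_add_eq_zero_right h1
      rw [map_smul, coordEval_apply, coordEval_apply, map_mul, ← Matrix.mulVec_mulVec, map_one,
        Matrix.one_mulVec, ← Complex.coe_smul, inner_smul_right, h3, Complex.im_ofReal_mul,
        Complex.neg_im, h2, neg_zero, mul_zero])
    (fun B hB => by
      have h1 := hskew B hB.2 y x
      have h2 : ⟪T ((cMat B).mulVec y), T x⟫ = 0 := by
        rw [← inner_conj_symm, hx B hB.2, map_zero]
      rw [h2, zero_add] at h1
      simpa [coordEval_apply] using h1)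
    (fun B hB => by simpa [coordEval_apply] using hx B hB.2)
  refine ⟨C, hC, ?_⟩
  filter_upwards [eventually_exists_exp_mul_exp hK.1 hK.2.1 hZ hSN hev] with k hk hkK
  obtain ⟨B, hB, A, hA, hBU, -, rfl⟩ := hk hkK
  have hAy : (cMat (NormedSpace.exp A)).mulVec y = y :=
    cMat_exp_mulVec_eq (T.map_eq_zero_iff.mp hA.2)
  have hAx := hfix _ (exp_mem hK.1 hK.2.1 hZ hA.1) hAy
  have e1 : (cMat (NormedSpace.exp B * NormedSpace.exp A)).mulVec y =
      (cMat (NormedSpace.exp B)).mulVec y := by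
    rw [map_mul, ← Matrix.mulVec_mulVec, hAy]
  have e2 : (cMat (NormedSpace.exp B * NormedSpace.exp A)).mulVec x =
      (cMat (NormedSpace.exp B)).mulVec x := by
    rw [map_mul, ← Matrix.mulVec_mulVec, hAx]
  have h := hBU hB
  simp only [coordEval_apply, map_one, Matrix.one_mulVec] at h
  unfold CoefficientBounds
  rw [e1, e2]
  exact h

theorem exists_coefficientBounds (hT : IsUnitarization K T) (hK : IsMatSubgroup ℝ n K)
    (hc : IsCompact K) {y x : Fin n → ℂ}
    (hy : ∀ A ∈ tangentOne K, ⟪T y, T ((cMat A).mulVec y)⟫ = 0)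
    (hx : ∀ A ∈ tangentOne K, ⟪T x, T ((cMat A).mulVec y)⟫ = 0)
    (hfix : ∀ k ∈ K, (cMat k).mulVec y = y → (cMat k).mulVec x = x) :
    ∃ C : ℝ, 0 ≤ C ∧ ∀ k ∈ K, CoefficientBounds T y x C k := by
  have hZ := isZClosedSet_of_isCompact hK hc
  have main : ∃ C : ℝ, 0 ≤ C ∧ ∀ k ∈ K, k ∈ K → CoefficientBounds T y x C k := by
    refine hc.induction_on
      (p := fun s => ∃ C : ℝ, 0 ≤ C ∧ ∀ k ∈ s, k ∈ K → CoefficientBounds T y x C k)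
      ⟨0, le_rfl, by simp⟩ ?_ ?_ ?_
    · rintro s t hst ⟨C, hC, h⟩
      exact ⟨C, hC, fun k hk => h k (hst hk)⟩
    · rintro s t ⟨C, hC, h⟩ ⟨D, hD, h'⟩
      refine ⟨max C D, hC.trans (le_max_left _ _), ?_⟩
      rintro k (hk | hk) hkK
      · exact (h k hk hkK).mono (le_max_left _ _)
      · exact (h' k hk hkK).mono (le_max_right _ _)
    · intro k₀ hk₀
      by_cases hfk : (cMat k₀).mulVec y = y
      · obtain ⟨C, hC, hev⟩ := exists_coefficientBounds_near_one hT hK hZ hy hx hfix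
        have hu := (hK.2.2 k₀ hk₀).1
        have hdet := (Matrix.isUnit_iff_isUnit_det _).mp hu
        have hcont : Continuous fun k : Matrix (Fin n) (Fin n) ℝ => k * k₀⁻¹ := by fun_prop
        have htend : Tendsto (fun k : Matrix (Fin n) (Fin n) ℝ => k * k₀⁻¹) (𝓝 k₀) (𝓝 1) := by
          have := hcont.tendsto k₀
          rwa [Matrix.mul_nonsing_inv _ hdet] at this
        refine ⟨_, mem_nhdsWithin_of_mem_nhds (htend.eventually hev), C, hC, ?_⟩
        intro k hk hkK
        have h1 := hk (hK.2.1 _ hkK _ (hK.2.2 k₀ hk₀).2)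
        have hfx := hfix k₀ hk₀ hfk
        have e : ∀ v, (cMat k₀).mulVec v = v →
            (cMat (k * k₀⁻¹)).mulVec v = (cMat k).mulVec v := by
          intro v hv
          conv_lhs => rw [← hv]
          rw [Matrix.mulVec_mulVec, ← map_mul, mul_assoc, Matrix.nonsing_inv_mul _ hdet, mul_one]
        unfold CoefficientBounds at h1 ⊢
        rwa [e y hfk, e x hfx] at h1
      · have hcont : Continuous fun k : Matrix (Fin n) (Fin n) ℝ =>
            ‖T ((cMat k).mulVec y) - T y‖ :=
          ((coordEval T y).continuous.sub continuous_const).norm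
        have hpos : 0 < ‖T ((cMat k₀).mulVec y) - T y‖ := by
          rw [norm_pos_iff, sub_ne_zero]
          exact fun h => hfk (T.injective h)
        set δ := ‖T ((cMat k₀).mulVec y) - T y‖ / 2 with hδ
        have hδ0 : 0 < δ := by positivity
        have hev : ∀ᶠ k in 𝓝 k₀, δ < ‖T ((cMat k).mulVec y) - T y‖ :=
          (hcont.tendsto k₀).eventually_const_lt (by rw [hδ]; linarith)
        set Q := max ‖T y‖ ‖T x‖ with hQ
        have hQ0 : 0 ≤ Q := (norm_nonneg _).trans (le_max_left _ _)
        have hQy : ‖T y‖ ≤ Q := le_max_left _ _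
        have hQx : ‖T x‖ ≤ Q := le_max_right _ _
        set M := 2 * (Q * Q) with hM
        have hM0 : 0 ≤ M := by positivity
        refine ⟨_, mem_nhdsWithin_of_mem_nhds hev, M / δ ^ 3 + M / δ ^ 2 + M / δ, by positivity, ?_⟩
        intro k hk hkK
        have hk : δ < ‖T ((cMat k).mulVec y) - T y‖ := hk
        have hi : ∀ u v, ‖T u‖ ≤ Q → ‖T v‖ ≤ Q → ‖⟪T u, T v⟫‖ ≤ Q * Q := fun u v hu hv =>
          (norm_inner_le_norm _ _).trans (mul_le_mul hu hv (norm_nonneg _) hQ0)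
        have hky : ‖T ((cMat k).mulVec y)‖ ≤ Q := (hT.norm_eq hkK y).trans_le hQy
        have hkx : ‖T ((cMat k).mulVec x)‖ ≤ Q := (hT.norm_eq hkK x).trans_le hQx
        have hd : ∀ a b : ℂ, ‖a‖ ≤ Q * Q → ‖b‖ ≤ Q * Q → ‖a - b‖ ≤ M := fun a b ha hb =>
          (norm_sub_le _ _).trans (by rw [hM]; linarith)
        set r := ‖T ((cMat k).mulVec y) - T y‖ with hr
        have h3 : M ≤ M / δ ^ 3 * r ^ 3 := by
          rw [div_mul_eq_mul_div, le_div_iff₀ (by positivity)]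
          gcongr
        have h2 : M ≤ M / δ ^ 2 * r ^ 2 := by
          rw [div_mul_eq_mul_div, le_div_iff₀ (by positivity)]
          gcongr
        have h1 : M ≤ M / δ * r := by
          rw [div_mul_eq_mul_div, le_div_iff₀ (by positivity)]
          gcongr
        have p1 : 0 ≤ M / δ := by positivity
        have p2 : 0 ≤ M / δ ^ 2 := by positivity
        have p3 : 0 ≤ M / δ ^ 3 := by positivity
        have hr0 : 0 ≤ r := norm_nonneg _
        refine ⟨?_, ?_, ?_, ?_⟩
        · refine ((Complex.abs_im_le_norm _).trans (hi _ _ hQy hky)).trans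
            ((by rw [hM]; nlinarith : Q * Q ≤ M).trans (h3.trans ?_))
          gcongr
          linarith
        · refine (hd _ _ (hi _ _ hQy hkx) (hi _ _ hQy hQx)).trans (h2.trans ?_)
          gcongr
          linarith
        · refine (hd _ _ (hi _ _ hQx hky) (hi _ _ hQx hQy)).trans (h2.trans ?_)
          gcongr
          linarith
        · refine (hd _ _ (hi _ _ hQx hkx) (hi _ _ hQx hQx)).trans (h1.trans ?_)
          gcongr
          linarith
  obtain ⟨C, hC, h⟩ := main
  exact ⟨C, hC, fun k hk => h k hk hk⟩

end Displacement

end ZPaper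

namespace ZPaper

section CriticalVector

open MeasureTheory

local notation "⟪" x "," y "⟫" => inner ℂ x y

theorem exists_eval_eq_linear {σ 𝕜 : Type} [RCLike 𝕜] [Fintype σ] (L : (σ → 𝕜) →ₗ[𝕜] 𝕜) :
    ∃ p : MvPolynomial σ 𝕜, (∀ v, eval v p = L v) ∧ ∀ v x, polyDiff p v x = L x := by
  classical
  have hL : ∀ v, ∑ i, L (Pi.single i 1) * v i = L v := by
    intro v
    conv_rhs => rw [pi_eq_sum_univ' v, map_sum]
    refine Finset.sum_congr rfl fun i _ => ?_
    rw [map_smul, smul_eq_mul, mul_comm]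
  refine ⟨∑ i, C (L (Pi.single i 1)) * X i, fun v => ?_, fun v x => ?_⟩
  · rw [map_sum, ← hL]
    simp
  · rw [polyDiff_apply, ← hL]
    refine Finset.sum_congr rfl fun i _ => ?_
    congr 1
    rw [map_sum, map_sum, Finset.sum_eq_single i]
    · simp
    · intro j _ hj
      simp [pderiv_X, hj]
    · simp

theorem polyDiff_pow {σ 𝕜 : Type} [RCLike 𝕜] [Fintype σ] (p : MvPolynomial σ 𝕜) (m : ℕ)
    (v x : σ → 𝕜) :
    polyDiff (p ^ m) v x = m * eval v p ^ (m - 1) * polyDiff p v x := by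
  simp only [polyDiff_apply, Derivation.leibniz_pow, smul_eq_mul, map_mul, map_pow,
    nsmul_eq_mul, map_natCast]
  rw [Finset.mul_sum]
  refine Finset.sum_congr rfl fun i _ => ?_
  ring

variable {n : ℕ} {K : Set (Matrix (Fin n) (Fin n) ℝ)}
  {T : (Fin n → ℂ) ≃ₗ[ℂ] EuclideanSpace ℂ (Fin n)}

theorem exists_eval_eq_inner (T : (Fin n → ℂ) ≃ₗ[ℂ] EuclideanSpace ℂ (Fin n)) (u : Fin n → ℂ) :
    ∃ p : MvPolynomial (Fin n) ℂ, (∀ v, eval v p = ⟪T u, T v⟫) ∧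
      ∀ v x, polyDiff p v x = ⟪T u, T x⟫ :=
  exists_eval_eq_linear
    { toFun := fun v => ⟪T u, T v⟫
      map_add' := fun v w => by rw [map_add, inner_add_right]
      map_smul' := fun c v => by rw [map_smul, inner_smul_right]; rfl }

/-- A vector which is normal to the orbit of a vector `y` of minimal length, fixed by the
stabilizer of `y` and annihilated by the differentials at `y` of all invariants, is zero. -/
theorem eq_zero_of_polyDiff_invariant_eq_zero (hT : IsUnitarization K T)
    (hK : IsMatSubgroup ℝ n K) (hc : IsCompact K) {y x : Fin n → ℂ}
    (hy : ∀ A ∈ tangentOne K, ⟪T y, T ((cMat A).mulVec y)⟫ = 0)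
    (hx : ∀ A ∈ tangentOne K, ⟪T x, T ((cMat A).mulVec y)⟫ = 0)
    (hfix : ∀ k ∈ K, (cMat k).mulVec y = y → (cMat k).mulVec x = x)
    (hF : ∀ F : MvPolynomial (Fin n) ℂ, Invariant ℂ n (complexifiedGroup n K) F →
      polyDiff F y x = 0) : x = 0 := by
  obtain ⟨C, hC, hbd⟩ := exists_coefficientBounds hT hK hc hy hx hfix
  obtain ⟨H, _, _, _, _, _, _, μ, _, _, ρ, hρ, hr⟩ := exists_haar hK hc
  have hρK : ∀ h, ρ h ∈ K := fun h => hr ▸ Set.mem_range_self h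
  have hTc : ∀ v, Continuous fun h => T ((cMat (ρ h)).mulVec v) := fun v =>
    (LinearMap.continuous_of_finiteDimensional
      (T : (Fin n → ℂ) →ₗ[ℂ] EuclideanSpace ℂ (Fin n))).comp (continuous_cMat_mulVec hρ v)
  set a : H → ℂ := fun h => ⟪T y, T ((cMat (ρ h)).mulVec y)⟫ with ha
  set b : H → ℂ := fun h => ⟪T y, T ((cMat (ρ h)).mulVec x)⟫ with hb
  set c : H → ℂ := fun h => ⟪T x, T ((cMat (ρ h)).mulVec y)⟫ with hcdef
  set d : H → ℂ := fun h => ⟪T x, T ((cMat (ρ h)).mulVec x)⟫ with hd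
  set r : H → ℝ := fun h => ‖T ((cMat (ρ h)).mulVec y) - T y‖ with hrdef
  have hac : Continuous a := continuous_const.inner (hTc y)
  have hbc : Continuous b := continuous_const.inner (hTc x)
  have hcc : Continuous c := continuous_const.inner (hTc y)
  have hdc : Continuous d := continuous_const.inner (hTc x)
  have hrc : Continuous r := ((hTc y).sub continuous_const).norm
  have hr0 : ∀ h, 0 ≤ r h := fun h => norm_nonneg _
  have hintg : ∀ f : H → ℂ, Continuous f → Integrable f μ := fun f hf =>
    hf.integrable_of_hasCompactSupport (HasCompactSupport.of_compactSpace _)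
  obtain ⟨p, hp, hp'⟩ := exists_eval_eq_inner T y
  obtain ⟨q, hq, hq'⟩ := exists_eval_eq_inner T x
  have hmom : ∀ f : MvPolynomial (Fin n) ℂ,
      ∫ h, polyDiff f ((cMat (ρ h)).mulVec y) ((cMat (ρ h)).mulVec x) ∂μ = 0 := by
    intro f
    obtain ⟨F, hFi, -, hFd⟩ := exists_invariant_average μ hρ hr f
    rw [← hFd]
    exact hF F hFi
  have hab : ∀ m, ∫ h, a h ^ m * b h ∂μ = 0 := by
    intro m
    have h1 := hmom (p ^ (m + 1))
    simp only [polyDiff_pow, hp, hp', Nat.add_sub_cancel, mul_assoc] at h1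
    rw [integral_const_mul] at h1
    exact (mul_eq_zero.mp h1).resolve_left (Nat.cast_ne_zero.mpr m.succ_ne_zero)
  have had : ∀ m : ℕ, (m : ℂ) * ∫ h, a h ^ (m - 1) * (b h * c h) ∂μ + ∫ h, a h ^ m * d h ∂μ = 0 := by
    intro m
    have h1 := hmom (p ^ m * q)
    rw [← integral_const_mul, ← integral_add]
    · rw [← h1]
      refine integral_congr_ae (Filter.Eventually.of_forall fun h => ?_)
      simp only [polyDiff_mul, polyDiff_pow, hp, hp', hq, hq', map_pow]
      ring
    · exact (hintg _ ((hac.pow _).mul (hbc.mul hcc))).const_mul _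
    · exact hintg _ ((hac.pow _).mul hdc)
  set θ : H → ℝ := fun h => (a h).im with hθ
  have hare : ∀ h, a h = ((‖T y‖ ^ 2 : ℝ) : ℂ) +
      (((-(r h ^ 2) / 2 : ℝ) : ℂ) + Complex.I * θ h) := by
    intro h
    have h1 : r h ^ 2 = ‖T y‖ ^ 2 - 2 * (a h).re + ‖T y‖ ^ 2 := by
      rw [hrdef]
      simp only
      rw [@norm_sub_sq ℂ, hT.norm_eq (hρK h), inner_re_symm]
      rfl
    apply Complex.ext
    · simp only [Complex.add_re, Complex.ofReal_re, Complex.mul_re, Complex.I_re, Complex.I_im,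
        Complex.ofReal_im]
      linarith
    · simp [hθ, -Complex.ofReal_pow]
  have hexp : ∀ (s : ℝ) (u : H → ℂ), ∫ h, Complex.exp ((s : ℝ) * a h) * u h ∂μ =
      Complex.exp (s * ((‖T y‖ ^ 2 : ℝ) : ℂ)) * ∫ h, Complex.exp ((s : ℝ) *
        (((-(r h ^ 2) / 2 : ℝ) : ℂ) + Complex.I * θ h)) * u h ∂μ := by
    intro s u
    rw [← integral_const_mul]
    refine integral_congr_ae (Filter.Eventually.of_forall fun h => ?_)
    simp only
    rw [hare h, mul_add, Complex.exp_add, mul_assoc]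
  have hexp0 : ∀ (s : ℝ) (u : H → ℂ), ∫ h, Complex.exp ((s : ℝ) * a h) * u h ∂μ = 0 →
      ∫ h, Complex.exp ((s : ℝ) *
        (((-(r h ^ 2) / 2 : ℝ) : ℂ) + Complex.I * θ h)) * u h ∂μ = 0 := by
    intro s u h
    rw [hexp] at h
    exact (mul_eq_zero.mp h).resolve_left (Complex.exp_ne_zero _)
  have hexpc : ∀ s : ℝ, Continuous fun h => Complex.exp ((s : ℝ) *
        (((-(r h ^ 2) / 2 : ℝ) : ℂ) + Complex.I * θ h)) := by
    intro s
    have hθc : Continuous θ := Complex.continuous_im.comp hac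
    refine Complex.continuous_exp.comp (continuous_const.mul ((Complex.continuous_ofReal.comp
      (((hrc.pow 2).neg).div_const 2)).add (continuous_const.mul
        (Complex.continuous_ofReal.comp hθc))))
  obtain ⟨C₀, D, c₀, hc₀, hgrow⟩ : ∃ (C₀ : ℝ) (D : ℕ) (c₀ : ℝ), 0 < c₀ ∧
      ∀ j : ℕ, c₀ / 2 ^ (j * D) ≤ μ.real {h | r h ≤ C₀ / 2 ^ j} := by
    set f : H → Fin (n + n) → ℝ := fun h => Fin.append
      (fun i => (T ((cMat (ρ h⁻¹)).mulVec y) i).re) (fun i => (T ((cMat (ρ h⁻¹)).mulVec y) i).im)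
      with hf
    have hTi : ∀ h i, ‖T ((cMat (ρ h)).mulVec y) i‖ ≤ ‖T y‖ := fun h i =>
      (PiLp.norm_apply_le _ i).trans (hT.norm_eq (hρK h) y).le
    suffices hs : (∀ h i, |f h i| ≤ ‖T y‖) ∧ ∀ ε : ℝ, ∀ h h₀, (∀ i, |f h i - f h₀ i| ≤ ε) →
        r (h * h₀⁻¹) ≤ Real.sqrt n * 2 * ε by
      obtain ⟨c₀, hc₀, hg⟩ := exists_measure_sublevel_ge μ hs.1 hs.2
      exact ⟨_, _, c₀, hc₀, hg⟩
    refine ⟨fun h i => ?_, fun ε h h₀ hε => ?_⟩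
    · refine Fin.addCases (fun i => ?_) (fun i => ?_) i
      · simpa [hf] using (Complex.abs_re_le_norm _).trans (hTi h⁻¹ i)
      · simp only [hf, Fin.append_right]
        exact (Complex.abs_im_le_norm _).trans (hTi h⁻¹ i)
    · have h1 : T ((cMat (ρ (h * h₀⁻¹))).mulVec y) - T y =
          T ((cMat (ρ h)).mulVec ((cMat (ρ h₀⁻¹)).mulVec y - (cMat (ρ h⁻¹)).mulVec y)) := by
        rw [Matrix.mulVec_sub, Matrix.mulVec_mulVec, Matrix.mulVec_mulVec, ← map_mul, ← map_mul,
          ← map_mul, ← map_mul, mul_inv_cancel, map_one, map_one, Matrix.one_mulVec, map_sub]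
      have h2 : r (h * h₀⁻¹) =
          ‖T ((cMat (ρ h₀⁻¹)).mulVec y) - T ((cMat (ρ h⁻¹)).mulVec y)‖ := by
        rw [hrdef]
        simp only
        rw [h1, hT.norm_eq (hρK h), map_sub]
      rw [h2, EuclideanSpace.norm_eq]
      have h3 : ∀ i : Fin n, ‖(T ((cMat (ρ h₀⁻¹)).mulVec y) - T ((cMat (ρ h⁻¹)).mulVec y)) i‖ ≤
          2 * ε := by
        intro i
        have h4 := hε (Fin.castAdd n i)
        have h5 := hε (Fin.natAdd n i)
        simp only [hf, Fin.append_left, Fin.append_right] at h4 h5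
        rw [PiLp.sub_apply, norm_sub_rev]
        refine (Complex.norm_le_abs_re_add_abs_im _).trans ?_
        rw [Complex.sub_re, Complex.sub_im]
        linarith
      rcases Nat.eq_zero_or_pos n with hn | hn
      · subst hn
        simp
      · have hε0 : 0 ≤ 2 * ε := (norm_nonneg _).trans (h3 ⟨0, hn⟩)
        have h4 : ∑ i : Fin n, ‖(T ((cMat (ρ h₀⁻¹)).mulVec y) -
            T ((cMat (ρ h⁻¹)).mulVec y)) i‖ ^ 2 ≤ n * (2 * ε) ^ 2 := by
          refine (Finset.sum_le_sum fun i _ => pow_le_pow_left₀ (norm_nonneg _) (h3 i) 2).trans ?_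
          simp
        refine (Real.sqrt_le_sqrt h4).trans (le_of_eq ?_)
        rw [Real.sqrt_mul (Nat.cast_nonneg _), Real.sqrt_sq hε0, mul_assoc]
  have hrQ : ∀ h, r h ≤ 2 * ‖T y‖ := by
    intro h
    refine (norm_sub_le _ _).trans ?_
    rw [hT.norm_eq (hρK h)]
    linarith
  have hQ : 0 ≤ 2 * ‖T y‖ := by positivity
  have hyx : ⟪T y, T x⟫ = 0 := by
    refine eq_zero_of_integral_exp_eq_zero μ (r := r) (θ := θ) (u := fun _ => b)
      (C := C + C * (2 * ‖T y‖)) hrc.measurable hr0 (by positivity) (fun h => ?_)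
      (fun s hs h => ?_) hc₀ hgrow (fun s => hintg _ ((hexpc s).mul hbc)) (fun s _ => ?_)
    · refine (hbd _ (hρK h)).1.trans ?_
      gcongr
      · exact le_add_of_nonneg_right (by positivity)
    · refine (hbd _ (hρK h)).2.1.trans ?_
      have h1 := hrQ h
      have h2 := hr0 h
      have h3 : C * r h ^ 2 ≤ C * (2 * ‖T y‖) * r h := by
        rw [mul_assoc, pow_two]
        gcongr
      have h4 : 0 ≤ (C + C * (2 * ‖T y‖)) * (s * r h ^ 4) := by positivity
      have h5 : 0 ≤ C * r h := by positivity
      change C * r h ^ 2 ≤ _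
      linarith
    · refine hexp0 s b ?_
      have h1 := hasSum_integral_pow_mul μ hac hbc s
      simp only [hab, mul_zero] at h1
      exact h1.unique hasSum_zero
  have hxy : ⟪T x, T y⟫ = 0 := by rw [← inner_conj_symm, hyx, map_zero]
  have hxx : ⟪T x, T x⟫ = 0 := by
    refine eq_zero_of_integral_exp_eq_zero μ (r := r) (θ := θ)
      (u := fun s h => s * (b h * c h) + d h)
      (C := C + C * C) hrc.measurable hr0 (by positivity) (fun h => ?_)
      (fun s hs h => ?_) hc₀ hgrow (fun s => hintg _ ((hexpc s).mul
        ((continuous_const.mul (hbc.mul hcc)).add hdc))) (fun s _ => ?_)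
    · refine (hbd _ (hρK h)).1.trans ?_
      gcongr
      · exact le_add_of_nonneg_right (by positivity)
    · obtain ⟨-, h1, h2, h3⟩ := hbd _ (hρK h)
      rw [hyx, sub_zero] at h1
      rw [hxy, sub_zero] at h2
      change ‖b h‖ ≤ C * r h ^ 2 at h1
      change ‖c h‖ ≤ C * r h ^ 2 at h2
      change ‖d h - _‖ ≤ C * r h at h3
      have h4 := hr0 h
      have h5 : ‖(s : ℂ) * (b h * c h)‖ ≤ s * (C * r h ^ 2 * (C * r h ^ 2)) := by
        rw [norm_mul, norm_mul, Complex.norm_real, Real.norm_of_nonneg (by linarith)]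
        gcongr
      rw [add_sub_assoc]
      refine (norm_add_le _ _).trans ((add_le_add h5 h3).trans ?_)
      have h6 : 0 ≤ C * C * r h := by positivity
      have h7 : 0 ≤ C * (s * r h ^ 4) := by positivity
      nlinarith
    · refine hexp0 s _ ?_
      have h1 := hasSum_integral_pow_mul μ hac (hbc.mul hcc) s
      have h2 := hasSum_integral_pow_mul μ hac hdc s
      have h3 := (hasSum_nat_add_iff' 1).mpr h2
      have hβ : ∫ h, d h ∂μ = 0 := by simpa using had 0
      have h5 : ∀ k : ℕ, (s : ℂ) * ((s : ℂ) ^ k / (k.factorial : ℂ) *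
          ∫ h, a h ^ k * (b h * c h) ∂μ) =
          -((s : ℂ) ^ (k + 1) / ((k + 1).factorial : ℂ) * ∫ h, a h ^ (k + 1) * d h ∂μ) := by
        intro k
        have h6 := eq_neg_of_add_eq_zero_right (had (k + 1))
        rw [Nat.add_sub_cancel] at h6
        rw [h6, Nat.factorial_succ]
        have hk1 : ((k : ℂ) + 1) ≠ 0 := by exact_mod_cast k.succ_ne_zero
        have hk2 : (k.factorial : ℂ) ≠ 0 := by exact_mod_cast k.factorial_ne_zero
        push_cast
        field_simp
        ring
      simp only [Finset.sum_range_one, pow_zero, one_mul, hβ, mul_zero, sub_zero] at h3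
      have h4 : HasSum (fun k : ℕ => -((s : ℂ) ^ (k + 1) / ((k + 1).factorial : ℂ) *
          ∫ h, a h ^ (k + 1) * d h ∂μ)) (s * ∫ h, Complex.exp (s * a h) * (b h * c h) ∂μ) := by
        rw [← funext h5]
        exact h1.mul_left (s : ℂ)
      have h6 := h4.unique h3.neg
      have h7 : ∀ h, Complex.exp (s * a h) * (s * (b h * c h) + d h) =
          s * (Complex.exp (s * a h) * (b h * c h)) + Complex.exp (s * a h) * d h := fun h => by
        ring
      have hexpc' : Continuous fun h => Complex.exp ((s : ℂ) * a h) :=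
        Complex.continuous_exp.comp (continuous_const.mul hac)
      refine (integral_congr_ae (Filter.Eventually.of_forall h7)).trans ?_
      rw [integral_add, integral_const_mul, h6, neg_add_cancel]
      · exact (hintg _ (hexpc'.mul (hbc.mul hcc))).const_mul _
      · exact hintg _ (hexpc'.mul hdc)
  rw [inner_self_eq_zero] at hxx
  exact T.map_eq_zero_iff.mp hxx

end CriticalVector

end ZPaper

namespace ZPaper

attribute [local instance] matNormedRing matNormedAlgebra

section MinimalVector

variable {n : ℕ} {K : Set (Matrix (Fin n) (Fin n) ℝ)} {G : Set (Matrix (Fin n) (Fin n) ℂ)}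
  {T : (Fin n → ℂ) ≃ₗ[ℂ] EuclideanSpace ℂ (Fin n)}

theorem HasClosedOrbit.isClosed {y : Fin n → ℂ} (hy : HasClosedOrbit ℂ n G y) :
    IsClosed (orbit ℂ n G y) := by
  have h : orbit ℂ n G y = ⋂ p ∈ vanishingIdeal ℂ n (orbit ℂ n G y), {v | eval v p = 0} := by
    ext v
    simp only [Set.mem_iInter, Set.mem_ofPred_eq]
    exact ⟨fun hv p hp => hp v hv, fun hv => hy fun p hp => hv p hp⟩
  rw [h]
  refine isClosed_biInter fun p _ => isClosed_eq ?_ continuous_const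
  exact continuous_iff_continuousAt.mpr fun v => (hasFDerivAt_eval p v).continuousAt

theorem HasClosedOrbit.exists_norm_le (hG : IsMatSubgroup ℂ n G) {y : Fin n → ℂ}
    (hy : HasClosedOrbit ℂ n G y) (T : (Fin n → ℂ) ≃ₗ[ℂ] EuclideanSpace ℂ (Fin n)) :
    ∃ g ∈ G, ∀ h ∈ G, ‖T (g.mulVec y)‖ ≤ ‖T (h.mulVec (g.mulVec y))‖ := by
  have hcl : IsClosed (T.symm ⁻¹' orbit ℂ n G y) :=
    hy.isClosed.preimage (LinearMap.continuous_of_finiteDimensional T.symm.toLinearMap)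
  obtain ⟨z, hz, hmin⟩ := hcl.exists_infDist_eq_dist ⟨T y, 1, hG.1, by simp⟩ 0
  obtain ⟨g, hg, hgz⟩ := hz
  have hgz' : T (g.mulVec y) = z := by
    rw [← T.apply_symm_apply z]
    exact congrArg T hgz
  refine ⟨g, hg, fun h hh => ?_⟩
  have h1 : T (h.mulVec (g.mulVec y)) ∈ T.symm ⁻¹' orbit ℂ n G y := by
    refine ⟨h * g, hG.2.1 _ hh _ hg, ?_⟩
    simp [Matrix.mulVec_mulVec]
  have h2 := Metric.infDist_le_dist_of_mem (x := 0) h1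
  rw [hmin, dist_zero_left, dist_zero_left] at h2
  rwa [hgz']

theorem re_inner_eq_zero_of_norm_le (hG : IsMatSubgroup ℂ n G) (hZ : IsZClosedSet G)
    {y : Fin n → ℂ} (hmin : ∀ h ∈ G, ‖T y‖ ≤ ‖T (h.mulVec y)‖)
    {A : Matrix (Fin n) (Fin n) ℂ} (hA : A ∈ tangentOne G) :
    (inner ℂ (T y) (T (A.mulVec y))).re = 0 := by
  let L : (Fin n → ℂ) →L[ℂ] EuclideanSpace ℂ (Fin n) :=
    LinearMap.toContinuousLinearMap T.toLinearMap
  have h1 : HasDerivAt (fun s : ℂ => T ((NormedSpace.exp (s • A)).mulVec y))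
      (T (A.mulVec y)) ((0 : ℝ) : ℂ) := by
    have := L.hasFDerivAt.comp_hasDerivAt ((0 : ℝ) : ℂ) (hasDerivAt_exp_mulVec A y ((0 : ℝ) : ℂ))
    simpa [Function.comp_def, L] using this
  have h2 : HasDerivAt (fun t : ℝ => T ((NormedSpace.exp ((t : ℂ) • A)).mulVec y))
      (T (A.mulVec y)) 0 := by
    have := h1.scomp (0 : ℝ) Complex.ofRealCLM.hasDerivAt
    simpa [Function.comp_def] using this
  have h3 := Complex.reCLM.hasFDerivAt.comp_hasDerivAt (0 : ℝ) (h2.inner ℂ h2)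
  have h4 : IsLocalMin (Complex.reCLM ∘ fun t : ℝ =>
      inner ℂ (T ((NormedSpace.exp ((t : ℂ) • A)).mulVec y))
        (T ((NormedSpace.exp ((t : ℂ) • A)).mulVec y))) 0 := by
    refine Filter.Eventually.of_forall fun t => ?_
    simp only [Function.comp_def, Complex.reCLM_apply, Complex.ofReal_zero, zero_smul,
      NormedSpace.exp_zero, Matrix.one_mulVec]
    have h5 := hmin _ (exp_smul_mem hG.1 hG.2.1 hZ hA (t : ℂ))
    have h6 := inner_self_eq_norm_sq (𝕜 := ℂ) (T y)
    have h7 := inner_self_eq_norm_sq (𝕜 := ℂ) (T ((NormedSpace.exp ((t : ℂ) • A)).mulVec y))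
    simp only [RCLike.re_to_complex] at h6 h7
    rw [h6, h7]
    gcongr
  have h5 := h4.hasDerivAt_eq_zero h3
  simp only [Complex.ofReal_zero, zero_smul, NormedSpace.exp_zero, Matrix.one_mulVec,
    Complex.reCLM_apply, Complex.add_re] at h5
  rw [← inner_conj_symm (T (A.mulVec y)), Complex.conj_re] at h5
  linarith

theorem inner_eq_zero_of_norm_le (hG : IsMatSubgroup ℂ n G) (hZ : IsZClosedSet G)
    {y : Fin n → ℂ} (hmin : ∀ h ∈ G, ‖T y‖ ≤ ‖T (h.mulVec y)‖)
    {A : Matrix (Fin n) (Fin n) ℂ} (hA : A ∈ tangentOne G) :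
    inner ℂ (T y) (T (A.mulVec y)) = 0 := by
  have h1 := re_inner_eq_zero_of_norm_le hG hZ hmin hA
  have h2 := re_inner_eq_zero_of_norm_le hG hZ hmin ((tangentOne G).smul_mem Complex.I hA)
  rw [Matrix.smul_mulVec, map_smul, inner_smul_right, Complex.I_mul_re, neg_eq_zero] at h2
  exact Complex.ext h1 h2

end MinimalVector

section GradientKernel

variable {n : ℕ} {K : Set (Matrix (Fin n) (Fin n) ℝ)} {G : Set (Matrix (Fin n) (Fin n) ℂ)}
  {T : (Fin n → ℂ) ≃ₗ[ℂ] EuclideanSpace ℂ (Fin n)}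

theorem Invariant.linSub_eq_self {p : MvPolynomial (Fin n) ℂ} (hp : Invariant ℂ n G p)
    {g : Matrix (Fin n) (Fin n) ℂ} (hg : g ∈ G) : linSub (Matrix.mulVecLin g) p = p := by
  refine MvPolynomial.funext fun v => ?_
  rw [eval_linSub]
  exact hp g hg v

theorem Invariant.polyDiff_mulVec {p : MvPolynomial (Fin n) ℂ} (hp : Invariant ℂ n G p)
    {g : Matrix (Fin n) (Fin n) ℂ} (hg : g ∈ G) (v x : Fin n → ℂ) :
    polyDiff p (g.mulVec v) (g.mulVec x) = polyDiff p v x := by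
  conv_rhs => rw [← hp.linSub_eq_self hg, polyDiff_linSub]
  rfl

theorem Invariant.polyDiff_eq_zero (hG : IsMatSubgroup ℂ n G) (hZ : IsZClosedSet G)
    {p : MvPolynomial (Fin n) ℂ} (hp : Invariant ℂ n G p) (v : Fin n → ℂ)
    {A : Matrix (Fin n) (Fin n) ℂ} (hA : A ∈ tangentOne G) :
    polyDiff p v (A.mulVec v) = 0 := by
  obtain ⟨c, hc0, hc, hcp⟩ : ∃ c : ℂ → Fin n → ℂ, c 0 = v ∧ HasDerivAt c (A.mulVec v) 0 ∧
      ∀ s, eval (c s) p = eval v p := by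
    refine ⟨fun s => (NormedSpace.exp (s • A)).mulVec v, ?_, ?_, fun s => ?_⟩
    · simp only [zero_smul, NormedSpace.exp_zero, Matrix.one_mulVec]
    · have h0 := hasDerivAt_exp_mulVec A v 0
      rwa [zero_smul, NormedSpace.exp_zero, Matrix.one_mulVec] at h0
    · exact hp _ (exp_smul_mem hG.1 hG.2.1 hZ hA s) v
  subst hc0
  have h1 : HasDerivAt (fun s => eval (c s) p) (polyDiff p (c 0) (A.mulVec (c 0))) 0 :=
    (hasFDerivAt_eval p (c 0)).comp_hasDerivAt 0 hc
  rw [funext hcp] at h1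
  exact h1.unique (hasDerivAt_const _ _)

/-- Vectors killed by the differentials at `v` of all invariants. -/
def gradKer (G : Set (Matrix (Fin n) (Fin n) ℂ)) (v : Fin n → ℂ) : Submodule ℂ (Fin n → ℂ) where
  carrier := {x | ∀ p, Invariant ℂ n G p → polyDiff p v x = 0}
  zero_mem' := fun p _ => map_zero _
  add_mem' := fun ha hb p hp => by rw [map_add, ha p hp, hb p hp, add_zero]
  smul_mem' := fun c x hx p hp => by rw [map_smul, hx p hp, smul_zero]

theorem mem_gradKer {v x : Fin n → ℂ} :
    x ∈ gradKer G v ↔ ∀ p, Invariant ℂ n G p → polyDiff p v x = 0 := Iff.rfl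

theorem map_evalAt_le_gradKer (hG : IsMatSubgroup ℂ n G) (hZ : IsZClosedSet G) (v : Fin n → ℂ) :
    (tangentOne G).map (evalAt v) ≤ gradKer G v := by
  rintro _ ⟨A, hA, rfl⟩ p hp
  exact hp.polyDiff_eq_zero hG hZ v hA

/-- At a vector of minimal norm whose isotropy fixes a complement of the orbit tangent space,
the invariants cut out exactly the orbit tangent space to first order. -/
theorem gradKer_le_of_minimal (hK : IsMatSubgroup ℝ n K) (hc : IsCompact K)
    (hT : IsUnitarization K T) {y : Fin n → ℂ}
    (hmin : ∀ h ∈ complexifiedGroup n K, ‖T y‖ ≤ ‖T (h.mulVec y)‖)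
    (hdec : ∀ x, ∃ A ∈ tangentOne (complexifiedGroup n K), ∃ u, x = A.mulVec y + u ∧
      ∀ h ∈ isotropy ℂ n (complexifiedGroup n K) y, h.mulVec u = u) :
    gradKer (complexifiedGroup n K) y ≤
      (tangentOne (complexifiedGroup n K)).map (evalAt y) := by
  have hG := isMatSubgroup_complexifiedGroup hK hc
  have hZ : IsZClosedSet (complexifiedGroup n K) := isZClosedSet_complexifiedGroup
  set S := (tangentOne (complexifiedGroup n K)).map (evalAt y) with hS
  have hcA : ∀ A ∈ tangentOne K, cMat A ∈ tangentOne (complexifiedGroup n K) := fun A hA => by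
    have := mem_tangentOne_complexifiedGroup.mpr ⟨hA, (tangentOne K).zero_mem⟩
    simpa using this
  intro x hx
  obtain ⟨a, ha, b, hb, hab⟩ := (S.map T.toLinearMap).exists_add_mem_mem_orthogonal (T x)
  obtain ⟨a, haS, rfl⟩ := ha
  have hxb : T (x - a) = b := by
    rw [map_sub, hab]
    exact add_sub_cancel_left _ _
  have hbS : ∀ s ∈ S, inner ℂ (T (x - a)) (T s) = 0 := fun s hs => by
    rw [hxb]
    exact (Submodule.mem_orthogonal' _ _).mp hb _ ⟨s, hs, rfl⟩
  have hker : x - a ∈ gradKer (complexifiedGroup n K) y :=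
    Submodule.sub_mem _ hx (map_evalAt_le_gradKer hG hZ y haS)
  suffices h0 : x - a = 0 by rwa [sub_eq_zero.mp h0]
  refine eq_zero_of_polyDiff_invariant_eq_zero hT hK hc
    (fun A hA => inner_eq_zero_of_norm_le hG hZ hmin (hcA A hA))
    (fun A hA => hbS _ ⟨_, hcA A hA, rfl⟩) (fun k hk hky => ?_) (mem_gradKer.mp hker)
  obtain ⟨A, hA, u, hu, hfix⟩ := hdec (x - a)
  have hkG := cMat_mem hk
  have hstab : ∀ s ∈ S, (cMat k).mulVec s ∈ S := by
    rintro _ ⟨B, hB, rfl⟩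
    refine ⟨cMat k * B * (cMat k)⁻¹, conj_mem_tangentOne hG hZ hB hkG, ?_⟩
    rw [evalAt_apply, evalAt_apply]
    conv_lhs => rw [← hky]
    rw [Matrix.mulVec_mulVec, Matrix.mul_assoc, Matrix.nonsing_inv_mul, Matrix.mul_one,
      Matrix.mulVec_mulVec]
    exact (Matrix.isUnit_iff_isUnit_det _).mp (hG.2.2 _ hkG).1
  have hmem : (cMat k).mulVec (x - a) - (x - a) ∈ S := by
    have hAy : A.mulVec y ∈ S := ⟨A, hA, rfl⟩
    have : (cMat k).mulVec (x - a) - (x - a) = (cMat k).mulVec (A.mulVec y) - A.mulVec y := by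
      conv_lhs => rw [hu, Matrix.mulVec_add, hfix _ ⟨hkG, hky⟩]
      abel
    rw [this]
    exact S.sub_mem (hstab _ hAy) hAy
  have hnorm : ∀ s ∈ S, inner ℂ (T ((cMat k).mulVec (x - a))) (T s) = 0 := fun s hs => by
    obtain ⟨hku, hki⟩ := hK.2.2 k hk
    have hkd := (Matrix.isUnit_iff_isUnit_det _).mp hku
    have hs' : (cMat k⁻¹).mulVec s ∈ S := by
      obtain ⟨B, hB, rfl⟩ := hs
      have hkyi : (cMat k⁻¹).mulVec y = y := by
        conv_lhs => rw [← hky]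
        rw [Matrix.mulVec_mulVec, ← map_mul, Matrix.nonsing_inv_mul _ hkd, map_one,
          Matrix.one_mulVec]
      refine ⟨cMat k⁻¹ * B * cMat k, ?_, ?_⟩
      · have := conj_mem_tangentOne hG hZ hB (cMat_mem hki)
        rwa [Matrix.inv_eq_right_inv (B := cMat k)] at this
        rw [← map_mul, Matrix.nonsing_inv_mul _ hkd, map_one]
      · rw [evalAt_apply, evalAt_apply, ← Matrix.mulVec_mulVec, hky, Matrix.mulVec_mulVec]
    have h2 : (cMat k).mulVec ((cMat k⁻¹).mulVec s) = s := by
      rw [Matrix.mulVec_mulVec, ← map_mul, Matrix.mul_nonsing_inv _ hkd, map_one,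
        Matrix.one_mulVec]
    rw [← h2, hT k hk]
    exact hbS _ hs'
  have h0 : T ((cMat k).mulVec (x - a) - (x - a)) = 0 := by
    rw [← inner_self_eq_zero (𝕜 := ℂ)]
    conv_lhs => rw [map_sub, inner_sub_left]
    rw [← map_sub, hnorm _ hmem, hbS _ hmem, sub_zero]
  exact sub_eq_zero.mp (T.map_eq_zero_iff.mp h0)

theorem gradKer_le_of_isPrincipalPt (hK : IsMatSubgroup ℝ n K) (hc : IsCompact K)
    {y : Fin n → ℂ} (hy : IsPrincipalPt ℂ n (complexifiedGroup n K) y) :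
    gradKer (complexifiedGroup n K) y ≤
      (tangentOne (complexifiedGroup n K)).map (evalAt y) := by
  have hG := isMatSubgroup_complexifiedGroup hK hc
  have hZ : IsZClosedSet (complexifiedGroup n K) := isZClosedSet_complexifiedGroup
  obtain ⟨T, hT⟩ := exists_isUnitarization hK hc
  obtain ⟨hcl, N, hN, htriv⟩ := hy
  obtain ⟨g, hg, hmin⟩ := hcl.exists_norm_le hG T
  obtain ⟨hgu, hgi⟩ := hG.2.2 g hg
  have hgd := (Matrix.isUnit_iff_isUnit_det _).mp hgu
  have hgg : ∀ v, g.mulVec (g⁻¹.mulVec v) = v := fun v => by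
    rw [Matrix.mulVec_mulVec, Matrix.mul_nonsing_inv _ hgd, Matrix.one_mulVec]
  have hgg' : ∀ v, g⁻¹.mulVec (g.mulVec v) = v := fun v => by
    rw [Matrix.mulVec_mulVec, Matrix.nonsing_inv_mul _ hgd, Matrix.one_mulVec]
  have hmain := gradKer_le_of_minimal hK hc hT hmin fun x => by
    have htop : g⁻¹.mulVec x ∈ (tangentOne (complexifiedGroup n K)).map (evalAt y) ⊔ N := by
      rw [← orbitTangent_eq hG.1 hG.2.1 hZ, hN.1.sup_eq_top]
      trivial
    obtain ⟨_, ⟨A, hA, rfl⟩, u, hu, hAu⟩ := Submodule.mem_sup.mp htop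
    refine ⟨g * A * g⁻¹, conj_mem_tangentOne hG hZ hA hg, g.mulVec u, ?_, fun h hh => ?_⟩
    · rw [← Matrix.mulVec_mulVec, hgg', ← Matrix.mulVec_mulVec, ← Matrix.mulVec_add]
      rw [evalAt_apply] at hAu
      rw [hAu, hgg]
    · have := htriv (g⁻¹ * h * g) ⟨hG.2.1 _ (hG.2.1 _ hgi _ hh.1) _ hg, by
        rw [← Matrix.mulVec_mulVec, ← Matrix.mulVec_mulVec, hh.2, hgg']⟩ u hu
      rw [← Matrix.mulVec_mulVec, ← Matrix.mulVec_mulVec] at this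
      rw [← hgg (h.mulVec _), this]
  intro x hx
  obtain ⟨A, hA, hAx⟩ := hmain (x := g.mulVec x) fun p hp => by
    rw [hp.polyDiff_mulVec hg]
    exact hx p hp
  refine ⟨g⁻¹ * A * g, ?_, ?_⟩
  · have := conj_mem_tangentOne hG hZ hA hgi
    rwa [Matrix.nonsing_inv_nonsing_inv _ hgd] at this
  · rw [evalAt_apply] at hAx ⊢
    rw [← Matrix.mulVec_mulVec, ← Matrix.mulVec_mulVec, hAx, hgg']

end GradientKernel

end ZPaper

namespace ZPaper

section GenericPrincipal

variable {n : ℕ} {K : Set (Matrix (Fin n) (Fin n) ℝ)} {G : Set (Matrix (Fin n) (Fin n) ℂ)}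

theorem finrank_gradKer_add (v : Fin n → ℂ) :
    Module.finrank ℂ (gradKer G v) + Module.finrank ℂ (Submodule.span ℂ (Set.range
      fun p : {p // Invariant ℂ n G p} => fun j => eval v (pderiv j p.1))) = n := by
  set B : LinearMap.BilinForm ℂ (Fin n → ℂ) := Matrix.toBilin' 1
  set S := Submodule.span ℂ (Set.range
      fun p : {p // Invariant ℂ n G p} => fun j => eval v (pderiv j p.1))
  have hB : ∀ x u, B x u = x ⬝ᵥ u := fun x u => by
    rw [Matrix.toBilin'_apply', Matrix.one_mulVec]
  have hnd : B.Nondegenerate :=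
    LinearMap.BilinForm.nondegenerate_toBilin'_of_det_ne_zero' _ (by simp)
  have hrefl : B.IsRefl := fun x u h => by rw [hB, dotProduct_comm, ← hB, h]
  have h1 := LinearMap.BilinForm.finrank_orthogonal hnd S
  have h2 : B.orthogonal S = gradKer G v := by
    ext x
    rw [LinearMap.BilinForm.mem_orthogonal_iff, mem_gradKer]
    constructor
    · intro h p hp
      have := h _ (Submodule.subset_span ⟨⟨p, hp⟩, rfl⟩)
      rw [hB] at this
      rw [polyDiff_apply]
      exact this
    · intro h s hs
      induction hs using Submodule.span_induction with
      | mem s hs =>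
        obtain ⟨p, rfl⟩ := hs
        rw [hB]
        exact (polyDiff_apply _ _ _).symm.trans (h p.1 p.2)
      | zero => simp
      | add a b _ _ ha hb => rw [map_add, LinearMap.add_apply, ha, hb, add_zero]
      | smul c a _ ha => rw [map_smul, LinearMap.smul_apply, ha, smul_zero]
  have h3 := S.finrank_le
  rw [h2] at h1
  rw [Module.finrank_fin_fun] at h1 h3
  omega

theorem exists_poly_gradKer_le (hK : IsMatSubgroup ℝ n K) (hc : IsCompact K)
    {y : Fin n → ℂ} (hy : IsPrincipalPt ℂ n (complexifiedGroup n K) y) :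
    ∃ f : MvPolynomial (Fin n) ℂ, eval y f ≠ 0 ∧ ∀ v, eval v f ≠ 0 →
      gradKer (complexifiedGroup n K) v ≤
        (tangentOne (complexifiedGroup n K)).map (evalAt v) := by
  obtain ⟨f, hfy, hf⟩ := exists_poly_finrank_map_le (tangentOne (complexifiedGroup n K)) y
  obtain ⟨g, hgy, hg⟩ := exists_poly_finrank_le
    (fun (p : {p // Invariant ℂ n (complexifiedGroup n K) p}) j => pderiv j p.1) y
  refine ⟨f * g, by simp [hfy, hgy], fun v hv => ?_⟩
  rw [map_mul, mul_ne_zero_iff] at hv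
  have h1 := hf v hv.1
  have h2 := hg v hv.2
  have h3 := finrank_gradKer_add (G := complexifiedGroup n K) y
  have h4 := finrank_gradKer_add (G := complexifiedGroup n K) v
  have h5 := Submodule.finrank_mono (gradKer_le_of_isPrincipalPt hK hc hy)
  refine (Submodule.eq_of_le_of_finrank_le (map_evalAt_le_gradKer
    (isMatSubgroup_complexifiedGroup hK hc) isZClosedSet_complexifiedGroup v) ?_).ge
  omega

theorem isPrincipalPt_of_gradKer_le (hK : IsMatSubgroup ℝ n K) (hc : IsCompact K)
    {w : Fin n → ℝ} (hw : gradKer (complexifiedGroup n K) (cv w) ≤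
      (tangentOne (complexifiedGroup n K)).map (evalAt (cv w))) :
    IsPrincipalPt ℝ n K w := by
  obtain ⟨N, hN, -⟩ := exists_sliceComplement_real hK hc w
  refine ⟨hasClosedOrbit_real hK hc w, N, hN, fun k hk x hx => ?_⟩
  have hsub : cv (k.mulVec x - x) = (cMat k).mulVec (cv x) - cv x := by
    rw [cMat_mulVec]
    ext i
    simp [cv_apply]
  have h1 : cv (k.mulVec x - x) ∈ gradKer (complexifiedGroup n K) (cv w) := fun p hp => by
    have hkw : (cMat k).mulVec (cv w) = cv w := by rw [cMat_mulVec, hk.2]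
    have h2 := hp.polyDiff_mulVec (cMat_mem hk.1) (cv w) (cv x)
    rw [hkw] at h2
    rw [hsub, map_sub, h2, sub_self]
  have h2 := hw h1
  rw [map_evalAt_cv, ← orbitTangent_eq hK.1 hK.2.1 (isZClosedSet_of_isCompact hK hc)] at h2
  have h3 : k.mulVec x - x ∈ orbitTangent ℝ n K w := by
    have := (mem_cpl.mp h2).1
    exact this
  exact sub_eq_zero.mp (Submodule.disjoint_def.mp hN.1.disjoint _ h3
    (N.sub_mem (hN.2 k hk x hx) hx))

theorem exists_poly_isPrincipalPt (hK : IsMatSubgroup ℝ n K) (hc : IsCompact K)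
    {y : Fin n → ℂ} (hy : IsPrincipalPt ℂ n (complexifiedGroup n K) y) :
    ∃ f : MvPolynomial (Fin n) ℂ, eval y f ≠ 0 ∧
      ∀ w : Fin n → ℝ, eval (cv w) f ≠ 0 → IsPrincipalPt ℝ n K w := by
  obtain ⟨f, hfy, hf⟩ := exists_poly_gradKer_le hK hc hy
  exact ⟨f, hfy, fun w hw => isPrincipalPt_of_gradKer_le hK hc (hf _ hw)⟩

end GenericPrincipal

section Density

variable {n : ℕ} {X A : Set (Fin n → ℝ)} {B : Set (Fin n → ℂ)}

theorem eval_eq_zero_of_complexification {p : MvPolynomial (Fin n) ℂ}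
    (hp : ∀ w ∈ X, eval (cv w) p = 0) : ∀ y ∈ complexification n X, eval y p = 0 := by
  refine fun y hy => hy p ?_
  rintro _ ⟨w, hw, rfl⟩
  exact hp w hw

theorem cv_mem_complexification {w : Fin n → ℝ} (hw : w ∈ X) : cv w ∈ complexification n X :=
  fun _ hp => hp _ ⟨w, hw, rfl⟩

/-- A real and a complex locus have simultaneously dense traces on `X` and on `X_ℂ` as soon as
the complex locus contains the real one and each of its points has a Zariski neighbourhood whose
real points lie in the real locus. -/
theorem zDenseIn_iff_complexification (hAB : ∀ w ∈ A, cv w ∈ B)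
    (hBA : ∀ y ∈ B, ∃ f : MvPolynomial (Fin n) ℂ, eval y f ≠ 0 ∧
      ∀ w : Fin n → ℝ, eval (cv w) f ≠ 0 → w ∈ A) :
    ZDenseIn ℝ n (X ∩ A) X ↔
      ZDenseIn ℂ n (complexification n X ∩ B) (complexification n X) := by
  constructor
  · intro h p hp
    obtain ⟨p₁, p₂, rfl⟩ := exists_re_im p
    have h0 : ∀ w, eval (cv w) (cPoly p₁ + C Complex.I * cPoly p₂) = 0 ↔
        eval w p₁ = 0 ∧ eval w p₂ = 0 := fun w => by
      rw [map_add, map_mul, eval_C, eval_cPoly, eval_cPoly, ofReal_add_I_mul_eq_zero]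
    have h1 : ∀ w ∈ X ∩ A, eval w p₁ = 0 ∧ eval w p₂ = 0 := fun w hw =>
      (h0 w).mp (hp _ ⟨cv_mem_complexification hw.1, hAB w hw.2⟩)
    exact eval_eq_zero_of_complexification fun w hw => (h0 w).mpr
      ⟨h p₁ (fun a ha => (h1 a ha).1) w hw, h p₂ (fun a ha => (h1 a ha).2) w hw⟩
  · intro h p hp w hw
    have h1 := h (cPoly p) (fun y hy => by
      obtain ⟨f, hfy, hf⟩ := hBA y hy.2
      have h2 := eval_eq_zero_of_complexification (X := X) (p := cPoly p * f)
        (fun u hu => by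
          rw [map_mul, eval_cPoly]
          by_cases hfu : eval (cv u) f = 0
          · rw [hfu, mul_zero]
          · rw [hp u ⟨hu, hf u hfu⟩, Complex.ofReal_zero, zero_mul]) y hy.1
      rw [map_mul] at h2
      exact (mul_eq_zero.mp h2).resolve_right hfy) _ (cv_mem_complexification hw)
    rw [eval_cPoly] at h1
    exact_mod_cast h1

end Density

end ZPaper

namespace ZPaper

/-- **Theorem 1.3(3).** Let `K` be a compact Lie group (realized as a compact subgroup of
`GL_n(ℝ)`) and `X ⊆ W = ℝⁿ` a `K`-stable real algebraic set, with complexification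
`Y = X_ℂ ⊆ ℂⁿ` acted on by `G = K_ℂ`.  Then `X_apr` (resp. `X_pr`) is Zariski dense in `X`
if and only if `Y_apr` (resp. `Y_pr`) is Zariski dense in `Y`. -/
theorem apr_dense_iff_complexification_apr_dense
    (n : ℕ) (K : Set (Matrix (Fin n) (Fin n) ℝ))
    (hKgrp : IsMatSubgroup ℝ n K) (hKcpt : IsCompact K)
    (X : Set (Fin n → ℝ)) (hXalg : IsAlgebraicSet ℝ n X) (hXstab : Stabilizes ℝ n K X) :
    (ZDenseIn ℝ n (X ∩ aprPoints ℝ n K) X ↔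
      ZDenseIn ℂ n
        (complexification n X ∩ aprPoints ℂ n (complexifiedGroup n K))
        (complexification n X)) ∧
    (ZDenseIn ℝ n (X ∩ prPoints ℝ n K) X ↔
      ZDenseIn ℂ n
        (complexification n X ∩ prPoints ℂ n (complexifiedGroup n K))
        (complexification n X)) := by
  refine ⟨zDenseIn_iff_complexification ?_ fun y hy =>
      exists_poly_isAlmostPrincipalPt hKgrp hKcpt hy,
    zDenseIn_iff_complexification ?_ fun y hy => exists_poly_isPrincipalPt hKgrp hKcpt hy⟩
  · rintro w ⟨-, N, hN, hf⟩
    exact ⟨hasClosedOrbit_complexifiedGroup hKgrp hKcpt w, cpl N,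
      isSliceComplement_cpl hKgrp hKcpt hN hf, hasFiniteImageOn_cpl hKgrp hKcpt hf⟩
  · rintro w ⟨-, N, hN, ht⟩
    exact ⟨hasClosedOrbit_complexifiedGroup hKgrp hKcpt w, cpl N,
      isSliceComplement_cpl hKgrp hKcpt hN (hasFiniteImageOn_of_actsTriviallyOn ht),
      actsTriviallyOn_cpl hKgrp hKcpt ht⟩

end ZPaper
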